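/- Let H(τ) := 2(θ₂(τ)⁴ − θ₄(τ)⁴)/η(τ)³ − (24/θ₃(τ)) ∑_{n∈ℤ} q^{n²/2 − 1/8}/(1 + q^{n−1/2}) be the Mathieu moonshine q-series H^{(2)}, and define its completion Ĥ(τ) := H(τ) − 12 i ∫_{−τ̄}^{i∞} η(w)³ (−i(w+τ))^{−1/2} dw. Then Ĥ transforms as a non-holomorphic modular form of weight (1/2, 0) for SL(2,ℤ): for all τ ∈ ℍ, Ĥ(τ+1) = e^{−πi/4} Ĥ(τ) and Ĥ(−1/τ) = −√(−iτ) Ĥ(τ), with the principal branch of the square root. -/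

import Mathlib

open Complex MeasureTheory

noncomputable section

/-- `e^{2πiτs}`, i.e. `q^s` for `q = e^{2πiτ}`. -/
def qp (τ s : ℂ) : ℂ := Complex.exp (2 * (Real.pi : ℂ) * Complex.I * τ * s)

/-- Jacobi theta constant `θ₂(τ) = ∑_{r∈ℤ+1/2} q^{r²/2}`. -/
def theta2 (τ : ℂ) : ℂ := ∑' n : ℤ, qp τ (((n : ℂ) + 1 / 2) ^ 2 / 2)

/-- Jacobi theta constant `θ₃(τ) = ∑_{n∈ℤ} q^{n²/2}`. -/
def theta3 (τ : ℂ) : ℂ := ∑' n : ℤ, qp τ ((n : ℂ) ^ 2 / 2)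

/-- Jacobi theta constant `θ₄(τ) = ∑_{n∈ℤ} (−1)ⁿ q^{n²/2}`. -/
def theta4 (τ : ℂ) : ℂ := ∑' n : ℤ, (-1 : ℂ) ^ n * qp τ ((n : ℂ) ^ 2 / 2)

/-- Dedekind eta function `η(τ) = q^{1/24} ∏_{n≥1}(1 − qⁿ)`. -/
def etaDedekind (τ : ℂ) : ℂ :=
  Complex.exp ((Real.pi : ℂ) * Complex.I * τ / 12) * ∏' n : ℕ, (1 - qp τ ((n : ℂ) + 1))

/-- The Mathieu moonshine q-series
`H(τ) = 2(θ₂⁴ − θ₄⁴)/η³ − (24/θ₃) ∑_{n∈ℤ} q^{n²/2−1/8}/(1 + q^{n−1/2})`. -/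
def H0 (τ : ℂ) : ℂ :=
  2 * (theta2 τ ^ 4 - theta4 τ ^ 4) / etaDedekind τ ^ 3 -
    (24 / theta3 τ) *
      ∑' n : ℤ, qp τ ((n : ℂ) ^ 2 / 2 - 1 / 8) / (1 + qp τ ((n : ℂ) - 1 / 2))

/-- The Eichler integral `∫_{−τ̄}^{i∞} η(w)³ (−i(w+τ))^{−1/2} dw`, taken along the
vertical path `w = −τ̄ + it`, `t ∈ (0,∞)`, with the principal branch. -/
def eichler (τ : ℂ) : ℂ :=
  ∫ t in Set.Ioi (0 : ℝ),
    (etaDedekind (-(starRingEnd ℂ) τ + Complex.I * (t : ℂ))) ^ 3 *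
      (-Complex.I * ((-(starRingEnd ℂ) τ + Complex.I * (t : ℂ)) + τ)) ^ (-(1 / 2) : ℂ) *
      Complex.I

/-- The non-holomorphic completion `Ĥ(τ) = H(τ) − 12i ∫_{−τ̄}^{i∞} η(w)³(−i(w+τ))^{−1/2} dw`. -/
def Hhat (τ : ℂ) : ℂ := H0 τ - 12 * Complex.I * eichler τ

section

def sqI (τ : ℂ) : ℂ := (-I * τ) ^ ((1 : ℂ) / 2)

lemma re_negI_mul {τ : ℂ} (h : 0 < τ.im) : 0 < (-I * τ).re := by simpa using h

lemma negI_ne {τ : ℂ} (h : 0 < τ.im) : -I * τ ≠ 0 := by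
  intro h0
  have := re_negI_mul h
  rw [h0] at this
  simp at this

lemma tau_ne {τ : ℂ} (h : 0 < τ.im) : τ ≠ 0 := by
  rintro rfl
  simp at h

lemma cpow_half_sq (z : ℂ) : (z ^ ((1 : ℂ) / 2)) ^ 2 = z := by
  rw [← cpow_nat_mul]
  norm_num

lemma cpow_half_re_pos {z : ℂ} (hz : z ∈ slitPlane) : 0 < (z ^ ((1 : ℂ) / 2)).re := by
  have h0 : z ≠ 0 := slitPlane_ne_zero hz
  rw [cpow_def_of_ne_zero h0, exp_re]
  apply mul_pos (Real.exp_pos _)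
  have h1 : (log z * (1 / 2)).im = arg z / 2 := by
    rw [show log z * (1/2) = log z / 2 by ring]
    simp [log_im]
  rw [h1]
  have h2 := neg_pi_lt_arg z
  have h3 := arg_lt_pi_iff.2 (by
    rcases hz with h | h
    · exact Or.inl h.le
    · exact Or.inr h : 0 ≤ z.re ∨ z.im ≠ 0)
  apply Real.cos_pos_of_mem_Ioo
  constructor <;> linarith

lemma eq_of_sq_eq_re_pos {a b : ℂ} (h : a ^ 2 = b ^ 2) (ha : 0 < a.re) (hb : 0 < b.re) : a = b := by
  rcases sq_eq_sq_iff_eq_or_eq_neg.1 h with h | h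
  · exact h
  · rw [h] at ha
    simp at ha
    linarith

lemma sqI_sq {τ : ℂ} (h : 0 < τ.im) : sqI τ ^ 2 = -I * τ := cpow_half_sq _
lemma sqI_ne {τ : ℂ} (h : 0 < τ.im) : sqI τ ≠ 0 := by
  intro h0
  have := sqI_sq h
  rw [h0] at this
  exact negI_ne h (by rw [← this]; simp)
lemma sqI_re_pos {τ : ℂ} (h : 0 < τ.im) : 0 < (sqI τ).re :=
  cpow_half_re_pos (Or.inl (re_negI_mul h))

lemma im_S {τ : ℂ} (h : 0 < τ.im) : 0 < (-1 / τ).im := by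
  have := UpperHalfPlane.im_inv_neg_coe_pos ⟨τ, h⟩
  simpa [neg_div, inv_neg] using this

lemma sqI_S {τ : ℂ} (h : 0 < τ.im) : sqI (-1 / τ) = (sqI τ)⁻¹ := by
  apply eq_of_sq_eq_re_pos
  · rw [inv_pow, sqI_sq h, sqI_sq (im_S h)]
    field_simp [tau_ne h]
    simp
  · exact sqI_re_pos (im_S h)
  · rw [inv_re]
    exact div_pos (sqI_re_pos h) (normSq_pos.2 (sqI_ne h))

lemma diff_sq {τ : ℂ} (h : 0 < τ.im) : DifferentiableAt ℂ sqI τ := by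
  unfold sqI
  apply DifferentiableAt.cpow_const (by fun_prop)
  exact Or.inl (re_negI_mul h)

lemma eta_eq (τ : ℂ) : etaDedekind τ = ModularForm.eta τ := by
  unfold etaDedekind ModularForm.eta
  congr 1
  · simp only [Function.Periodic.qParam]
    congr 1
    push_cast
    ring
  · apply tprod_congr
    intro n
    rw [ModularForm.eta_q_eq_cexp, qp]
    congr 2
    ring

lemma eta_ne {τ : ℂ} (h : 0 < τ.im) : etaDedekind τ ≠ 0 := by
  rw [eta_eq]; exact ModularForm.eta_ne_zero h

lemma diff_eta {τ : ℂ} (h : 0 < τ.im) : DifferentiableAt ℂ etaDedekind τ := by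
  rw [show etaDedekind = ModularForm.eta from funext eta_eq]
  exact ModularForm.differentiableAt_eta_of_mem_upperHalfPlaneSet h

lemma eta_S {τ : ℂ} (h : 0 < τ.im) : etaDedekind (-1 / τ) = sqI τ * etaDedekind τ := by
  have h1 := ModularForm.eta_comp_eq_csqrt_I_inv h
  simp only [Function.comp, Pi.smul_apply, Pi.mul_apply, smul_eq_mul] at h1
  rw [eta_eq, eta_eq, h1, ← mul_assoc]
  congr 1
  rw [inv_mul_eq_iff_eq_mul₀ (by simp [Complex.sqrt])]
  have h2 : Complex.log (I * (-I * τ)) = Complex.log I + Complex.log (-I * τ) := by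
    apply Complex.log_mul I_ne_zero (negI_ne h)
    have := (Complex.abs_arg_lt_pi_div_two_iff.2 (Or.inl (re_negI_mul h)))
    rw [abs_lt] at this
    rw [arg_I]
    constructor <;> linarith [Real.pi_pos]
  have h3 : I * (-I * τ) = τ := by rw [← mul_assoc]; simp
  rw [h3] at h2
  rw [sqI, Complex.sqrt, Complex.sqrt, cpow_def_of_ne_zero (tau_ne h), cpow_def_of_ne_zero I_ne_zero, h2,
    cpow_def_of_ne_zero (negI_ne h), ← Complex.exp_add]
  congr 1
  ring

lemma eta_T (τ : ℂ) : etaDedekind (τ + 1) = exp (Real.pi * I / 12) * etaDedekind τ := by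
  unfold etaDedekind
  rw [← mul_assoc, ← Complex.exp_add]
  congr 1
  · congr 1
    ring
  · apply tprod_congr
    intro n
    unfold qp
    congr 1
    rw [show 2 * (Real.pi : ℂ) * I * (τ + 1) * (n + 1) = 2 * (Real.pi : ℂ) * I * τ * (n + 1)
      + ((n + 1 : ℤ) : ℂ) * (2 * Real.pi * I) by push_cast; ring, exp_periodic.int_mul]

lemma theta3_eq (τ : ℂ) : theta3 τ = jacobiTheta₂ 0 τ := by
  unfold theta3 jacobiTheta₂ jacobiTheta₂_term qp
  apply tsum_congr; intro n; congr 1; ring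

lemma neg_one_zpow_exp (n : ℤ) : (-1 : ℂ) ^ n = exp (Real.pi * I * n) := by
  rw [← Complex.exp_pi_mul_I, ← Complex.exp_int_mul]
  congr 1; ring

lemma theta4_eq (τ : ℂ) : theta4 τ = jacobiTheta₂ (1/2) τ := by
  unfold theta4 jacobiTheta₂ jacobiTheta₂_term qp
  apply tsum_congr; intro n
  rw [neg_one_zpow_exp, ← Complex.exp_add]
  congr 1; ring

lemma theta2_eq (τ : ℂ) : theta2 τ = exp (Real.pi * I * τ / 4) * jacobiTheta₂ (τ/2) τ := by
  unfold theta2 jacobiTheta₂ jacobiTheta₂_term qp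
  rw [← tsum_mul_left]
  apply tsum_congr; intro n
  rw [← Complex.exp_add]
  congr 1; ring

lemma theta3_S {τ : ℂ} (h : 0 < τ.im) : theta3 (-1/τ) = sqI τ * theta3 τ := by
  rw [theta3_eq, theta3_eq, jacobiTheta₂_functional_equation 0 τ]
  have := sqI_ne h
  rw [show ((-I * τ) ^ (1/2 : ℂ)) = sqI τ from rfl]
  simp
  field_simp

lemma theta2_S {τ : ℂ} (h : 0 < τ.im) : theta2 (-1/τ) = sqI τ * theta4 τ := by
  rw [theta2_eq, theta4_eq, jacobiTheta₂_functional_equation (1/2) τ]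
  have := sqI_ne h
  have h0 := tau_ne h
  rw [show ((-I * τ) ^ (1/2 : ℂ)) = sqI τ from rfl]
  have e1 : -1/τ/2 = -(1/2/τ) := by field_simp
  rw [e1, jacobiTheta₂_neg_left]
  have e2 : Real.pi * I * (-1/τ) / 4 = -Real.pi * I * (1/2)^2/τ := by field_simp; norm_num
  rw [e2]
  field_simp

lemma S_S {τ : ℂ} (h : 0 < τ.im) : -1/(-1/τ) = τ := by
  have := tau_ne h
  field_simp

lemma theta4_S {τ : ℂ} (h : 0 < τ.im) : theta4 (-1/τ) = sqI τ * theta2 τ := by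
  have := theta2_S (im_S h)
  rw [S_S h, sqI_S h] at this
  rw [this]
  field_simp [sqI_ne h]

lemma exp_two_pi_int (n : ℤ) (z : ℂ) : exp (z + 2 * Real.pi * I * n) = exp z := by
  rw [show z + 2 * Real.pi * I * n = z + n * (2 * Real.pi * I) by ring]
  exact exp_periodic.int_mul n z

lemma theta3_T (τ : ℂ) : theta3 (τ+1) = theta4 τ := by
  unfold theta3 theta4 qp
  apply tsum_congr; intro n
  rw [neg_one_zpow_exp, ← Complex.exp_add]
  obtain ⟨k, hk⟩ := Int.even_mul_succ_self n
  rw [← exp_two_pi_int (-(k-n))]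
  congr 1
  have : (n : ℂ) * (n + 1) = k + k := by exact_mod_cast hk
  push_cast
  linear_combination Real.pi * I * this

lemma theta4_T (τ : ℂ) : theta4 (τ+1) = theta3 τ := by
  unfold theta3 theta4 qp
  apply tsum_congr; intro n
  rw [neg_one_zpow_exp, ← Complex.exp_add]
  obtain ⟨k, hk⟩ := Int.even_mul_succ_self n
  rw [← exp_two_pi_int (-k)]
  congr 1
  have : (n : ℂ) * (n + 1) = k + k := by exact_mod_cast hk
  push_cast
  linear_combination Real.pi * I * this

lemma theta2_T (τ : ℂ) : theta2 (τ+1) = exp (Real.pi * I / 4) * theta2 τ := by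
  unfold theta2 qp
  rw [← tsum_mul_left]
  apply tsum_congr; intro n
  rw [← Complex.exp_add]
  obtain ⟨k, hk⟩ := Int.even_mul_succ_self n
  rw [← exp_two_pi_int (-k)]
  congr 1
  have : (n : ℂ) * (n + 1) = k + k := by exact_mod_cast hk
  push_cast
  linear_combination Real.pi * I * this

lemma diff_theta3 {τ : ℂ} (h : 0 < τ.im) : DifferentiableAt ℂ theta3 τ := by
  rw [show theta3 = jacobiTheta₂ 0 from funext theta3_eq]
  exact differentiableAt_jacobiTheta₂_snd 0 h

lemma diff_theta4 {τ : ℂ} (h : 0 < τ.im) : DifferentiableAt ℂ theta4 τ := by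
  rw [show theta4 = jacobiTheta₂ (1/2) from funext theta4_eq]
  exact differentiableAt_jacobiTheta₂_snd _ h

lemma diff_theta2 {τ : ℂ} (h : 0 < τ.im) : DifferentiableAt ℂ theta2 τ := by
  rw [show theta2 = fun τ => exp (Real.pi * I * τ / 4) * jacobiTheta₂ (τ/2) τ from funext theta2_eq]
  apply DifferentiableAt.mul (by fun_prop)
  have h1 := (hasFDerivAt_jacobiTheta₂ (τ/2) h).differentiableAt
  exact DifferentiableAt.comp (f := fun t : ℂ => (t/2, t)) τ h1 (by fun_prop)

end

section

open Filter Topology ModularGroup ModularForm MatrixGroups in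
lemma levelOne_const (f : ℂ → ℂ) (hd : ∀ z : ℂ, 0 < z.im → DifferentiableAt ℂ f z)
    (hT : ∀ z : ℂ, 0 < z.im → f (z + 1) = f z) (hS : ∀ z : ℂ, 0 < z.im → f (-1 / z) = f z)
    (c : ℂ) (hc : Tendsto f (comap im atTop ⊓ 𝓟 {z | |z.re| ≤ 1}) (𝓝 c)) :
    ∀ z : ℂ, 0 < z.im → f z = c := by
  let F : UpperHalfPlane → ℂ := fun z => f z
  have hTn : ∀ n : ℤ, ∀ z : ℂ, 0 < z.im → f (z + n) = f z := by
    intro n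
    induction n using Int.induction_on with
    | zero => simp
    | succ n ih =>
      intro z hz
      have := hT (z + n) (by simpa using hz)
      push_cast
      rw [← add_assoc, this]
      exact_mod_cast ih z hz
    | pred n ih =>
      intro z hz
      have := hT (z + (-n - 1)) (by simpa using hz)
      push_cast
      rw [← this]
      have := ih z hz
      push_cast at this
      rw [← this]
      congr 1; ring
  have hFS : F ∣[(0 : ℤ)] S = F := by
    ext z
    rw [SL_slash_apply, UpperHalfPlane.modular_S_smul]
    simp only [F, neg_zero, zpow_zero, mul_one]
    rw [← hS z z.2]
    congr 1
    simp [neg_div, inv_neg]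
  have hFT : F ∣[(0 : ℤ)] T = F := by
    ext z
    rw [SL_slash_apply, UpperHalfPlane.modular_T_smul]
    simp only [F, neg_zero, zpow_zero, mul_one]
    rw [← hT z z.2]
    congr 1
    simp [add_comm]
  have hinv := SlashInvariantForm.slash_action_generators_SL2Z hFS hFT
  have hbd : UpperHalfPlane.IsBoundedAtImInfty F := by
    rw [UpperHalfPlane.isBoundedAtImInfty_iff]
    have h1 := hc.norm.eventually (gt_mem_nhds (lt_add_one ‖c‖))
    rw [eventually_inf_principal, eventually_comap] at h1
    obtain ⟨A, hA⟩ := eventually_atTop.1 h1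
    refine ⟨‖c‖ + 1, A, fun z hz => ?_⟩
    have h2 := hA z.im hz ((z : ℂ) + ((-round z.re : ℤ) : ℂ)) (by simp) (by
      simp only [Set.mem_setOf_eq, add_re, intCast_re]
      have := abs_sub_round z.re
      push_cast
      rw [← sub_eq_add_neg]
      have e : (z : ℂ).re = z.re := rfl
      rw [e]
      linarith)
    rw [hTn _ _ z.2] at h2
    exact h2.le
  let M : ModularForm (Matrix.SpecialLinearGroup.mapGL ℝ : Matrix.SpecialLinearGroup (Fin 2) ℤ →* _).range 0 :=
    { toFun := F
      slash_action_eq' := by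
        intro A hA
        obtain ⟨A, rfl⟩ := hA
        exact hinv A
      holo' := by
        rw [UpperHalfPlane.mdifferentiable_iff]
        refine .congr (fun z hz ↦ (hd z hz).differentiableWithinAt) fun z hz ↦ ?_
        simp [F, UpperHalfPlane.ofComplex_apply_of_im_pos hz]
      bdd_at_cusps' := by
        intro c hc
        rw [Subgroup.IsArithmetic.isCusp_iff_isCusp_SL2Z] at hc
        rw [OnePoint.isBoundedAt_iff_forall_SL2Z hc]
        intro γ _
        rw [hinv]
        exact hbd }
  obtain ⟨d, hd⟩ := ModularFormClass.levelOne_weight_zero_const M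
  have hF : ∀ z : ℂ, 0 < z.im → f z = d := fun z hz => congrFun hd ⟨z, hz⟩
  have hdc : d = c := by
    have hlim : Tendsto (fun y : ℝ => f (I * y)) atTop (𝓝 c) := by
      apply hc.comp
      rw [tendsto_inf]
      constructor
      · rw [tendsto_comap_iff]
        have : im ∘ (fun y : ℝ => I * (y:ℂ)) = id := by ext y; simp
        rw [this]; exact tendsto_id
      · rw [tendsto_principal]
        exact Eventually.of_forall (fun y => by simp)
    have h2 : Tendsto (fun y : ℝ => f (I * y)) atTop (𝓝 d) := by
      apply tendsto_const_nhds.congr'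
      filter_upwards [eventually_gt_atTop 0] with y hy
      rw [hF]; simpa using hy
    exact tendsto_nhds_unique h2 hlim
  intro z hz
  rw [hF z hz, hdc]

open Filter Topology in
lemma qlim (c : ℤ → ℂ) (e : ℤ → ℝ) (he : ∀ n, 0 ≤ e n)
    (hs : Summable fun n => ‖c n‖ * Real.exp (-Real.pi * e n)) :
    Tendsto (fun τ : ℂ => ∑' n, c n * exp (Real.pi * I * τ * e n)) (comap im atTop)
      (𝓝 (∑' n, if e n = 0 then c n else 0)) := by
  have hn : ∀ (τ : ℂ) (x : ℝ), ‖exp (Real.pi * I * τ * x)‖ = Real.exp (-Real.pi * τ.im * x) := by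
    intro τ x
    rw [norm_exp]; congr 1; simp
  apply tendsto_tsum_of_dominated_convergence hs
  · intro n
    split_ifs with h
    · simpa [h] using tendsto_const_nhds
    · rw [tendsto_zero_iff_norm_tendsto_zero]
      simp_rw [norm_mul, hn]
      rw [show (0:ℝ) = ‖c n‖ * 0 by simp]
      apply Tendsto.const_mul
      apply Real.tendsto_exp_atBot.comp
      have h0 : 0 < e n := lt_of_le_of_ne (he n) (Ne.symm h)
      have : Tendsto (fun y : ℝ => -Real.pi * y * e n) atTop atBot := by
        have : (fun y : ℝ => -Real.pi * y * e n) = fun y => y * (-(Real.pi * e n)) := by ext; ring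
        rw [this]
        exact tendsto_id.atTop_mul_const_of_neg (by have := Real.pi_pos; nlinarith [mul_pos this h0])
      exact this.comp tendsto_comap
  · have : ∀ᶠ τ : ℂ in comap im atTop, 1 ≤ τ.im := tendsto_comap.eventually (eventually_ge_atTop 1)
    filter_upwards [this] with τ hτ n
    rw [norm_mul, hn]
    gcongr ‖c n‖ * Real.exp ?_
    have := mul_nonneg Real.pi_pos.le (he n)
    nlinarith

def gE (τ : ℂ) : ℂ := ∑' n : ℤ, (-1 : ℂ) ^ n * (n + 1/2) * exp (Real.pi * I * τ * ((n:ℂ) + 1/2) ^ 2)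

lemma theta_half_zero (τ : ℂ) : jacobiTheta₂ (1/2 + τ/2) τ = 0 := by
  have h1 := jacobiTheta₂_add_left' (1/2 - τ/2) τ
  have h2 : jacobiTheta₂ (1/2 - τ/2) τ = jacobiTheta₂ (1/2 + τ/2) τ := by
    rw [← jacobiTheta₂_neg_left, ← jacobiTheta₂_add_left]
    congr 1; ring
  rw [h2, show 1/2 - τ/2 + τ = 1/2 + τ/2 by ring,
    show -Real.pi * I * (τ + 2 * (1/2 - τ/2)) = -(Real.pi * I) by ring, Complex.exp_neg,
    Complex.exp_pi_mul_I] at h1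
  norm_num at h1
  linear_combination h1 / 2

lemma hasSum_gE {τ : ℂ} (h : 0 < τ.im) :
    HasSum (fun n : ℤ => (-1 : ℂ) ^ n * (n + 1/2) * exp (Real.pi * I * τ * ((n:ℂ) + 1/2) ^ 2))
    (exp (Real.pi * I * τ / 4) / (2 * Real.pi * I) * jacobiTheta₂' (1/2 + τ/2) τ) := by
  have h1 := (hasSum_jacobiTheta₂'_term (1/2 + τ/2) h).mul_left (exp (Real.pi * I * τ / 4) / (2 * Real.pi * I))
  have h2 := (hasSum_jacobiTheta₂_term (1/2 + τ/2) h).mul_left (exp (Real.pi * I * τ / 4) / 2)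
  rw [theta_half_zero] at h2
  have h3 := h1.add h2
  rw [mul_zero, add_zero] at h3
  refine h3.congr_fun ?_ |> fun x => x
  intro n
  have hp : (Real.pi : ℂ) ≠ 0 := by exact_mod_cast Real.pi_ne_zero
  rw [neg_one_zpow_exp, jacobiTheta₂'_term, jacobiTheta₂_term]
  have : exp (Real.pi * I * n) * exp (Real.pi * I * τ * (n + 1/2)^2) =
    exp (Real.pi * I * τ / 4) * exp (2 * Real.pi * I * n * (1/2 + τ/2) + Real.pi * I * n^2 * τ) := by
    rw [← Complex.exp_add, ← Complex.exp_add]; congr 1; ring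
  have h5 : exp (Real.pi * I * n) * (n + 1/2) * exp (Real.pi * I * τ * (n + 1/2)^2) =
     (n + 1/2) * (exp (Real.pi * I * n) * exp (Real.pi * I * τ * (n + 1/2)^2)) := by ring
  rw [h5, this]
  field_simp

lemma gE_eq {τ : ℂ} (h : 0 < τ.im) :
    gE τ = exp (Real.pi * I * τ / 4) / (2 * Real.pi * I) * jacobiTheta₂' (1/2 + τ/2) τ :=
  (hasSum_gE h).tsum_eq

lemma gE_T (τ : ℂ) : gE (τ+1) = exp (Real.pi * I / 4) * gE τ := by
  unfold gE
  rw [← tsum_mul_left]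
  apply tsum_congr; intro n
  have : exp (Real.pi * I * (τ+1) * (n + 1/2)^2) = exp (Real.pi * I / 4) * exp (Real.pi * I * τ * (n + 1/2)^2) := by
    rw [← Complex.exp_add]
    obtain ⟨k, hk⟩ := Int.even_mul_succ_self n
    rw [← exp_two_pi_int (-k)]
    congr 1
    have : (n : ℂ) * (n + 1) = k + k := by exact_mod_cast hk
    push_cast
    linear_combination Real.pi * I * this
  rw [this]; ring

lemma gE_S {τ : ℂ} (h : 0 < τ.im) : gE (-1/τ) = sqI τ ^ 3 * gE τ := by
  have h0 := tau_ne h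
  rw [gE_eq h, gE_eq (im_S h), jacobiTheta₂'_functional_equation (1/2 + τ/2) τ]
  rw [show ((-I * τ) ^ (1/2 : ℂ)) = sqI τ from rfl]
  have e1 : (1/2 + τ/2) / τ = - (1/2 + -1/τ/2) + 1 := by field_simp; ring
  rw [e1, jacobiTheta₂_add_left, jacobiTheta₂'_add_left, jacobiTheta₂_neg_left,
    jacobiTheta₂'_neg_left, theta_half_zero]
  have e2 : exp (-Real.pi * I * (1/2 + τ/2)^2 / τ) * exp (Real.pi * I * τ / 4) =
    -I * exp (Real.pi * I * (-1/τ) / 4) := by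
    rw [show -I = exp (-(Real.pi / 2 * I)) by
      rw [Complex.exp_neg, Complex.exp_pi_div_two_mul_I]; simp]
    rw [← Complex.exp_add, ← Complex.exp_add]
    congr 1; field_simp; ring
  have h3 : sqI τ ^ 3 = sqI τ * (-I * τ) := by rw [← sqI_sq h]; ring
  have h4 := sqI_ne h
  rw [h3]
  have hp : (Real.pi : ℂ) ≠ 0 := by exact_mod_cast Real.pi_ne_zero
  set J := jacobiTheta₂' (1/2 + -1/τ/2) (-1/τ)
  calc _ = (1 / (2 * Real.pi * I)) * J * (exp (Real.pi * I * (-1/τ) / 4)) := by ring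
    _ = (1 / (2 * Real.pi * I)) * J * (I * (exp (-Real.pi * I * (1/2 + τ/2)^2 / τ) * exp (Real.pi * I * τ / 4))) := by
      rw [e2, ← mul_assoc I, show I * -I = 1 by simp, one_mul]
    _ = _ := by field_simp; ring

end

section

lemma norm_exp_pi (τ : ℂ) (x : ℝ) : ‖exp (Real.pi * I * τ * x)‖ = Real.exp (-Real.pi * τ.im * x) := by
  rw [norm_exp]; congr 1; simp

lemma diff_qsum (c : ℤ → ℂ) (e : ℤ → ℝ) (he : ∀ n, 0 ≤ e n)
    (hs : ∀ y : ℝ, 0 < y → Summable fun n => ‖c n‖ * Real.exp (-Real.pi * y * e n)) {τ : ℂ} (h : 0 < τ.im) :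
    DifferentiableAt ℂ (fun τ : ℂ => ∑' n, c n * exp (Real.pi * I * τ * e n)) τ := by
  have ho : IsOpen {z : ℂ | τ.im / 2 < z.im} := isOpen_lt continuous_const continuous_im
  have := differentiableOn_tsum_of_summable_norm (F := fun (n : ℤ) (τ : ℂ) => c n * exp (Real.pi * I * τ * e n))
    (hs (τ.im / 2) (by linarith)) (U := {z : ℂ | τ.im / 2 < z.im}) (by intro n; fun_prop) ho (by
      intro n w hw
      rw [norm_mul, norm_exp_pi]
      gcongr ‖c n‖ * Real.exp ?_
      have h1 := mul_nonneg Real.pi_pos.le (he n)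
      simp only [Set.mem_ofPred_eq] at hw
      nlinarith)
  exact this.differentiableAt (ho.mem_nhds (by simp only [Set.mem_ofPred_eq]; linarith))

lemma summable_poly_gauss (k : ℕ) (S : ℝ) {T : ℝ} (hT : 0 < T) (c : ℤ → ℝ) (C : ℝ) (e : ℤ → ℝ)
    (hc : ∀ n : ℤ, ‖c n‖ ≤ C * (1 + |(n:ℝ)| ^ k))
    (he : ∀ n : ℤ, T * (n:ℝ)^2 - 2 * S * |(n:ℝ)| ≤ e n) :
    Summable fun n => c n * Real.exp (-Real.pi * e n) := by
  have h1 := (((summable_pow_mul_jacobiTheta₂_term_bound S hT 0).add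
    (summable_pow_mul_jacobiTheta₂_term_bound S hT k)).mul_left C)
  refine Summable.of_norm_bounded h1 ?_
  intro n
  have hC : 0 ≤ C * (1 + |(n:ℝ)| ^ k) := (norm_nonneg _).trans (hc n)
  rw [norm_mul, Real.norm_of_nonneg (Real.exp_pos _).le]
  calc _ ≤ (C * (1 + |(n:ℝ)| ^ k)) * Real.exp (-Real.pi * (T * (n:ℝ)^2 - 2 * S * |(n:ℝ)|)) := by
        have h2 : Real.exp (-Real.pi * e n) ≤ Real.exp (-Real.pi * (T * (n:ℝ)^2 - 2 * S * |(n:ℝ)|)) := by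
          apply Real.exp_le_exp.2
          have := mul_le_mul_of_nonneg_left (he n) Real.pi_pos.le
          linarith
        exact mul_le_mul (hc n) h2 (Real.exp_pos _).le hC
    _ = _ := by push_cast; ring

lemma diff_gE {τ : ℂ} (h : 0 < τ.im) : DifferentiableAt ℂ gE τ := by
  have := diff_qsum (fun n => (-1 : ℂ) ^ n * (n + 1/2)) (fun n => ((n:ℝ) + 1/2)^2) (fun n => sq_nonneg _) ?_ h
  · convert this using 1
    ext τ
    unfold gE
    apply tsum_congr; intro n; push_cast; rfl
  · intro y hy
    have := summable_poly_gauss 1 (y/2) hy (fun n => ‖(-1 : ℂ) ^ n * (n + 1/2)‖) 1 (fun n => y * ((n:ℝ) + 1/2)^2) ?_ ?_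
    · convert this using 4; ring
    · intro n
      rw [norm_norm, norm_mul, norm_zpow, norm_neg, norm_one, one_zpow, one_mul]
      refine (norm_add_le _ _).trans ?_
      rw [norm_intCast]; norm_num
      linarith
    · intro n
      have := neg_abs_le (n:ℝ)
      nlinarith

open Filter Topology

def iinf : Filter ℂ := comap im atTop

lemma iinf_ev : ∀ᶠ τ : ℂ in iinf, 1 ≤ τ.im := tendsto_comap.eventually (eventually_ge_atTop 1)

lemma quad_lb (n : ℤ) : (0:ℝ) ≤ n ^ 2 + n := by
  have : 0 ≤ n ^ 2 + n := by nlinarith [sq_nonneg (2 * n + 1)]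
  exact_mod_cast this

lemma quad_eq (n : ℤ) : ((n:ℝ) ^ 2 + n = 0) ↔ n = 0 ∨ n = -1 := by
  constructor
  · intro h
    have : n * (n + 1) = 0 := by
      have : n ^ 2 + n = 0 := by exact_mod_cast h
      linarith
    rcases mul_eq_zero.1 this with h | h
    · exact Or.inl h
    · right; linarith
  · rintro (rfl | rfl) <;> norm_num

lemma tsum_quad (c : ℤ → ℂ) : ∑' n : ℤ, (if (n:ℝ) ^ 2 + n = 0 then c n else 0) = c 0 + c (-1) := by
  rw [tsum_eq_sum (s := {0, -1})]
  · rw [Finset.sum_pair (by norm_num)]; norm_num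
  · intro n hn
    rw [if_neg]
    rw [quad_eq]
    simpa using hn

lemma tsum_sq (c : ℤ → ℂ) : ∑' n : ℤ, (if (n:ℝ) ^ 2 = 0 then c n else 0) = c 0 := by
  rw [tsum_eq_single 0]
  · norm_num
  · intro n hn
    rw [if_neg]; simpa using hn

lemma gE_lim : Tendsto (fun τ => exp (-(Real.pi * I * τ / 4)) * gE τ) iinf (𝓝 1) := by
  have := qlim (fun n => (-1 : ℂ) ^ n * (n + 1/2)) (fun n => (n:ℝ)^2 + n) quad_lb ?_
  · rw [tsum_quad] at this
    norm_num at this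
    refine this.congr ?_
    intro τ
    unfold gE
    rw [← tsum_mul_left]
    apply tsum_congr; intro n
    rw [mul_left_comm, ← Complex.exp_add]
    congr 2
    ring
  · refine summable_poly_gauss 1 (1/2) one_pos _ 1 _ ?_ ?_
    · intro n
      rw [norm_norm, norm_mul, norm_zpow, norm_neg, norm_one, one_zpow, one_mul]
      refine (norm_add_le _ _).trans ?_
      rw [norm_intCast]; norm_num
      linarith
    · intro n
      have := neg_abs_le (n:ℝ)
      nlinarith

lemma theta2_lim : Tendsto (fun τ => exp (-(Real.pi * I * τ / 4)) * theta2 τ) iinf (𝓝 2) := by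
  have := qlim (fun n => 1) (fun n => (n:ℝ)^2 + n) quad_lb ?_
  · rw [tsum_quad] at this
    norm_num at this
    refine this.congr ?_
    intro τ
    unfold theta2 qp
    rw [← tsum_mul_left]
    apply tsum_congr; intro n
    rw [← Complex.exp_add]
    congr 1
    ring
  · refine summable_poly_gauss 1 (1/2) one_pos _ 1 _ ?_ ?_
    · intro n
      simp
    · intro n
      have := neg_abs_le (n:ℝ)
      nlinarith

lemma theta3_lim : Tendsto theta3 iinf (𝓝 1) := by
  have := qlim (fun n => 1) (fun n => (n:ℝ)^2) (fun n => sq_nonneg _) ?_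
  · rw [tsum_sq] at this
    refine this.congr ?_
    intro τ
    unfold theta3 qp
    apply tsum_congr; intro n
    rw [one_mul]
    congr 1
    push_cast; ring
  · refine summable_poly_gauss 1 0 one_pos _ 1 _ ?_ ?_
    · intro n
      simp
    · intro n
      simp

lemma theta4_lim : Tendsto theta4 iinf (𝓝 1) := by
  have := qlim (fun n => (-1)^n) (fun n => (n:ℝ)^2) (fun n => sq_nonneg _) ?_
  · rw [tsum_sq] at this
    norm_num at this
    refine this.congr ?_
    intro τ
    unfold theta4 qp
    apply tsum_congr; intro n
    congr 2
    ring
  · refine summable_poly_gauss 1 0 one_pos _ 1 _ ?_ ?_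
    · intro n
      simp
    · intro n
      simp

lemma eta_lim : Tendsto (fun τ => exp (-(Real.pi * I * τ / 12)) * etaDedekind τ) iinf (𝓝 1) := by
  have htprod : Tendsto (fun q : ℂ ↦ ∏' (n : ℕ), (1 - q ^ (n + 1))) (𝓝 0) (𝓝 1) := by
    have := tendsto_tprod_one_add_of_dominated_convergence (𝓕 := 𝓝 0) (g := 0)
      (f := fun (q : ℂ) (n : ℕ) ↦ -q ^ (n + 1)) (bound := fun n ↦ (1 / 2 : ℝ) ^ (n + 1))
    simp only [Pi.zero_apply, norm_neg, norm_pow, add_zero, tprod_one] at this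
    simp_rw [sub_eq_add_neg]
    refine this
      (by simpa only [pow_succ'] using (summable_geometric_of_abs_lt_one (by norm_num)).mul_left _)
      (fun k ↦ by simpa using ((continuous_pow (M := ℂ) (k + 1)).tendsto 0).neg) ?_
    filter_upwards [Metric.ball_mem_nhds (0 : ℂ) (by norm_num : (0 : ℝ) < 1 / 2)] with q hq k
    exact pow_le_pow_left₀ (norm_nonneg _) (mem_ball_zero_iff.mp hq).le _
  have hq : Tendsto (fun τ : ℂ => exp (2 * Real.pi * I * τ)) iinf (𝓝 0) := by
    rw [tendsto_zero_iff_norm_tendsto_zero]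
    have : (fun τ : ℂ => ‖exp (2 * Real.pi * I * τ)‖) = (fun y : ℝ => Real.exp (-(2 * Real.pi * y))) ∘ im := by
      ext τ
      rw [norm_exp]; simp
    rw [this]
    refine Tendsto.comp ?_ tendsto_comap
    exact Real.tendsto_exp_neg_atTop_nhds_zero.comp (tendsto_id.const_mul_atTop (by positivity))
  refine (htprod.comp hq).congr ?_
  intro τ
  simp only [Function.comp]
  unfold etaDedekind
  rw [← mul_assoc, ← Complex.exp_add, neg_add_cancel, Complex.exp_zero, one_mul]
  apply tprod_congr
  intro n
  rw [qp, ← Complex.exp_nat_mul]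
  congr 2
  push_cast; ring

lemma eta3_lim : Tendsto (fun τ => exp (-(Real.pi * I * τ / 4)) * etaDedekind τ ^ 3) iinf (𝓝 1) := by
  have := eta_lim.pow 3
  rw [one_pow] at this
  refine this.congr ?_
  intro τ
  rw [mul_pow, ← Complex.exp_nat_mul]
  congr 2
  push_cast; ring

lemma eta_cube {τ : ℂ} (h : 0 < τ.im) : etaDedekind τ ^ 3 = gE τ := by
  have := levelOne_const (fun τ => gE τ / etaDedekind τ ^ 3) ?_ ?_ ?_ 1 ?_ τ h
  · have h2 := eta_ne h
    field_simp at this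
    exact this.symm
  · intro z hz
    exact (diff_gE hz).div ((diff_eta hz).pow 3) (pow_ne_zero _ (eta_ne hz))
  · intro z hz
    rw [gE_T, eta_T, mul_pow, ← Complex.exp_nat_mul,
      show ((3:ℕ):ℂ) * (Real.pi * I / 12) = Real.pi * I / 4 by push_cast; ring]
    rw [mul_div_mul_left _ _ (Complex.exp_ne_zero _)]
  · intro z hz
    rw [gE_S hz, eta_S hz, mul_pow, mul_div_mul_left _ _ (pow_ne_zero _ (sqI_ne hz))]
  · have := gE_lim.div eta3_lim one_ne_zero
    rw [div_one] at this
    refine Tendsto.mono_left (this.congr ?_) inf_le_left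
    intro τ
    simp only [Pi.div_apply]
    rw [mul_div_mul_left _ _ (Complex.exp_ne_zero _)]

lemma theta_prod {τ : ℂ} (h : 0 < τ.im) : theta2 τ * theta3 τ * theta4 τ = 2 * etaDedekind τ ^ 3 := by
  have := levelOne_const (fun τ => theta2 τ * theta3 τ * theta4 τ / etaDedekind τ ^ 3) ?_ ?_ ?_ 2 ?_ τ h
  · have h2 := eta_ne h
    field_simp at this
    rw [this]; ring
  · intro z hz
    exact (((diff_theta2 hz).mul (diff_theta3 hz)).mul (diff_theta4 hz)).div ((diff_eta hz).pow 3) (pow_ne_zero _ (eta_ne hz))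
  · intro z hz
    rw [theta2_T, theta3_T, theta4_T, eta_T, mul_pow, ← Complex.exp_nat_mul,
      show ((3:ℕ):ℂ) * (Real.pi * I / 12) = Real.pi * I / 4 by push_cast; ring]
    rw [mul_assoc, mul_assoc, mul_div_mul_left _ _ (Complex.exp_ne_zero _)]
    ring
  · intro z hz
    rw [theta2_S hz, theta3_S hz, theta4_S hz, eta_S hz, mul_pow]
    rw [show sqI z * theta4 z * (sqI z * theta3 z) * (sqI z * theta2 z) = sqI z ^ 3 * (theta2 z * theta3 z * theta4 z) by ring, mul_div_mul_left _ _ (pow_ne_zero _ (sqI_ne hz))]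
  · have := ((theta2_lim.mul theta3_lim).mul theta4_lim).div eta3_lim one_ne_zero
    norm_num at this
    refine Tendsto.mono_left (this.congr ?_) inf_le_left
    intro τ
    simp only [Pi.div_apply]
    rw [mul_assoc, mul_assoc, mul_div_mul_left _ _ (Complex.exp_ne_zero _)]
    ring

lemma theta3_ne {τ : ℂ} (h : 0 < τ.im) : theta3 τ ≠ 0 := by
  intro h0
  have := theta_prod h
  rw [h0] at this
  have h2 := eta_ne h
  simp [h2] at this

lemma theta4_ne {τ : ℂ} (h : 0 < τ.im) : theta4 τ ≠ 0 := by
  intro h0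
  have := theta_prod h
  rw [h0] at this
  have h2 := eta_ne h
  simp [h2] at this

end

section
open Filter Topology

lemma cot_tendsto {z : ℂ} (hz : z ∈ Complex.integerComplement) :
    Tendsto (fun M : ℕ => ∑ m ∈ Finset.range M, (1 / (z + m) - 1 / (m + 1 - z))) atTop
      (𝓝 (Real.pi * cot (Real.pi * z))) := by
  have h1 := tendsto_logDeriv_euler_cot_sub hz
  have h2 : Tendsto (fun M : ℕ => 1 / z - 1 / (z + (M:ℂ))) atTop (𝓝 (1 / z - 0)) := by
    apply Tendsto.sub tendsto_const_nhds
    simp_rw [one_div]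
    apply tendsto_inv₀_cobounded.comp
    rw [← tendsto_norm_atTop_iff_cobounded]
    have : Tendsto (fun M : ℕ => (M:ℝ) - ‖z‖) atTop atTop :=
      tendsto_atTop_add_const_right _ _ tendsto_natCast_atTop_atTop
    refine tendsto_atTop_mono ?_ this
    intro M
    have := norm_sub_le (z + M) z
    rw [add_sub_cancel_left, norm_natCast] at this
    linarith
  have h3 := h1.add h2
  rw [sub_zero, sub_add_cancel] at h3
  refine h3.congr ?_
  intro M
  have hne : ∀ m : ℕ, z + m ≠ 0 := by
    intro m
    have := Complex.integerComplement_add_ne_zero hz m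
    exact_mod_cast this
  have hne' : ∀ m : ℕ, z - (m + 1) ≠ 0 := by
    intro m
    have := Complex.integerComplement_add_ne_zero hz (-(m + 1))
    push_cast at this
    rwa [← sub_eq_add_neg] at this
  induction M with
  | zero => simp
  | succ M ih =>
    rw [Finset.sum_range_succ, Finset.sum_range_succ, ← ih]
    unfold cotTerm
    have e : 1 / (M + 1 - z) = - (1 / (z - (M + 1))) := by
      rw [← one_div_neg_eq_neg_one_div]; congr 1; ring
    rw [e]
    push_cast
    rw [← add_assoc z]
    ring

def pairP (m : ℕ) (t : ℝ) : ℝ := (4*m+1) * Real.exp (-Real.pi * t * (4*m+1)^2/4) -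
  (4*m+3) * Real.exp (-Real.pi * t * (4*m+3)^2/4)

lemma gterm_fold (t : ℝ) (n : ℕ) : ((-1 : ℂ) ^ (n:ℤ) * (((n:ℤ):ℂ) + 1/2) * exp (Real.pi * I * (I * t) * (((n:ℤ):ℂ) + 1/2) ^ 2) +
      (-1 : ℂ) ^ (-((n:ℤ)+1)) * (((-((n:ℤ)+1) : ℤ):ℂ) + 1/2) * exp (Real.pi * I * (I * t) * (((-((n:ℤ)+1):ℤ):ℂ) + 1/2) ^ 2))
      = (-1:ℂ)^n * ((2 * n + 1) * exp (-Real.pi * t * (2 * n + 1)^2/4)) := by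
  have e1 : exp (Real.pi * I * (I * t) * (((n:ℤ):ℂ) + 1/2) ^ 2) = exp (-Real.pi * t * (2 * n + 1)^2/4) := by
    congr 1
    push_cast
    linear_combination Real.pi * t * (n + 1/2)^2 * I_mul_I
  have e2 : exp (Real.pi * I * (I * t) * (((-((n:ℤ)+1):ℤ):ℂ) + 1/2) ^ 2) = exp (-Real.pi * t * (2 * n + 1)^2/4) := by
    congr 1
    push_cast
    linear_combination Real.pi * t * (n + 1/2)^2 * I_mul_I
  have e3 : (-1 : ℂ) ^ (-((n:ℤ)+1)) = - (-1:ℂ)^n := by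
    rw [zpow_neg, zpow_add₀ (by norm_num), zpow_natCast]
    rcases neg_one_pow_eq_or ℂ n with h | h <;> rw [h] <;> norm_num
  rw [e1, e2, e3, zpow_natCast]
  push_cast
  ring

lemma gE_nat {t : ℝ} (ht : 0 < t) : HasSum (fun n : ℕ => (-1:ℂ)^n * ((2 * n + 1) * exp (-Real.pi * t * (2 * n + 1)^2/4)))
    (etaDedekind (I * t) ^ 3) := by
  have him : 0 < (I * (t:ℂ)).im := by simpa using ht
  have h1 := (hasSum_gE him).nat_add_neg_add_one
  rw [← gE_eq him, ← eta_cube him] at h1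
  exact h1.congr_fun (fun n => (gterm_fold t n).symm)

lemma pairP_term (t : ℝ) (m : ℕ) : (pairP m t : ℂ) =
    (-1:ℂ)^(2 * m) * ((2 * ((2 * m : ℕ):ℂ) + 1) * exp (-Real.pi * t * (2 * ((2 * m : ℕ):ℂ) + 1)^2/4)) +
    (-1:ℂ)^(2 * m + 1) * ((2 * ((2 * m + 1 : ℕ):ℂ) + 1) * exp (-Real.pi * t * (2 * ((2 * m + 1 : ℕ):ℂ) + 1)^2/4)) := by
  have h1 : (-1:ℂ)^(2 * m) = 1 := by rw [pow_mul]; norm_num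
  have h2 : (2 * ((2 * m : ℕ):ℂ) + 1) = 4 * m + 1 := by push_cast; ring
  have h3 : (2 * ((2 * m + 1 : ℕ):ℂ) + 1) = 4 * m + 3 := by push_cast; ring
  have h4 : (-1:ℂ)^(2 * m + 1) = -1 := by rw [pow_succ, h1, one_mul]
  rw [h4, h1, h2, h3, pairP]
  push_cast
  ring

lemma hasSum_pair (f : ℕ → ℂ) (a : ℂ) (h3 : HasSum f a) : HasSum (fun m => f (2 * m) + f (2 * m + 1)) a := by
  have he : Summable (fun n => f (2 * n)) := h3.summable.comp_injective (i := fun n : ℕ => 2 * n) (mul_right_injective₀ (two_ne_zero' ℕ))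
  have ho : Summable (fun n => f (2 * n + 1)) := h3.summable.comp_injective (i := fun n : ℕ => 2 * n + 1) (fun a b h => by simpa using h)
  have h4 := tsum_even_add_odd (f := f) he ho
  rw [h3.tsum_eq] at h4
  rw [← h4]
  exact he.hasSum.add ho.hasSum

lemma eta_pair {t : ℝ} (ht : 0 < t) : HasSum (fun m : ℕ => (pairP m t : ℂ)) (etaDedekind (I * t) ^ 3) := by
  have h5 := hasSum_pair _ _ (gE_nat ht)
  exact h5.congr_fun (pairP_term t)

lemma integral_exp_Ioi {a : ℝ} (ha : 0 < a) : ∫ t in Set.Ioi (0:ℝ), Real.exp (-a * t) = 1 / a := by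
  rw [integral_exp_mul_Ioi (by linarith)]
  simp [neg_div_neg_eq]

lemma int_exp_Ioi {a : ℝ} (ha : 0 < a) : IntegrableOn (fun t => Real.exp (-a * t)) (Set.Ioi (0:ℝ)) :=
  integrableOn_exp_mul_Ioi (by linarith) 0

lemma pairP_mul (m : ℕ) (t x : ℝ) : pairP m t * Real.exp (-Real.pi * x^2 * t) =
    (4*m+1) * Real.exp (-(Real.pi * ((4*m+1)^2/4 + x^2)) * t) -
    (4*m+3) * Real.exp (-(Real.pi * ((4*m+3)^2/4 + x^2)) * t) := by
  unfold pairP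
  rw [sub_mul, mul_assoc (4 * (m:ℝ) + 1), mul_assoc (4 * (m:ℝ) + 3), ← Real.exp_add, ← Real.exp_add]
  ring_nf

lemma int_pairP (m : ℕ) (x : ℝ) :
    IntegrableOn (fun t => pairP m t * Real.exp (-Real.pi * x^2 * t)) (Set.Ioi (0:ℝ)) := by
  simp_rw [pairP_mul]
  apply Integrable.sub
  · exact (int_exp_Ioi (by have := Real.pi_pos; positivity)).const_mul _
  · exact (int_exp_Ioi (by have := Real.pi_pos; positivity)).const_mul _

lemma integral_pairP (m : ℕ) (x : ℝ) :
    ∫ t in Set.Ioi (0:ℝ), pairP m t * Real.exp (-Real.pi * x^2 * t) =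
     (4*m+1) / (Real.pi * ((4*m+1)^2/4 + x^2)) - (4*m+3) / (Real.pi * ((4*m+3)^2/4 + x^2)) := by
  simp_rw [pairP_mul]
  have hp := Real.pi_pos
  rw [integral_sub, integral_const_mul, integral_const_mul, integral_exp_Ioi (by positivity),
    integral_exp_Ioi (by positivity)]
  · ring
  · exact (int_exp_Ioi (by positivity)).const_mul _
  · exact (int_exp_Ioi (by positivity)).const_mul _

lemma integral_norm_pairP (m : ℕ) (x : ℝ) :
    ∫ t in Set.Ioi (0:ℝ), ‖pairP m t * Real.exp (-Real.pi * x^2 * t)‖ ≤ 10 * (1 / ((m:ℝ)+1)^2) := by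
  have hp := Real.pi_pos
  set N : ℝ := 4 * m + 1 with hN
  have hN1 : 1 ≤ N := by rw [hN]; have : (0:ℝ) ≤ m := Nat.cast_nonneg m; linarith
  have i1 := int_exp_Ioi (a := Real.pi * (N^2/4)) (by positivity)
  have i2 := int_exp_Ioi (a := Real.pi * ((N+2)^2/4)) (by positivity)
  calc _ ≤ ∫ t in Set.Ioi (0:ℝ), (N * (Real.exp (-(Real.pi * (N^2/4)) * t) - Real.exp (-(Real.pi * ((N+2)^2/4)) * t))
        + 2 * Real.exp (-(Real.pi * ((N+2)^2/4)) * t)) := by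
        apply setIntegral_mono_on (int_pairP m x).norm _ measurableSet_Ioi
        · intro t ht
          simp only [Set.mem_Ioi] at ht
          rw [norm_mul, Real.norm_of_nonneg (Real.exp_pos _).le]
          have h1 : Real.exp (-Real.pi * x^2 * t) ≤ 1 := by
            rw [Real.exp_le_one_iff]
            have : 0 ≤ Real.pi * x^2 * t := by positivity
            linarith
          have h2 : ‖pairP m t‖ ≤ (N * (Real.exp (-(Real.pi * (N^2/4)) * t) - Real.exp (-(Real.pi * ((N+2)^2/4)) * t))
              + 2 * Real.exp (-(Real.pi * ((N+2)^2/4)) * t)) := by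
            have h3 : pairP m t = N * (Real.exp (-(Real.pi * (N^2/4)) * t) - Real.exp (-(Real.pi * ((N+2)^2/4)) * t))
              - 2 * Real.exp (-(Real.pi * ((N+2)^2/4)) * t) := by
              unfold pairP
              rw [show -Real.pi * t * (4*m+1)^2/4 = -(Real.pi * (N^2/4)) * t by rw [hN]; ring,
                show -Real.pi * t * (4*m+3)^2/4 = -(Real.pi * ((N+2)^2/4)) * t by rw [hN]; ring]
              rw [hN]; ring
            rw [h3]
            have h4 : Real.exp (-(Real.pi * ((N+2)^2/4)) * t) ≤ Real.exp (-(Real.pi * (N^2/4)) * t) := by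
              apply Real.exp_le_exp.2
              have : 0 ≤ Real.pi * t * (4 * N + 4) := by positivity
              nlinarith
            have h5 := mul_nonneg (by linarith : 0 ≤ N) (sub_nonneg.2 h4)
            have h6 := Real.exp_pos (-(Real.pi * ((N+2)^2/4)) * t)
            rw [Real.norm_eq_abs, abs_le]
            constructor <;> linarith
          calc _ ≤ ‖pairP m t‖ * 1 := by gcongr
            _ ≤ _ := by rw [mul_one]; exact h2
        · exact ((i1.sub i2).const_mul _).add (i2.const_mul _)
    _ = N * (1 / (Real.pi * (N^2/4)) - 1 / (Real.pi * ((N+2)^2/4))) + 2 * (1 / (Real.pi * ((N+2)^2/4))) := by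
        have i3 : IntegrableOn (fun t => N * (Real.exp (-(Real.pi * (N^2/4)) * t) - Real.exp (-(Real.pi * ((N+2)^2/4)) * t))) (Set.Ioi 0) := (i1.sub i2).const_mul _
        rw [integral_add i3 (i2.const_mul _), integral_const_mul, integral_const_mul,
          integral_sub i1 i2, integral_exp_Ioi (by positivity), integral_exp_Ioi (by positivity)]
    _ ≤ _ := by
        have hm : (m:ℝ) + 1 = (N+3)/4 := by rw [hN]; ring
        rw [hm]
        have e : N * (1 / (Real.pi * (N^2/4)) - 1 / (Real.pi * ((N+2)^2/4))) + 2 * (1 / (Real.pi * ((N+2)^2/4)))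
          = (4 * (6 * N + 4)) / (Real.pi * (N * (N+2)^2)) := by
          field_simp; ring
        rw [e, show 10 * (1 / ((N+3)/4)^2) = 160 / (N+3)^2 by field_simp; ring]
        rw [div_le_div_iff₀ (by positivity) (by positivity)]
        have h3 := Real.pi_gt_three
        have h7 : (4 * (6 * N + 4)) * (N+3)^2 ≤ 160 * (3 * (N * (N+2)^2)) := by
          have : 0 ≤ N - 1 := by linarith
          nlinarith [mul_nonneg this this, mul_nonneg (mul_nonneg this this) this]
        refine h7.trans ?_
        gcongr

lemma summable_inv_sq : Summable fun m : ℕ => 10 * (1 / ((m:ℝ)+1)^2) := by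
  apply Summable.mul_left
  have := (summable_nat_add_iff 1).2 (Real.summable_one_div_nat_pow.2 (one_lt_two))
  simpa using this

lemma sech_sum (x : ℝ) : Tendsto (fun M : ℕ => ∑ m ∈ Finset.range M,
    ((((4*m+1) / (Real.pi * ((4*m+1)^2/4 + x^2)) - (4*m+3) / (Real.pi * ((4*m+3)^2/4 + x^2)) : ℝ)) : ℂ)) atTop
    (𝓝 (1 / cosh (Real.pi * x))) := by
  set z : ℂ := (1 + 2 * I * x) / 4 with hz
  set w : ℂ := (1 - 2 * I * x) / 4 with hw
  have hp : (Real.pi : ℂ) ≠ 0 := by exact_mod_cast Real.pi_ne_zero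
  have zre : z.re = 1/4 := by rw [hz]; norm_num
  have wre : w.re = 1/4 := by rw [hw]; norm_num
  have notint : ∀ u : ℂ, u.re = 1/4 → u ∈ Complex.integerComplement := by
    intro u hu
    rw [Complex.mem_integerComplement_iff]
    rintro ⟨n, rfl⟩
    rw [intCast_re] at hu
    have : (4 * n : ℤ) = 1 := by
      have : (4 * n : ℝ) = 1 := by linarith
      exact_mod_cast this
    omega
  have h1 := ((cot_tendsto (notint z zre)).add (cot_tendsto (notint w wre))).const_mul (1 / (2 * (Real.pi:ℂ)))
  have hcosh : cosh (Real.pi * x) ≠ 0 := by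
    rw [← ofReal_mul, ← ofReal_cosh]
    exact_mod_cast (Real.cosh_pos _).ne'
  have e : 1 / (2 * (Real.pi:ℂ)) * (Real.pi * cot (Real.pi * z) + Real.pi * cot (Real.pi * w)) = 1 / cosh (Real.pi * x) := by
    have s1 := sin_pi_mul_ne_zero (notint z zre)
    have s2 := sin_pi_mul_ne_zero (notint w wre)
    have hsum : sin (Real.pi * z + Real.pi * w) = 1 := by
      rw [show (Real.pi:ℂ) * z + Real.pi * w = Real.pi / 2 by rw [hz, hw]; ring]
      exact Complex.sin_pi_div_two
    have hcs : cos (Real.pi * z - Real.pi * w) = cosh (Real.pi * x) := by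
      rw [show (Real.pi:ℂ) * z - Real.pi * w = (Real.pi * x) * I by rw [hz, hw]; ring]
      exact Complex.cos_mul_I _
    have hcp : cos (Real.pi * z + Real.pi * w) = 0 := by
      rw [show (Real.pi:ℂ) * z + Real.pi * w = Real.pi / 2 by rw [hz, hw]; ring]
      exact Complex.cos_pi_div_two
    rw [Complex.sin_add] at hsum
    rw [Complex.cos_sub] at hcs
    rw [Complex.cos_add] at hcp
    have hss : cosh (Real.pi * x) = 2 * (sin (Real.pi * z) * sin (Real.pi * w)) := by
      rw [← hcs]; linear_combination hcp
    rw [hss]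
    unfold cot
    field_simp
    linear_combination hsum
  rw [e] at h1
  refine h1.congr ?_
  intro M
  rw [← Finset.sum_add_distrib, Finset.mul_sum]
  apply Finset.sum_congr rfl
  intro m _
  have n1 : z + m ≠ 0 := by
    intro h; have := congrArg re h; simp [zre] at this
    have h0 : (0:ℝ) ≤ m := Nat.cast_nonneg m
    linarith
  have n2 : w + m ≠ 0 := by
    intro h; have := congrArg re h; simp [wre] at this
    have h0 : (0:ℝ) ≤ m := Nat.cast_nonneg m
    linarith
  have n3 : (m:ℂ) + 1 - z ≠ 0 := by
    intro h; have := congrArg re h; simp [zre] at this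
    have h0 : (0:ℝ) ≤ m := Nat.cast_nonneg m
    linarith
  have n4 : (m:ℂ) + 1 - w ≠ 0 := by
    intro h; have := congrArg re h; simp [wre] at this
    have h0 : (0:ℝ) ≤ m := Nat.cast_nonneg m
    linarith
  have f1 : ((4*m+1)^2/4 + x^2 : ℂ) = 4 * ((z + m) * (w + m)) := by
    rw [hz, hw]; linear_combination x^2 * I_sq
  have f2 : ((4*m+3)^2/4 + x^2 : ℂ) = 4 * ((m + 1 - z) * (m + 1 - w)) := by
    rw [hz, hw]; linear_combination x^2 * I_sq
  push_cast
  rw [f1, f2]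
  have g1 : (4 * m + 1 : ℂ) = 2 * ((z + m) + (w + m)) := by rw [hz, hw]; ring
  have g2 : (4 * m + 3 : ℂ) = 2 * ((m + 1 - z) + (m + 1 - w)) := by rw [hz, hw]; ring
  rw [g1, g2]
  generalize (m:ℂ) + 1 - z = A at *
  generalize (m:ℂ) + 1 - w = B at *
  generalize z + (m:ℂ) = C at *
  generalize w + (m:ℂ) = D at *
  field_simp
  ring

lemma laplace_sech (x : ℝ) :
    ∫ t in Set.Ioi (0:ℝ), etaDedekind (I * t) ^ 3 * exp (-Real.pi * x^2 * t) = 1 / cosh (Real.pi * x) := by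
  have hF := hasSum_integral_of_summable_integral_norm (μ := volume.restrict (Set.Ioi (0:ℝ)))
    (F := fun (m : ℕ) (t : ℝ) => ((pairP m t * Real.exp (-Real.pi * x^2 * t) : ℝ) : ℂ))
    (fun m => (int_pairP m x).ofReal) (by
      simp_rw [norm_real]
      exact Summable.of_nonneg_of_le (fun m => integral_nonneg (fun t => norm_nonneg _))
        (fun m => integral_norm_pairP m x) summable_inv_sq)
  have h1 : ∀ m : ℕ, ∫ t in Set.Ioi (0:ℝ), ((pairP m t * Real.exp (-Real.pi * x^2 * t) : ℝ) : ℂ) =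
     (((4*m+1) / (Real.pi * ((4*m+1)^2/4 + x^2)) - (4*m+3) / (Real.pi * ((4*m+3)^2/4 + x^2)) : ℝ) : ℂ) := by
    intro m
    rw [← integral_pairP]; exact integral_ofReal
  simp_rw [h1] at hF
  have h2 := tendsto_nhds_unique hF.tendsto_sum_nat (sech_sum x)
  rw [← h2]
  apply setIntegral_congr_fun measurableSet_Ioi
  intro t ht
  have h3 := (eta_pair ht).mul_right (exp (-Real.pi * x^2 * t))
  simp only
  rw [← h3.tsum_eq]
  apply tsum_congr
  intro m
  push_cast
  rfl

end

section
open Filter Topology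

lemma eta3_bd {δ : ℝ} (hδ : 0 < δ) : ∃ C : ℝ, 0 < C ∧ ∀ τ : ℂ, δ ≤ τ.im →
    ‖etaDedekind τ ^ 3‖ ≤ C * Real.exp (-Real.pi * τ.im / 4) := by
  have hs : Summable fun n : ℤ => |(n:ℝ) + 1/2| * Real.exp (-Real.pi * (δ * ((n:ℝ)^2 + n))) := by
    refine summable_poly_gauss 1 (δ/2) hδ _ 1 _ ?_ ?_
    · intro n
      rw [Real.norm_eq_abs, abs_abs]
      refine (abs_add_le _ _).trans ?_
      norm_num
      linarith
    · intro n
      have := neg_abs_le (n:ℝ)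
      nlinarith
  refine ⟨∑' n : ℤ, |(n:ℝ) + 1/2| * Real.exp (-Real.pi * (δ * ((n:ℝ)^2 + n))) + 1, ?_, ?_⟩
  · have : 0 ≤ ∑' n : ℤ, |(n:ℝ) + 1/2| * Real.exp (-Real.pi * (δ * ((n:ℝ)^2 + n))) :=
      tsum_nonneg (fun n => by positivity)
    linarith
  · intro τ hτ
    have h0 : 0 < τ.im := lt_of_lt_of_le hδ hτ
    rw [eta_cube h0, gE, add_mul]
    have hb : ‖∑' n : ℤ, (-1 : ℂ) ^ n * (n + 1/2) * exp (Real.pi * I * τ * ((n:ℂ) + 1/2) ^ 2)‖ ≤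
      ∑' n : ℤ, (|(n:ℝ) + 1/2| * Real.exp (-Real.pi * (δ * ((n:ℝ)^2 + n)))) * Real.exp (-Real.pi * τ.im / 4) := by
      apply tsum_of_norm_bounded (hs.mul_right _).hasSum
      intro n
      have := norm_exp_pi τ (((n:ℝ) + 1/2)^2)
      push_cast at this
      rw [norm_mul, norm_mul, this, norm_zpow, norm_neg, norm_one, one_zpow, one_mul, mul_assoc |(n:ℝ) + 1/2|, ← Real.exp_add]
      have h2 : ‖((n:ℂ) + 1/2)‖ = |(n:ℝ) + 1/2| := by
        rw [← Real.norm_eq_abs, ← norm_real]; push_cast; rfl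
      rw [h2]
      gcongr _ * Real.exp ?_
      have := mul_nonneg (sub_nonneg.2 hτ) (mul_nonneg Real.pi_pos.le (quad_lb n))
      nlinarith
    rw [tsum_mul_right] at hb
    have := Real.exp_pos (-Real.pi * τ.im / 4)
    linarith

lemma eta_it_bd : ∃ C : ℝ, 0 < C ∧ ∀ t : ℝ, 0 < t → ‖etaDedekind (I * t) ^ 3‖ ≤ C * (t * Real.exp (-t / 2)) := by
  obtain ⟨C, hC, hb⟩ := eta3_bd one_pos
  refine ⟨36 * C, by positivity, ?_⟩
  intro t ht
  have h3 := Real.pi_gt_three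
  have him : 0 < (I * (t:ℂ)).im := by simpa using ht
  rcases le_total 1 t with h1 | h1
  · have := hb (I * t) (by simpa using h1)
    refine this.trans ?_
    have e : Real.exp (-Real.pi * (I * (t:ℂ)).im / 4) ≤ Real.exp (-t/2) := by
      apply Real.exp_le_exp.2
      simp
      nlinarith
    have := Real.exp_pos (-t/2)
    have h5 : C * Real.exp (-Real.pi * (I * (t:ℂ)).im / 4) ≤ C * Real.exp (-t/2) := by gcongr
    have h6 : C * Real.exp (-t/2) * 1 ≤ C * Real.exp (-t/2) * t := by gcongr
    have h7 : 0 ≤ C * Real.exp (-t/2) * t := by positivity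
    nlinarith
  · have hS := eta_S him
    have hs2 : ‖sqI (I * t)‖ ^ 2 = t := by
      rw [← norm_pow, sqI_sq him]
      rw [show -I * (I * (t:ℂ)) = t by rw [← mul_assoc]; simp]
      rw [norm_real, Real.norm_of_nonneg ht.le]
    have hst : t ≤ ‖sqI (I * t)‖ := by
      nlinarith [norm_nonneg (sqI (I * t))]
    have e1 : -1 / (I * (t:ℂ)) = I * ((1/t : ℝ) : ℂ) := by
      have : (t:ℂ) ≠ 0 := by exact_mod_cast ht.ne'
      push_cast
      field_simp
      simp
    have hb1 := hb (I * ((1/t : ℝ) : ℂ)) (by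
      simp only [mul_im, I_re, I_im, ofReal_re, ofReal_im, zero_mul, one_mul, zero_add]
      rw [le_div_iff₀ ht]; linarith)
    rw [← e1, hS, mul_pow, norm_mul, norm_pow, pow_succ, hs2, e1] at hb1
    have hexp : Real.exp (-Real.pi * (I * ((1/t : ℝ) : ℂ)).im / 4) ≤ 18 * t^3 := by
      have h4 := Real.pow_div_factorial_le_exp (Real.pi / (4*t)) (by positivity) 3
      have h5 : (1:ℝ) / (18 * t^3) ≤ (Real.pi / (4*t))^3 / (Nat.factorial 3) := by
        rw [div_pow, show ((Nat.factorial 3 : ℕ) : ℝ) = 6 by norm_num [Nat.factorial]]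
        rw [div_div, div_le_div_iff₀ (by positivity) (by positivity)]
        have : (27:ℝ) ≤ Real.pi^3 := by
          have := pow_le_pow_left₀ (by norm_num) h3.le 3
          norm_num at this; exact this
        have h6 : 0 ≤ t^3 := by positivity
        have : t^3 * 27 ≤ t^3 * Real.pi^3 := by gcongr
        nlinarith
      have h6 : (-Real.pi * (I * ((1/t : ℝ) : ℂ)).im / 4) = -(Real.pi / (4 * t)) := by
        simp only [mul_im, I_re, I_im, ofReal_re, ofReal_im, zero_mul, one_mul, zero_add]
        field_simp
      rw [h6, Real.exp_neg]
      rw [inv_le_comm₀ (Real.exp_pos _) (by positivity), ← one_div]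
      exact h5.trans h4
    have hX := norm_nonneg (etaDedekind (I * t) ^ 3)
    have h7 : t * t * ‖etaDedekind (I * t) ^ 3‖ ≤ C * (18 * t^3) := by
      calc _ ≤ t * ‖sqI (I * t)‖ * ‖etaDedekind (I * t) ^ 3‖ := by gcongr
        _ ≤ _ := hb1
        _ ≤ _ := by gcongr
    have h8 : ‖etaDedekind (I * t) ^ 3‖ ≤ 18 * C * t := by
      have : 0 < t * t := by positivity
      refine le_of_mul_le_mul_left ?_ this
      nlinarith
    refine h8.trans ?_
    have h9 : 1/2 ≤ Real.exp (-t/2) := by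
      have := Real.add_one_le_exp (-t/2)
      linarith
    have h10 : C * t * (1/2) ≤ C * t * Real.exp (-t/2) := by gcongr
    nlinarith

lemma cont_eta_it : ContinuousOn (fun t : ℝ => etaDedekind (I * t) ^ 3) (Set.Ioi 0) := by
  intro t ht
  have him : 0 < (I * (t:ℂ)).im := by simpa using ht
  have h1 : ContinuousAt (fun t : ℝ => etaDedekind (I * t)) t :=
    ContinuousAt.comp (f := fun t : ℝ => I * (t:ℂ)) (g := etaDedekind) (diff_eta him).continuousAt (by fun_prop)
  exact (h1.pow 3).continuousWithinAt

lemma int_rpow_exp {s : ℝ} (hs : -1 < s) : IntegrableOn (fun t : ℝ => t ^ s * Real.exp (-t/2)) (Set.Ioi 0) := by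
  have := integrableOn_rpow_mul_exp_neg_mul_rpow hs one_pos (by norm_num : (0:ℝ) < 1/2)
  refine this.congr_fun ?_ measurableSet_Ioi
  intro t ht
  simp only [Real.rpow_one]
  congr 2; ring

/-- Integrability of eta cubed times a bounded-by-`t^{-1/2}` factor. -/
lemma int_eta_mul (f : ℝ → ℂ) (hf : ContinuousOn f (Set.Ioi 0)) (c : ℝ)
    (hb : ∀ t, 0 < t → ‖f t‖ ≤ c * (1 + t ^ (-(1/2):ℝ))) :
    IntegrableOn (fun t : ℝ => etaDedekind (I * t) ^ 3 * f t) (Set.Ioi 0) := by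
  obtain ⟨C, hC, hC2⟩ := eta_it_bd
  have h1 := ((int_rpow_exp (s := 1) (by norm_num)).add (int_rpow_exp (s := 1/2) (by norm_num))).const_mul (C * c)
  refine Integrable.mono' h1 ((cont_eta_it.mul hf).aestronglyMeasurable measurableSet_Ioi) ?_
  filter_upwards [ae_restrict_mem measurableSet_Ioi] with t ht
  simp only [Set.mem_Ioi] at ht
  rw [norm_mul]
  calc _ ≤ (C * (t * Real.exp (-t / 2))) * (c * (1 + t ^ (-(1/2):ℝ))) :=
        mul_le_mul (hC2 t ht) (hb t ht) (norm_nonneg _) (by positivity)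
    _ = _ := by
      have : t * t ^ (-(1/2):ℝ) = t ^ (1/2:ℝ) := by
        rw [← Real.rpow_one_add' ht.le (by norm_num)]; norm_num
      simp only [Pi.add_apply, Real.rpow_one]
      rw [← this]; ring

lemma gauss_sech_prod (a : ℂ) (ha : 0 ≤ a.re) (z : ℝ) :
    Integrable (fun p : ℝ × ℝ => etaDedekind (I * p.1) ^ 3 * exp (-(Real.pi * (p.1 + a)) * p.2^2 + (2 * Real.pi * I * z) * p.2 + 0))
     ((volume.restrict (Set.Ioi 0)).prod volume) := by
  have hp := Real.pi_pos
  have hn : ∀ t x : ℝ, ‖exp (-(Real.pi * (t + a)) * x^2 + (2 * Real.pi * I * z) * x + 0)‖ = Real.exp (-(Real.pi * (t + a.re)) * x^2) := by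
    intro t x
    rw [norm_exp]
    congr 1
    simp [← ofReal_pow]
  rw [integrable_prod_iff]
  · constructor
    · filter_upwards [ae_restrict_mem measurableSet_Ioi] with t ht
      apply Integrable.const_mul
      apply integrable_cexp_quadratic
      simp only [Set.mem_Ioi] at ht
      simp
      positivity
    · simp_rw [norm_mul, hn, integral_const_mul, integral_gaussian]
      have h1 : IntegrableOn (fun t : ℝ => etaDedekind (I * t) ^ 3 * ((√(Real.pi / (Real.pi * (t + a.re))) : ℝ) : ℂ)) (Set.Ioi 0) := by
        apply int_eta_mul _ _ 1
        · intro t ht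
          rw [norm_real, Real.norm_of_nonneg (Real.sqrt_nonneg _), one_mul]
          have : √(Real.pi / (Real.pi * (t + a.re))) ≤ t ^ (-(1/2):ℝ) := by
            rw [Real.rpow_neg ht.le, ← Real.sqrt_eq_rpow, ← Real.sqrt_inv]
            apply Real.sqrt_le_sqrt
            rw [← div_div, div_self hp.ne', ← one_div]
            gcongr
            linarith
          linarith
        · apply Continuous.comp_continuousOn continuous_ofReal
          apply Continuous.comp_continuousOn Real.continuous_sqrt
          apply ContinuousOn.div (by fun_prop) (by fun_prop)
          intro t ht
          simp only [Set.mem_Ioi] at ht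
          positivity
      refine h1.norm.congr ?_
      filter_upwards with t
      rw [norm_mul, norm_real, Real.norm_of_nonneg (Real.sqrt_nonneg _)]
  · have : (volume.restrict (Set.Ioi (0:ℝ))).prod (volume : Measure ℝ) = (volume.prod volume).restrict (Set.Ioi (0:ℝ) ×ˢ Set.univ) := by
      rw [← Measure.prod_restrict, Measure.restrict_univ]
    rw [this]
    apply ContinuousOn.aestronglyMeasurable _ (measurableSet_Ioi.prod MeasurableSet.univ)
    apply ContinuousOn.mul
    · exact cont_eta_it.comp continuousOn_fst (fun p hp => hp.1)
    · fun_prop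

lemma gauss_sech (a : ℂ) (ha : 0 ≤ a.re) (z : ℝ) :
    ∫ x : ℝ, exp (-(Real.pi * a * x^2) + 2 * Real.pi * I * z * x) / cosh (Real.pi * x) =
    ∫ t in Set.Ioi (0:ℝ), etaDedekind (I * t) ^ 3 * ((1 / (t + a)) ^ (1/2 : ℂ) * exp (-(Real.pi * z^2 / (t + a)))) := by
  have hp := Real.pi_pos
  have hsw := integral_integral_swap (μ := volume.restrict (Set.Ioi (0:ℝ))) (ν := (volume : Measure ℝ))
    (f := fun t x => etaDedekind (I * t) ^ 3 * exp (-(Real.pi * (t + a)) * x^2 + (2 * Real.pi * I * z) * x + 0))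
    (gauss_sech_prod a ha z)
  calc _ = ∫ x : ℝ, ∫ t in Set.Ioi (0:ℝ), etaDedekind (I * t) ^ 3 * exp (-(Real.pi * (t + a)) * x^2 + (2 * Real.pi * I * z) * x + 0) := by
        congr 1; ext x
        rw [div_eq_mul_one_div, ← laplace_sech, ← integral_const_mul]
        congr 1; ext t
        rw [mul_left_comm, ← Complex.exp_add]
        congr 2; ring
    _ = _ := hsw.symm
    _ = _ := by
        apply setIntegral_congr_fun measurableSet_Ioi
        intro t ht
        simp only [Set.mem_Ioi] at ht
        have h1 : 0 < ((t:ℂ) + a).re := by simp; linarith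
        have h2 : (t:ℂ) + a ≠ 0 := by intro h; rw [h] at h1; simp at h1
        have hpc : (Real.pi : ℂ) ≠ 0 := by exact_mod_cast Real.pi_ne_zero
        simp only
        rw [integral_const_mul, integral_cexp_quadratic (by simp at h1 ⊢; positivity)]
        congr 2
        · congr 1; field_simp
        · congr 1
          field_simp
          linear_combination 4 * Real.pi * z^2 * I_sq

lemma sech_fourier (z : ℝ) :
    ∫ x : ℝ, exp (2 * Real.pi * I * z * x) / cosh (Real.pi * x) = 1 / cosh (Real.pi * z) := by
  have h := gauss_sech 0 (by simp) z
  simp only [mul_zero, zero_mul, neg_zero, zero_add, add_zero] at h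
  rw [h, ← laplace_sech, ← integral_comp_rpow_Ioi _ (by norm_num : (-1:ℝ) ≠ 0)]
  apply setIntegral_congr_fun measurableSet_Ioi
  intro t ht
  simp only [Set.mem_Ioi] at ht
  have him : 0 < (I * (t:ℂ)).im := by simpa using ht
  have htc : (t:ℂ) ≠ 0 := by exact_mod_cast ht.ne'
  have e1 : I * ((t ^ (-1:ℝ) : ℝ) : ℂ) = -1 / (I * (t:ℂ)) := by
    rw [Real.rpow_neg_one]
    push_cast
    field_simp
    simp
  have e2 : -I * (I * (t:ℂ)) = t := by rw [← mul_assoc]; simp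
  simp only
  rw [e1, eta_S him]
  have hs : sqI (I * t) = (t:ℂ) ^ (1/2 : ℂ) := by rw [sqI, e2]
  have hs2 := sqI_sq him
  rw [e2] at hs2
  have hc : (1 / ((t ^ (-1:ℝ) : ℝ) : ℂ)) = t := by rw [Real.rpow_neg_one]; push_cast; simp
  have hc2 : (Real.pi * (z:ℂ)^2 / ((t ^ (-1:ℝ) : ℝ) : ℂ)) = Real.pi * z^2 * t := by
    rw [div_eq_mul_one_div, hc]
  rw [hc, ← hs, hc2, real_smul]
  have e3 : ((|(-1:ℝ)| * t ^ ((-1:ℝ) - 1) : ℝ) : ℂ) = 1 / t^2 := by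
    rw [show ((-1:ℝ) - 1) = -(2:ℕ) by norm_num, Real.rpow_neg ht.le, Real.rpow_natCast]
    simp
  rw [e3, show -(Real.pi * (z:ℂ)^2 * t) = -Real.pi * z^2 * t by ring]
  have : sqI (I * t) ^ 4 = t^2 := by linear_combination (sqI (I * t) ^ 2 + t) * hs2
  calc _ = sqI (I * t) ^ 4 / t^2 * (etaDedekind (I * t) ^ 3 * exp (-Real.pi * z^2 * t)) := by ring
    _ = _ := by rw [this, div_self (pow_ne_zero _ htc), one_mul]

end

section
open Filter Topology

def S3 (τ : ℂ) : ℂ := ∑' n : ℤ, qp τ ((n : ℂ) ^ 2 / 2 - 1 / 8) / (1 + qp τ ((n : ℂ) - 1 / 2))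

lemma S3_term (τ : ℂ) (n : ℤ) : qp τ ((n : ℂ) ^ 2 / 2 - 1 / 8) / (1 + qp τ ((n : ℂ) - 1 / 2)) =
    exp (Real.pi * I * τ * ((n:ℂ) - 1/2)^2) / (2 * cos (Real.pi * τ * ((n:ℂ) - 1/2))) := by
  have h1 : 1 + qp τ ((n : ℂ) - 1 / 2) = exp (Real.pi * I * τ * ((n:ℂ) - 1/2)) * (2 * cos (Real.pi * τ * ((n:ℂ) - 1/2))) := by
    rw [Complex.two_cos, mul_add, ← Complex.exp_add, ← Complex.exp_add, qp]
    rw [add_comm]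
    congr 1
    · congr 1; ring
    · rw [← Complex.exp_zero]; congr 1; ring
  have h2 : qp τ ((n : ℂ) ^ 2 / 2 - 1 / 8) = exp (Real.pi * I * τ * ((n:ℂ) - 1/2)) * exp (Real.pi * I * τ * ((n:ℂ) - 1/2)^2) := by
    rw [qp, ← Complex.exp_add]; congr 1; ring
  rw [h1, h2, mul_div_mul_left _ _ (Complex.exp_ne_zero _)]

lemma S3_term_it (y : ℝ) (n : ℤ) : qp (I * y) ((n : ℂ) ^ 2 / 2 - 1 / 8) / (1 + qp (I * y) ((n : ℂ) - 1 / 2)) =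
    exp (-(Real.pi * y * ((n:ℂ) - 1/2)^2)) / (2 * cosh (Real.pi * (y * ((n:ℂ) - 1/2)))) := by
  rw [S3_term, show Real.pi * (I * (y:ℂ)) * ((n:ℂ) - 1/2) = (Real.pi * (y * ((n:ℂ) - 1/2))) * I by ring, Complex.cos_mul_I]
  congr 2
  linear_combination Real.pi * y * ((n:ℂ) - 1/2)^2 * I_mul_I

lemma cosh_ne (x : ℝ) : cosh (x:ℂ) ≠ 0 := by
  rw [← ofReal_cosh]
  exact_mod_cast (Real.cosh_pos _).ne'

lemma cosh_ne' (x : ℝ) : cosh (Real.pi * (x:ℂ)) ≠ 0 := by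
  have := cosh_ne (Real.pi * x)
  push_cast at this; exact this

lemma norm_cosh (x : ℝ) : ‖cosh (Real.pi * (x:ℂ))‖ = Real.cosh (Real.pi * x) := by
  rw [← ofReal_mul, ← ofReal_cosh, norm_real, Real.norm_of_nonneg (Real.cosh_pos _).le]

lemma inv_cosh_le (x : ℝ) : 1 / Real.cosh (Real.pi * x) ≤ 2 * Real.exp (-(Real.pi * |x|)) := by
  rw [div_le_iff₀ (Real.cosh_pos _)]
  have h : Real.cosh (Real.pi * x) = Real.cosh (Real.pi * |x|) := by
    rw [← Real.cosh_abs, abs_mul, abs_of_pos Real.pi_pos]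
  rw [h, Real.cosh_eq]
  have := Real.exp_pos (-(Real.pi * |x|))
  have h2 : Real.exp (-(Real.pi * |x|)) * Real.exp (Real.pi * |x|) = 1 := by rw [← Real.exp_add]; simp
  nlinarith

lemma int_inv_cosh : Integrable fun x : ℝ => 1 / cosh (Real.pi * (x:ℂ)) := by
  by_contra h
  have h1 := integral_undef h
  have h2 := sech_fourier 0
  simp at h2 h1
  rw [h1] at h2
  exact zero_ne_one h2

lemma swap1 {y : ℝ} (hy : 0 < y) : 2 * S3 (I * y) = ∫ x : ℝ, (∑' n : ℤ,
    exp (-(Real.pi * y * ((n:ℂ) - 1/2)^2) + 2 * Real.pi * I * (y * ((n:ℂ) - 1/2)) * x)) / cosh (Real.pi * (x:ℂ)) := by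
  have key := hasSum_integral_of_summable_integral_norm (μ := volume)
    (F := fun (n : ℤ) (x : ℝ) => exp (-(Real.pi * y * ((n:ℂ) - 1/2)^2)) * (exp (2 * Real.pi * I * ((y * ((n:ℝ) - 1/2) : ℝ):ℂ) * x) / cosh (Real.pi * (x:ℂ)))) ?_ ?_
  · have h1 : (fun n : ℤ => ∫ x : ℝ, exp (-(Real.pi * y * ((n:ℂ) - 1/2)^2)) * (exp (2 * Real.pi * I * ((y * ((n:ℝ) - 1/2) : ℝ):ℂ) * x) / cosh (Real.pi * (x:ℂ))))
        = fun n : ℤ => 2 * (qp (I * y) ((n : ℂ) ^ 2 / 2 - 1 / 8) / (1 + qp (I * y) ((n : ℂ) - 1 / 2))) := by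
      funext n
      rw [integral_const_mul, sech_fourier, S3_term_it]
      have := cosh_ne' (y * ((n:ℝ) - 1/2))
      push_cast at this ⊢
      field_simp
    rw [h1] at key
    rw [S3, ← tsum_mul_left, key.tsum_eq]
    congr 1
    funext x
    rw [← tsum_div_const]
    congr 1; funext n
    rw [Complex.exp_add, mul_div_assoc]
    push_cast
    rfl
  · intro n
    apply Integrable.const_mul
    have := int_inv_cosh.bdd_mul (f := fun x : ℝ => exp (2 * Real.pi * I * ((y * ((n:ℝ) - 1/2) : ℝ):ℂ) * x)) (c := 1) (by apply Continuous.aestronglyMeasurable; fun_prop) ?_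
    · refine this.congr ?_
      filter_upwards with x
      ring
    · filter_upwards with x
      rw [show 2 * Real.pi * I * ((y * ((n:ℝ) - 1/2) : ℝ):ℂ) * x = ((2 * Real.pi * (y * ((n:ℝ) - 1/2)) * x : ℝ) : ℂ) * I by push_cast; ring, norm_exp_ofReal_mul_I]
  · have h2 : ∀ n : ℤ, (∫ x : ℝ, ‖exp (-(Real.pi * y * ((n:ℂ) - 1/2)^2)) * (exp (2 * Real.pi * I * ((y * ((n:ℝ) - 1/2) : ℝ):ℂ) * x) / cosh (Real.pi * (x:ℂ)))‖) = Real.exp (-Real.pi * (y * ((n:ℝ) - 1/2)^2)) * ∫ x : ℝ, ‖1 / cosh (Real.pi * (x:ℂ))‖ := by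
      intro n
      rw [← integral_const_mul]
      congr 1; funext x
      rw [norm_mul, norm_div, norm_div, show 2 * Real.pi * I * ((y * ((n:ℝ) - 1/2) : ℝ):ℂ) * x = ((2 * Real.pi * (y * ((n:ℝ) - 1/2)) * x : ℝ) : ℂ) * I by push_cast; ring, norm_exp_ofReal_mul_I, norm_one]
      congr 1
      rw [show -(Real.pi * y * ((n:ℂ) - 1/2)^2) = ((-Real.pi * (y * ((n:ℝ) - 1/2)^2) : ℝ):ℂ) by push_cast; ring, norm_exp_ofReal]
    simp_rw [h2]
    apply Summable.mul_right
    have := summable_poly_gauss (T := y) 0 (S := y/2) hy (c := fun _ => 1) (C := 1) (e := fun n => y * ((n:ℝ) - 1/2)^2) ?_ ?_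
    · simpa using this
    · intro n; simp
    · intro n
      have := le_abs_self (n:ℝ)
      have := sq_abs (n:ℝ)
      nlinarith

lemma theta_inv {y : ℝ} (hy : 0 < y) (x : ℝ) : ∑' n : ℤ,
    exp (-(Real.pi * y * ((n:ℂ) - 1/2)^2) + 2 * Real.pi * I * (y * ((n:ℂ) - 1/2)) * x) =
    (sqI (I * y))⁻¹ * ∑' n : ℤ, (-1 : ℂ)^n * exp (-(Real.pi * n^2 / y)) * exp (-(Real.pi * y * x^2) + 2 * Real.pi * n * x) := by
  have hy' : (y:ℂ) ≠ 0 := by exact_mod_cast hy.ne'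
  have h1 : ∀ n : ℤ, exp (-(Real.pi * y * ((n:ℂ) - 1/2)^2) + 2 * Real.pi * I * (y * ((n:ℂ) - 1/2)) * x)
     = exp (-(Real.pi * y / 4) - Real.pi * I * y * x) * jacobiTheta₂_term n (y * x - I * y / 2) (I * y) := by
    intro n
    rw [jacobiTheta₂_term, ← Complex.exp_add]
    congr 1
    linear_combination (Real.pi * n * y - Real.pi * n^2 * y) * I_mul_I
  simp_rw [h1]
  rw [tsum_mul_left, ← jacobiTheta₂, jacobiTheta₂_functional_equation, ← mul_assoc, jacobiTheta₂, ← tsum_mul_left, ← tsum_mul_left]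
  congr 1; funext n
  rw [neg_one_zpow_exp, jacobiTheta₂_term, sqI]
  have e1 : exp (-(Real.pi * y / 4) - Real.pi * I * y * x) * exp (-Real.pi * I * (y * x - I * y / 2)^2 / (I * y)) * exp (2 * Real.pi * I * n * ((y * x - I * y / 2) / (I * y)) + Real.pi * I * n^2 * (-1 / (I * y))) = exp (Real.pi * I * n) * exp (-(Real.pi * n^2 / y)) * exp (-(Real.pi * y * x^2) + 2 * Real.pi * n * x) := by
    rw [← Complex.exp_add, ← Complex.exp_add, ← Complex.exp_add, ← Complex.exp_add, Complex.exp_eq_exp_iff_exists_int]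
    refine ⟨-n, ?_⟩
    field_simp
    ring_nf
    simp only [I_sq]
    push_cast
    ring_nf
  rw [← e1]
  ring


lemma sqI_it {y : ℝ} (hy : 0 < y) : sqI (I * y) = (Real.sqrt y : ℂ) := by
  apply eq_of_sq_eq_re_pos
  · rw [sqI_sq (by simpa using hy), ← ofReal_pow, Real.sq_sqrt hy.le]
    linear_combination -(y:ℂ) * I_mul_I
  · exact sqI_re_pos (by simpa using hy)
  · simpa using hy

lemma gauss_it {y : ℝ} (hy : 0 < y) (μ : ℝ) :
    ∫ x : ℝ, exp (-(Real.pi * y * x^2) + 2 * Real.pi * μ * x) = (sqI (I * y))⁻¹ * exp (Real.pi * μ^2 / y) := by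
  have hy' : (y:ℂ) ≠ 0 := by exact_mod_cast hy.ne'
  have hp : (Real.pi:ℂ) ≠ 0 := by exact_mod_cast Real.pi_pos.ne'
  have hyp : 0 < Real.pi * y := by positivity
  have h := integral_cexp_quadratic (b := -(Real.pi * y)) (by simpa using hyp) (2 * Real.pi * μ) 0
  have e1 : (Real.pi / -(-(Real.pi * y)) : ℂ) ^ (1/2:ℂ) = (sqI (I * y))⁻¹ := by
    rw [sqI_it hy, show (Real.pi / -(-(Real.pi * y)) : ℂ) = ((1/y : ℝ) : ℂ) by push_cast; field_simp]
    apply eq_of_sq_eq_re_pos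
    · rw [cpow_half_sq, inv_pow, ← ofReal_pow, Real.sq_sqrt hy.le]; push_cast; simp
    · apply cpow_half_re_pos
      exact Or.inl (by rw [ofReal_re]; positivity)
    · rw [← ofReal_inv, ofReal_re]; positivity
  rw [e1] at h
  rw [show (Real.pi * μ^2 / y : ℂ) = 0 - (2 * Real.pi * μ)^2 / (4 * -(Real.pi * y)) by field_simp; ring, ← h]
  congr 1; funext x; congr 1; ring

lemma gauss_it_int {y : ℝ} (hy : 0 < y) (μ : ℝ) :
    Integrable fun x : ℝ => exp (-(Real.pi * y * x^2) + 2 * Real.pi * μ * x) := by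
  have hyp : 0 < Real.pi * y := by positivity
  have := integrable_cexp_quadratic (b := Real.pi * y) (by simpa using hyp) (2 * Real.pi * μ) 0
  refine this.congr ?_
  filter_upwards with x
  congr 1; ring

lemma gauss_it_norm {y : ℝ} (hy : 0 < y) (μ : ℝ) :
    ∫ x : ℝ, ‖exp (-(Real.pi * y * x^2) + 2 * Real.pi * μ * x)‖ = (Real.sqrt y)⁻¹ * Real.exp (Real.pi * μ^2 / y) := by
  have h := gauss_it hy μ
  have h1 : ∀ x : ℝ, exp (-(Real.pi * y * x^2) + 2 * Real.pi * μ * x) = ((‖exp (-(Real.pi * y * x^2) + 2 * Real.pi * μ * x)‖ : ℝ) : ℂ) := by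
    intro x
    rw [show (-(Real.pi * y * x^2) + 2 * Real.pi * μ * x : ℂ) = ((-(Real.pi * y * x^2) + 2 * Real.pi * μ * x : ℝ) : ℂ) by push_cast; ring, norm_exp_ofReal, ofReal_exp]
  have h2 : ∫ x : ℝ, exp (-(Real.pi * y * x^2) + 2 * Real.pi * μ * x) = ∫ x : ℝ, ((‖exp (-(Real.pi * y * x^2) + 2 * Real.pi * μ * x)‖ : ℝ) : ℂ) := by
    congr 1; funext x; exact h1 x
  rw [h2, integral_complex_ofReal, sqI_it hy] at h
  apply ofReal_injective
  rw [h]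
  push_cast
  rfl

def JJ (y : ℝ) (n : ℤ) (x : ℝ) : ℂ := (-1:ℂ)^n * exp (-(Real.pi * y * x^2) + 2 * Real.pi * n * x) / cosh (Real.pi * (x:ℂ))

lemma inv_cosh_le1 (x : ℝ) : 1 / Real.cosh (Real.pi * x) ≤ 2 * Real.exp (-(Real.pi * x)) := by
  refine (inv_cosh_le x).trans ?_
  have := le_abs_self x
  have := Real.pi_pos
  gcongr

lemma inv_cosh_le2 (x : ℝ) : 1 / Real.cosh (Real.pi * x) ≤ 2 * Real.exp (Real.pi * x) := by
  have := inv_cosh_le1 (-x)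
  rw [show Real.pi * -x = - (Real.pi * x) by ring, Real.cosh_neg, neg_neg] at this
  exact this

lemma JJ_bd1 (y : ℝ) (n : ℤ) (x : ℝ) : ‖JJ y n x‖ ≤ 2 * ‖exp (-(Real.pi * y * x^2) + 2 * Real.pi * ((n - 1/2 : ℝ):ℂ) * x)‖ := by
  rw [JJ, norm_div, norm_mul, norm_zpow, norm_neg, norm_one, one_zpow, one_mul, norm_cosh, div_eq_mul_one_div]
  refine (mul_le_mul_of_nonneg_left (inv_cosh_le1 x) (norm_nonneg _)).trans (le_of_eq ?_)
  rw [← mul_assoc, mul_comm _ (2:ℝ), mul_assoc, ← norm_exp_ofReal, ← norm_mul, ← Complex.exp_add]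
  congr 3
  push_cast; ring

lemma JJ_bd2 (y : ℝ) (n : ℤ) (x : ℝ) : ‖JJ y n x‖ ≤ 2 * ‖exp (-(Real.pi * y * x^2) + 2 * Real.pi * ((n + 1/2 : ℝ):ℂ) * x)‖ := by
  rw [JJ, norm_div, norm_mul, norm_zpow, norm_neg, norm_one, one_zpow, one_mul, norm_cosh, div_eq_mul_one_div]
  refine (mul_le_mul_of_nonneg_left (inv_cosh_le2 x) (norm_nonneg _)).trans (le_of_eq ?_)
  rw [← mul_assoc, mul_comm _ (2:ℝ), mul_assoc, ← norm_exp_ofReal, ← norm_mul, ← Complex.exp_add]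
  congr 3
  push_cast; ring

lemma JJ_int {y : ℝ} (hy : 0 < y) (n : ℤ) : Integrable (JJ y n) := by
  refine ((gauss_it_int hy (n - 1/2)).norm.const_mul 2).mono' ?_ ?_
  · apply Continuous.aestronglyMeasurable
    unfold JJ
    exact Continuous.div (by fun_prop) (by fun_prop) cosh_ne'
  · filter_upwards with x
    exact JJ_bd1 y n x

lemma JJ_norm_int {y : ℝ} (hy : 0 < y) (n : ℤ) :
    Real.exp (-(Real.pi * n^2 / y)) * ∫ x, ‖JJ y n x‖ ≤ 2 * (Real.sqrt y)⁻¹ * Real.exp (Real.pi / y * (1/4)) * Real.exp (-(Real.pi / y) * |(n:ℝ)|) := by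
  rcases le_or_gt 0 n with hn | hn
  · have h1 : ∫ x, ‖JJ y n x‖ ≤ ∫ x : ℝ, 2 * ‖exp (-(Real.pi * y * x^2) + 2 * Real.pi * ((n - 1/2 : ℝ):ℂ) * x)‖ :=
      integral_mono (JJ_int hy n).norm ((gauss_it_int hy (n - 1/2)).norm.const_mul 2) (JJ_bd1 y n)
    rw [integral_const_mul, gauss_it_norm hy] at h1
    refine (mul_le_mul_of_nonneg_left h1 (Real.exp_pos _).le).trans (le_of_eq ?_)
    rw [abs_of_nonneg (by exact_mod_cast hn), mul_assoc (2 * (Real.sqrt y)⁻¹), ← Real.exp_add,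
      show ∀ a b c d : ℝ, a * (b * (c * d)) = (b * c) * (a * d) by intros; ring, ← Real.exp_add]
    congr 2; field_simp; ring
  · have h1 : ∫ x, ‖JJ y n x‖ ≤ ∫ x : ℝ, 2 * ‖exp (-(Real.pi * y * x^2) + 2 * Real.pi * ((n + 1/2 : ℝ):ℂ) * x)‖ :=
      integral_mono (JJ_int hy n).norm ((gauss_it_int hy (n + 1/2)).norm.const_mul 2) (JJ_bd2 y n)
    rw [integral_const_mul, gauss_it_norm hy] at h1
    refine (mul_le_mul_of_nonneg_left h1 (Real.exp_pos _).le).trans (le_of_eq ?_)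
    rw [abs_of_neg (by exact_mod_cast hn), mul_assoc (2 * (Real.sqrt y)⁻¹), ← Real.exp_add,
      show ∀ a b c d : ℝ, a * (b * (c * d)) = (b * c) * (a * d) by intros; ring, ← Real.exp_add]
    congr 2; field_simp; ring

lemma summable_exp_abs {a : ℝ} (ha : 0 < a) : Summable fun n : ℤ => Real.exp (-a * |(n:ℝ)|) := by
  have h : Summable fun n : ℕ => Real.exp (-a * n) := by
    have := summable_geometric_of_lt_one (r := Real.exp (-a)) (Real.exp_pos _).le (by rw [Real.exp_lt_one_iff]; linarith)
    refine this.congr ?_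
    intro n
    rw [← Real.exp_nat_mul]; congr 1; ring
  apply Summable.of_nat_of_neg
  · simpa using h
  · simpa using h

lemma swap2 {y : ℝ} (hy : 0 < y) : HasSum (fun n : ℤ => exp (-(Real.pi * n^2 / y)) * ∫ x, JJ y n x) (2 * sqI (I * y) * S3 (I * y)) := by
  have key := hasSum_integral_of_summable_integral_norm (μ := volume)
    (F := fun (n : ℤ) (x : ℝ) => exp (-(Real.pi * n^2 / y)) * JJ y n x) ?_ ?_
  · simp_rw [integral_const_mul] at key
    have h0 : sqI (I * y) ≠ 0 := sqI_ne (by simpa using hy)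
    have h1 := swap1 hy
    simp_rw [theta_inv hy, mul_div_assoc] at h1
    rw [integral_const_mul] at h1
    have e : 2 * sqI (I * y) * S3 (I * y) = ∫ (a : ℝ), ∑' (i : ℤ), exp (-(Real.pi * i ^ 2 / y)) * JJ y i a := by
      rw [show 2 * sqI (I * y) * S3 (I * y) = sqI (I * y) * (2 * S3 (I * y)) by ring, h1, mul_inv_cancel_left₀ h0]
      congr 1; funext x
      rw [← tsum_div_const]
      congr 1; funext n
      rw [JJ]; ring_nf
    rw [e]; exact key
  · intro n
    exact (JJ_int hy n).const_mul _
  · refine Summable.of_nonneg_of_le (fun n => integral_nonneg fun x => norm_nonneg _) ?_ ((summable_exp_abs (a := Real.pi / y) (by positivity)).mul_left (2 * (Real.sqrt y)⁻¹ * Real.exp (Real.pi / y * (1/4))))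
    intro n
    refine le_trans (le_of_eq ?_) (JJ_norm_int hy n)
    rw [← integral_const_mul]
    congr 1; funext x
    rw [norm_mul]
    congr 1
    rw [show (-(Real.pi * n^2 / y) : ℂ) = ((-(Real.pi * n^2 / y) : ℝ) : ℂ) by push_cast; ring, norm_exp_ofReal]

lemma JJ_succ {y : ℝ} (hy : 0 < y) (n : ℤ) : (∫ x, JJ y (n+1) x) = (∫ x, JJ y n x) - 2 * (sqI (I * y))⁻¹ * ((-1:ℂ)^n * exp (Real.pi * (n+1/2)^2 / y)) := by
  have h := gauss_it hy (n + 1/2)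
  have h1 : (∫ x, JJ y n x) - (∫ x, JJ y (n+1) x) = ∫ x : ℝ, 2 * (-1:ℂ)^n * exp (-(Real.pi * y * x^2) + 2 * Real.pi * ((n + 1/2 : ℝ) : ℂ) * x) := by
    rw [← integral_sub (JJ_int hy n) (JJ_int hy (n+1))]
    congr 1; funext x
    rw [JJ, JJ, ← sub_div, div_eq_iff (cosh_ne' x), zpow_add_one₀ (by norm_num)]
    have e1 : exp (-(Real.pi * y * x^2) + 2 * Real.pi * n * x) = exp (-(Real.pi * y * x^2) + 2 * Real.pi * ((n + 1/2 : ℝ) : ℂ) * x) * exp (-(Real.pi * x)) := by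
      rw [← Complex.exp_add]; congr 1; push_cast; ring
    have e2 : exp (-(Real.pi * y * x^2) + 2 * Real.pi * ((n + 1 : ℤ):ℂ) * x) = exp (-(Real.pi * y * x^2) + 2 * Real.pi * ((n + 1/2 : ℝ) : ℂ) * x) * exp (Real.pi * x) := by
      rw [← Complex.exp_add]; congr 1; push_cast; ring
    rw [e1, e2]
    have h2 := Complex.two_cosh (Real.pi * x)
    linear_combination -(-1:ℂ)^n * exp (-(Real.pi * y * x^2) + 2 * Real.pi * ((n + 1/2 : ℝ) : ℂ) * x) * h2
  rw [integral_const_mul, h] at h1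
  push_cast at h1
  linear_combination -h1

lemma JJ_neg {y : ℝ} (n : ℤ) : (∫ x, JJ y (-n) x) = ∫ x, JJ y n x := by
  rw [← integral_neg_eq_self]
  congr 1; funext x
  rw [JJ, JJ, zpow_neg, ← inv_zpow]
  push_cast
  rw [show (Real.pi:ℂ) * -x = -(Real.pi * x) by ring, Complex.cosh_neg]
  congr 2
  · norm_num
  · congr 1; ring

lemma JJ_nat {y : ℝ} (hy : 0 < y) (n : ℕ) : (∫ x, JJ y n x) = (∫ x, JJ y 0 x) - 2 * (sqI (I * y))⁻¹ * ∑ k ∈ Finset.range n, (-1:ℂ)^k * exp (Real.pi * (k+1/2)^2 / y) := by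
  induction n with
  | zero => simp
  | succ n ih =>
    rw [Finset.sum_range_succ]
    push_cast
    rw [JJ_succ hy, ih]
    push_cast
    rw [zpow_natCast]
    ring


def GG (y : ℝ) (p : ℕ × ℕ) : ℂ := (-1:ℂ)^p.1 * exp (-(Real.pi * ((p.2 + 1/2) * (p.2 + 2 * p.1 + 3/2)) / y))

lemma GG_summable {y : ℝ} (hy : 0 < y) : Summable (GG y) := by
  have h : ∀ a : ℝ, 0 < a → Summable fun n : ℕ => Real.exp (-a * n) := by
    intro a ha
    have := summable_geometric_of_lt_one (r := Real.exp (-a)) (Real.exp_pos _).le (by rw [Real.exp_lt_one_iff]; linarith)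
    refine this.congr ?_
    intro n
    rw [← Real.exp_nat_mul]; congr 1; ring
  have h1 := (h (Real.pi / y) (by positivity)).mul_of_nonneg (h (Real.pi / y / 2) (by positivity)) (fun n => (Real.exp_pos _).le) (fun n => (Real.exp_pos _).le)
  refine Summable.of_norm_bounded h1 ?_
  rintro ⟨j, m⟩
  rw [GG, norm_mul, norm_pow, norm_neg, norm_one, one_pow, one_mul]
  simp only
  rw [show (-(Real.pi * ((m + 1/2) * (m + 2 * j + 3/2)) / y) : ℂ) = ((-(Real.pi * ((m + 1/2) * (m + 2 * j + 3/2)) / y) : ℝ) : ℂ) by push_cast; ring, norm_exp_ofReal, ← Real.exp_add]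
  apply Real.exp_le_exp.2
  have hm : (0:ℝ) ≤ m := by positivity
  have hj : (0:ℝ) ≤ j := by positivity
  have hp : 0 < Real.pi / y := by positivity
  have : (j:ℝ) + m / 2 ≤ (m + 1/2) * (m + 2 * j + 3/2) := by nlinarith [mul_nonneg hm hj]
  have h3 := mul_le_mul_of_nonneg_left this hp.le
  have e1 : Real.pi * ((m + 1/2) * (m + 2 * j + 3/2)) / y = Real.pi / y * ((m + 1/2) * (m + 2 * j + 3/2)) := by ring
  rw [e1]
  linarith

lemma GG_col {y : ℝ} (hy : 0 < y) : HasSum (fun m : ℕ => exp (-(Real.pi * (m + 1/2)^2 / y)) / (2 * cosh (Real.pi * (m + 1/2) / y))) (∑' p, GG y p) := by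
  have h := ((Equiv.prodComm ℕ ℕ).hasSum_iff (f := GG y)).2 (GG_summable hy).hasSum
  refine h.prod_fiberwise ?_
  intro m
  have hlt : ‖-exp (-(2 * Real.pi * (m + 1/2) / y))‖ < 1 := by
    rw [norm_neg, show (-(2 * Real.pi * (m + 1/2) / y) : ℂ) = ((-(2 * Real.pi * (m + 1/2) / y) : ℝ) : ℂ) by push_cast; ring, norm_exp_ofReal, Real.exp_lt_one_iff]
    have : 0 < 2 * Real.pi * (m + 1/2) / y := by positivity
    linarith
  have h1 := (hasSum_geometric_of_norm_lt_one hlt).mul_left (exp (-(Real.pi * ((m + 1/2) * (m + 3/2)) / y)))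
  have hc := cosh_ne' ((m + 1/2) / y)
  push_cast at hc
  rw [← mul_div_assoc] at hc
  have e : exp (-(Real.pi * ((m + 1/2) * (m + 3/2)) / y)) * (1 - -exp (-(2 * Real.pi * (m + 1/2) / y)))⁻¹ = exp (-(Real.pi * (m + 1/2)^2 / y)) / (2 * cosh (Real.pi * (m + 1/2) / y)) := by
    have e1 : 1 - -exp (-(2 * Real.pi * (m + 1/2) / y)) = exp (-(Real.pi * (m + 1/2) / y)) * (2 * cosh (Real.pi * (m + 1/2) / y)) := by
      have e3 : exp (-(Real.pi * (m + 1/2) / y)) * exp (Real.pi * (m + 1/2) / y) = 1 := by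
        rw [← Complex.exp_add, neg_add_cancel, Complex.exp_zero]
      have e4 : exp (-(2 * Real.pi * (m + 1/2) / y)) = exp (-(Real.pi * (m + 1/2) / y)) * exp (-(Real.pi * (m + 1/2) / y)) := by
        rw [← Complex.exp_add]; congr 1; ring
      rw [Complex.two_cosh, e4]
      linear_combination -e3
    have e2 : exp (-(Real.pi * ((m + 1/2) * (m + 3/2)) / y)) = exp (-(Real.pi * (m + 1/2) / y)) * exp (-(Real.pi * (m + 1/2)^2 / y)) := by
      rw [← Complex.exp_add]; congr 1; ring
    rw [e1, e2, ← div_eq_mul_inv, mul_div_mul_left _ _ (Complex.exp_ne_zero _)]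
  rw [e] at h1
  refine h1.congr_fun ?_
  intro j
  simp only [Function.comp, Equiv.prodComm_apply, Prod.swap, GG]
  rw [neg_pow (exp _), ← Complex.exp_nat_mul, mul_left_comm (exp _), ← Complex.exp_add]
  congr 2; ring

lemma GG_diag {y : ℝ} (hy : 0 < y) : HasSum (fun n : ℕ => exp (-(Real.pi * n^2 / y)) * ∑ k ∈ Finset.range n, (-1:ℂ)^k * exp (Real.pi * (k+1/2)^2 / y)) (∑' p, GG y p) := by
  have h := (Finset.HasAntidiagonal.sigmaAntidiagonalEquivProd.hasSum_iff (f := GG y)).2 (GG_summable hy).hasSum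
  have h2 := h.sigma (fun n => Finset.hasSum (Finset.HasAntidiagonal.antidiagonal n) (GG y))
  rw [← hasSum_nat_add_iff' 1]
  simp only [Finset.range_one, Finset.sum_singleton, Finset.range_zero, Finset.sum_empty, mul_zero, sub_zero]
  refine h2.congr_fun ?_
  intro n
  rw [Finset.Nat.sum_antidiagonal_eq_sum_range_succ_mk, Finset.mul_sum]
  apply Finset.sum_congr rfl
  intro k hk
  have hk' : k ≤ n := by simpa [Nat.lt_succ_iff] using hk
  rw [GG, mul_left_comm (exp _), ← Complex.exp_add]
  congr 2
  simp only
  rw [Nat.cast_sub hk']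
  push_cast
  ring

lemma S3_inv {y : ℝ} (hy : 0 < y) : S3 (I * (y⁻¹ : ℝ)) = 2 * ∑' p, GG y p := by
  have h := GG_col hy
  have h1 : HasSum (fun n : ℤ => exp (-(Real.pi * (n + 1/2)^2 / y)) / (2 * cosh (Real.pi * (n + 1/2) / y))) ((∑' p, GG y p) + ∑' p, GG y p) := by
    apply HasSum.of_nat_of_neg_add_one
    · simpa using h
    · refine h.congr_fun ?_
      intro n
      push_cast
      congr 1
      · congr 1; ring
      · rw [← Complex.cosh_neg]; congr 2; ring
  rw [two_mul, ← h1.tsum_eq, S3, ← (Equiv.addRight (1:ℤ)).tsum_eq]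
  congr 1; funext n
  rw [S3_term_it]
  simp only [Equiv.coe_addRight]
  push_cast
  congr 1
  · congr 1; ring
  · congr 2; ring

lemma mordell_it {y : ℝ} (hy : 0 < y) : 2 * sqI (I * y) * S3 (I * y) = theta3 (I * (y⁻¹:ℝ)) * (∫ x, JJ y 0 x) - 2 * (sqI (I * y))⁻¹ * S3 (I * (y⁻¹:ℝ)) := by
  have h1 := (swap2 hy).nat_add_neg
  have h2 : HasSum (fun n : ℤ => exp (-(Real.pi * n^2 / y))) (theta3 (I * (y⁻¹:ℝ))) := by
    have := (hasSum_jacobiTheta₂_term 0 (τ := I * (y⁻¹:ℝ)) (by simpa using hy))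
    rw [theta3_eq]
    refine this.congr_fun ?_
    intro n
    rw [jacobiTheta₂_term]
    congr 1
    push_cast
    linear_combination -Real.pi * n^2 * (y:ℂ)⁻¹ * I_mul_I
  have h3 := h2.nat_add_neg.mul_right (∫ x, JJ y 0 x)
  have h4 := (GG_diag hy).mul_left (4 * (sqI (I * y))⁻¹)
  have h5 := h3.sub h4
  have h6 := h1.unique (h5.congr_fun ?_)
  · rw [S3_inv hy]
    simp at h6
    rw [ofReal_inv]
    linear_combination h6
  · intro n
    rw [JJ_neg]
    push_cast
    rw [JJ_nat hy]
    push_cast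
    rw [neg_sq]
    ring

end

section
open Filter Topology

def gg (τ w : ℂ) : ℂ := etaDedekind w ^ 3 * (-I * (w + τ)) ^ (-(1/2) : ℂ)
def EE (τ z : ℂ) : ℂ := ∫ t in Set.Ioi (0:ℝ), gg τ (z + I * (t:ℂ)) * I
def KK (τ : ℂ) : ℂ := ∫ t in Set.Ioi (0:ℝ), gg τ (I * (t:ℂ))

lemma eichler_eq (τ : ℂ) : eichler τ = EE τ (-(starRingEnd ℂ) τ) := rfl

lemma re_csq {a : ℂ} (ha : 0 < a.re) : 0 < (a ^ ((1:ℂ)/2)).re ∧ |(a ^ ((1:ℂ)/2)).im| < (a ^ ((1:ℂ)/2)).re := by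
  have h1 := cpow_half_re_pos (z := a) (Or.inl ha)
  refine ⟨h1, ?_⟩
  have h2 := cpow_half_sq a
  have h3 := congrArg Complex.re h2
  rw [sq, mul_re] at h3
  apply abs_lt_of_sq_lt_sq _ h1.le
  nlinarith

lemma csq_mul {a b : ℂ} (ha : 0 < a.re) (hb : 0 < b.re) :
    (a * b) ^ ((1:ℂ)/2) = a ^ ((1:ℂ)/2) * b ^ ((1:ℂ)/2) := by
  obtain ⟨h1, h2⟩ := re_csq ha
  obtain ⟨h3, h4⟩ := re_csq hb
  have h5 : 0 < (a ^ ((1:ℂ)/2) * b ^ ((1:ℂ)/2)).re := by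
    rw [mul_re]
    have : |(a ^ ((1:ℂ)/2)).im * (b ^ ((1:ℂ)/2)).im| < (a ^ ((1:ℂ)/2)).re * (b ^ ((1:ℂ)/2)).re := by
      rw [abs_mul]
      exact mul_lt_mul'' h2 h4 (abs_nonneg _) (abs_nonneg _)
    linarith [le_abs_self ((a ^ ((1:ℂ)/2)).im * (b ^ ((1:ℂ)/2)).im)]
  have h6 : (a * b) ∈ slitPlane := by
    by_contra hn
    have h7 : (a ^ ((1:ℂ)/2) * b ^ ((1:ℂ)/2))^2 = a * b := by rw [mul_pow, cpow_half_sq, cpow_half_sq]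
    rw [Complex.mem_slitPlane_iff] at hn
    push Not at hn
    rw [← h7] at hn
    generalize a ^ ((1:ℂ)/2) * b ^ ((1:ℂ)/2) = u at hn h5
    rw [sq, mul_re, mul_im] at hn
    obtain ⟨hn1, hn2⟩ := hn
    have : u.im = 0 := by
      have h8 : u.re * u.im = 0 := by linarith
      rcases mul_eq_zero.1 h8 with h | h
      · linarith
      · exact h
    rw [this] at hn1
    nlinarith
  apply eq_of_sq_eq_re_pos
  · rw [mul_pow, cpow_half_sq, cpow_half_sq, cpow_half_sq]
  · exact cpow_half_re_pos h6
  · exact h5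

lemma csq_inv_add {a b : ℂ} (ha : 0 < a.re) (hb : 0 < b.re) :
    (a⁻¹ + b⁻¹) ^ ((1:ℂ)/2) * (a ^ ((1:ℂ)/2) * b ^ ((1:ℂ)/2)) = (a + b) ^ ((1:ℂ)/2) := by
  have ha0 : a ≠ 0 := by rintro rfl; simp at ha
  have hb0 : b ≠ 0 := by rintro rfl; simp at hb
  have hai : 0 < (a⁻¹).re := by rw [inv_re]; exact div_pos ha (normSq_pos.2 ha0)
  have hbi : 0 < (b⁻¹).re := by rw [inv_re]; exact div_pos hb (normSq_pos.2 hb0)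
  have h1 := csq_mul (a := a⁻¹ + b⁻¹) (b := a) (by rw [add_re]; positivity) ha
  have h2 := csq_mul (a := a + b) (b := b⁻¹) (by rw [add_re]; positivity) hbi
  have h3 := csq_mul (a := b⁻¹) (b := b) hbi hb
  rw [inv_mul_cancel₀ hb0, one_cpow] at h3
  rw [← mul_assoc, ← h1, show (a⁻¹ + b⁻¹) * a = (a + b) * b⁻¹ by field_simp; ring, h2, mul_assoc, ← h3, mul_one]

lemma re_add {w τ : ℂ} : (-I * (w + τ)).re = w.im + τ.im := by simp

lemma gg_S {τ z : ℂ} (h : 0 < τ.im) (hz : 0 < z.im) : gg (-1/τ) (-1/z) = - z^2 * sqI τ * gg τ z := by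
  have hz0 := tau_ne hz
  have h0 := tau_ne h
  have h1 := csq_inv_add (a := -I * z) (b := -I * τ) (re_negI_mul hz) (re_negI_mul h)
  have e1 : -I * (-1/z + -1/τ) = (-I * z)⁻¹ + (-I * τ)⁻¹ := by
    rw [mul_inv, mul_inv]
    simp only [inv_neg, inv_I, neg_neg]
    ring
  have e2 : -I * z + -I * τ = -I * (z + τ) := by ring
  rw [gg, gg, e1, eta_S hz, cpow_neg, cpow_neg, ← e2, ← h1]
  have hs1 := sqI_ne hz
  have hs2 := sqI_ne h
  have h4 := sqI_sq hz
  have e3 : sqI z ^ 4 = -z^2 := by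
    rw [show sqI z ^ 4 = (sqI z ^ 2)^2 by ring, h4]
    linear_combination z^2 * I_mul_I
  change (sqI z * etaDedekind z)^3 * _ = _ * (_ * (_ * (sqI z * sqI τ))⁻¹)
  rw [← e3]
  rw [mul_inv, mul_inv]
  field_simp

lemma gg_diff {τ w : ℂ} (h : 0 < τ.im) (hw : 0 < w.im) : DifferentiableAt ℂ (gg τ) w := by
  unfold gg
  have h1 : -I * (w + τ) ∈ slitPlane := Or.inl (by rw [re_add]; positivity)
  have h2 : DifferentiableAt ℂ (fun w => (-I * (w + τ)) ^ (-(1/2) : ℂ)) w :=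
    DifferentiableAt.cpow (by fun_prop) (by fun_prop) h1
  exact ((diff_eta hw).pow 3).mul h2

lemma norm_cpow_nhalf_le {x : ℂ} {m : ℝ} (hm : 0 < m) (hx : m ≤ x.re) : ‖x ^ (-(1/2) : ℂ)‖ ≤ m ^ (-(1/2):ℝ) := by
  have := Complex.norm_cpow_real x (-(1/2))
  push_cast at this
  rw [this]
  have h2 : m ≤ ‖x‖ := hx.trans (re_le_norm x)
  exact Real.rpow_le_rpow_of_nonpos hm h2 (by norm_num)

lemma gg_bd {τ : ℂ} (h : 0 < τ.im) {δ : ℝ} (hδ : 0 < δ) : ∃ C, 0 < C ∧ ∀ w : ℂ, δ ≤ w.im → ‖gg τ w‖ ≤ C * Real.exp (-Real.pi * w.im / 4) := by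
  obtain ⟨C, hC, hb⟩ := eta3_bd hδ
  refine ⟨C * τ.im ^ (-(1/2):ℝ), by positivity, ?_⟩
  intro w hw
  have h1 := hb w hw
  have h2 : ‖(-I * (w + τ)) ^ (-(1/2) : ℂ)‖ ≤ τ.im ^ (-(1/2):ℝ) := norm_cpow_nhalf_le h (by rw [re_add]; linarith)
  rw [gg, norm_mul]
  calc _ ≤ (C * Real.exp (-Real.pi * w.im / 4)) * τ.im ^ (-(1/2):ℝ) := mul_le_mul h1 h2 (norm_nonneg _) (by positivity)
    _ = _ := by ring

lemma im_add_It (z : ℂ) (t : ℝ) : (z + I * (t:ℂ)).im = z.im + t := by simp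

lemma gg_deriv_bd {τ : ℂ} (h : 0 < τ.im) {δ : ℝ} (hδ : 0 < δ) : ∃ C, 0 < C ∧ ∀ w : ℂ, δ ≤ w.im → ‖deriv (gg τ) w‖ ≤ C * Real.exp (-Real.pi * w.im / 4) := by
  obtain ⟨C, hC, hb⟩ := gg_bd h (δ := δ/2) (by positivity)
  refine ⟨C * Real.exp (Real.pi * δ / 8) / (δ/2), by positivity, ?_⟩
  intro w hw
  have him : ∀ z ∈ Metric.closedBall w (δ/2), w.im - δ/2 ≤ z.im := by
    intro z hz
    rw [Metric.mem_closedBall, dist_eq_norm] at hz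
    have := (abs_im_le_norm (z - w)).trans hz
    rw [sub_im] at this
    linarith [(abs_le.1 this).1]
  have := norm_deriv_le_of_forall_mem_sphere_norm_le (f := gg τ) (c := w) (R := δ/2) (C := C * Real.exp (-Real.pi * (w.im - δ/2) / 4)) (by positivity) ?_ ?_
  · refine this.trans (le_of_eq ?_)
    rw [show -Real.pi * (w.im - δ/2) / 4 = Real.pi * δ / 8 + -Real.pi * w.im / 4 by ring, Real.exp_add]
    ring
  · apply DifferentiableOn.diffContOnCl
    intro z hz
    have := him z (Metric.closure_ball_subset_closedBall hz)
    exact (gg_diff h (by linarith)).differentiableWithinAt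
  · intro z hz
    have h1 := him z (Metric.sphere_subset_closedBall hz)
    refine (hb z (by linarith)).trans ?_
    have := Real.pi_pos
    apply mul_le_mul_of_nonneg_left _ hC.le
    apply Real.exp_le_exp.2
    nlinarith

lemma exp_int : IntegrableOn (fun t : ℝ => Real.exp (-(Real.pi/4) * t)) (Set.Ioi 0) := exp_neg_integrableOn_Ioi 0 (by positivity)

lemma gg_cont {τ z : ℂ} (h : 0 < τ.im) (hz : 0 < z.im) : ContinuousOn (fun t : ℝ => gg τ (z + I * (t:ℂ))) (Set.Ioi 0) := by
  intro t ht
  apply ContinuousAt.continuousWithinAt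
  have h1 : ContinuousAt (gg τ) (z + I * (t:ℂ)) := (gg_diff h (by rw [im_add_It]; have := Set.mem_Ioi.1 ht; linarith)).continuousAt
  exact ContinuousAt.comp (f := fun t : ℝ => z + I * (t:ℂ)) (g := gg τ) h1 (by fun_prop)

lemma gg_int {τ z : ℂ} (h : 0 < τ.im) (hz : 0 < z.im) : IntegrableOn (fun t : ℝ => gg τ (z + I * (t:ℂ)) * I) (Set.Ioi 0) := by
  obtain ⟨C, hC, hb⟩ := gg_bd h hz
  refine (exp_int.const_mul C).mono' ?_ ?_
  · exact ((gg_cont h hz).mul continuousOn_const).aestronglyMeasurable measurableSet_Ioi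
  · rw [ae_restrict_iff' measurableSet_Ioi]
    filter_upwards with t ht
    have ht' := Set.mem_Ioi.1 ht
    rw [norm_mul, norm_I, mul_one]
    refine (hb _ (by rw [im_add_It]; linarith)).trans ?_
    rw [im_add_It]
    apply mul_le_mul_of_nonneg_left _ hC.le
    apply Real.exp_le_exp.2
    have := Real.pi_pos
    nlinarith

lemma EE_deriv {τ z : ℂ} (h : 0 < τ.im) (hz : 0 < z.im) : HasDerivAt (EE τ) (-gg τ z) z := by
  obtain ⟨C, hC, hb⟩ := gg_deriv_bd h (δ := z.im / 2) (by positivity)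
  have hd : ∀ w : ℂ, 0 < w.im → HasDerivAt (gg τ) (deriv (gg τ) w) w := fun w hw => (gg_diff h hw).hasDerivAt
  have hcd : ContinuousOn (deriv (gg τ)) {w | 0 < w.im} := by
    have : DifferentiableOn ℂ (gg τ) {w | 0 < w.im} := fun w hw => (gg_diff h hw).differentiableWithinAt
    exact (this.deriv (isOpen_lt continuous_const continuous_im)).continuousOn
  have key := hasDerivAt_integral_of_dominated_loc_of_deriv_le (μ := volume.restrict (Set.Ioi (0:ℝ))) (F := fun (z:ℂ) (t:ℝ) => gg τ (z + I * (t:ℂ)) * I) (F' := fun (z:ℂ) (t:ℝ) => deriv (gg τ) (z + I * (t:ℂ)) * I) (x₀ := z) (s := {w | z.im / 2 < w.im}) (bound := fun t => C * Real.exp (-(Real.pi/4) * t)) ?_ ?_ (gg_int h hz) ?_ ?_ (exp_int.const_mul C) ?_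
  · have h2 := integral_Ioi_of_hasDerivAt_of_tendsto' (f := fun t : ℝ => gg τ (z + I * (t:ℂ))) (f' := fun t : ℝ => deriv (gg τ) (z + I * (t:ℂ)) * I) (a := 0) (m := 0) ?_ key.1 ?_
    · have h3 := key.2
      rw [h2] at h3
      have e : (0:ℂ) - gg τ (z + I * ((0:ℝ):ℂ)) = -gg τ z := by simp
      rw [e] at h3
      exact h3
    · intro t ht
      have ht' := Set.mem_Ici.1 ht
      have h4 := hd (z + I * (t:ℂ)) (by rw [im_add_It]; linarith)
      have h5 : HasDerivAt (fun t : ℝ => z + I * (t:ℂ)) I t := by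
        have := ((hasDerivAt_id t).ofReal_comp.const_mul I).const_add z
        simpa using this
      exact h4.comp t h5
    · obtain ⟨C', hC', hb'⟩ := gg_bd h hz
      apply squeeze_zero_norm' (a := fun t : ℝ => C' * Real.exp (-(Real.pi/4) * t))
      · filter_upwards [eventually_ge_atTop 0] with t ht
        refine (hb' _ (by rw [im_add_It]; linarith)).trans ?_
        rw [im_add_It]
        apply mul_le_mul_of_nonneg_left _ hC'.le
        apply Real.exp_le_exp.2
        have := Real.pi_pos
        nlinarith
      · rw [← mul_zero C']
        apply Tendsto.const_mul
        apply Real.tendsto_exp_atBot.comp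
        exact tendsto_id.const_mul_atTop_of_neg (by linarith [Real.pi_pos])
  · exact (isOpen_lt continuous_const continuous_im).mem_nhds (by simp only [Set.mem_ofPred_eq]; linarith)
  · filter_upwards [(isOpen_lt continuous_const continuous_im).mem_nhds (show z ∈ {w : ℂ | 0 < w.im} from hz)] with w hw
    exact (gg_int h hw).aestronglyMeasurable
  · apply ContinuousOn.aestronglyMeasurable _ measurableSet_Ioi
    apply ContinuousOn.mul _ continuousOn_const
    apply hcd.comp (by fun_prop)
    intro t ht
    have ht' := Set.mem_Ioi.1 ht
    simp only [Set.mem_ofPred_eq, im_add_It]; linarith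
  · rw [ae_restrict_iff' measurableSet_Ioi]
    filter_upwards with t ht w hw
    have ht' := Set.mem_Ioi.1 ht
    replace hw : z.im / 2 < w.im := hw
    rw [norm_mul, norm_I, mul_one]
    refine (hb _ (by rw [im_add_It]; linarith)).trans ?_
    rw [im_add_It]
    apply mul_le_mul_of_nonneg_left _ hC.le
    apply Real.exp_le_exp.2
    have := Real.pi_pos
    nlinarith
  · rw [ae_restrict_iff' measurableSet_Ioi]
    filter_upwards with t ht w hw
    have ht' := Set.mem_Ioi.1 ht
    replace hw : z.im / 2 < w.im := hw
    have h4 := hd (w + I * (t:ℂ)) (by rw [im_add_It]; linarith)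
    exact (h4.comp_add_const w (I * (t:ℂ))).mul_const I


lemma EE_zero {τ : ℂ} (h : 0 < τ.im) : Tendsto (fun n : ℕ => EE τ (I * ((n:ℝ)+1 : ℝ))) atTop (𝓝 0) := by
  obtain ⟨C, hC, hb⟩ := gg_bd h one_pos
  apply squeeze_zero_norm (a := fun n : ℕ => Real.exp (-(Real.pi/4) * n) * (C * ∫ t in Set.Ioi (0:ℝ), Real.exp (-(Real.pi/4) * t)))
  · intro n
    rw [← integral_const_mul, ← integral_const_mul]
    apply norm_integral_le_of_norm_le ((exp_int.const_mul C).const_mul _)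
    rw [ae_restrict_iff' measurableSet_Ioi]
    filter_upwards with t ht
    have ht' := Set.mem_Ioi.1 ht
    have him : (I * (((n:ℝ)+1 : ℝ):ℂ) + I * (t:ℂ)).im = n + 1 + t := by rw [im_add_It]; simp
    have hn : (0:ℝ) ≤ n := Nat.cast_nonneg n
    rw [norm_mul, norm_I, mul_one]
    refine (hb _ (by rw [him]; linarith)).trans ?_
    rw [him, mul_left_comm, ← Real.exp_add]
    apply mul_le_mul_of_nonneg_left _ hC.le
    apply Real.exp_le_exp.2
    have := Real.pi_pos
    nlinarith
  · generalize (C * ∫ t in Set.Ioi (0:ℝ), Real.exp (-(Real.pi/4) * t)) = D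
    rw [← zero_mul D]
    apply Tendsto.mul_const
    apply Real.tendsto_exp_atBot.comp
    exact (tendsto_natCast_atTop_atTop).const_mul_atTop_of_neg (by linarith [Real.pi_pos])

lemma gg_it_int {τ : ℂ} (h : 0 < τ.im) : IntegrableOn (fun t : ℝ => gg τ (I * (t:ℂ))) (Set.Ioi 0) := by
  refine int_eta_mul (fun t : ℝ => (-I * (I * t + τ)) ^ (-(1/2) : ℂ)) ?_ (τ.im ^ (-(1/2):ℝ)) ?_
  · intro t ht
    have ht' := Set.mem_Ioi.1 ht
    apply ContinuousAt.continuousWithinAt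
    apply ContinuousAt.cpow (by fun_prop) (by fun_prop)
    refine Or.inl ?_
    rw [re_add]; simp; linarith
  · intro t ht
    refine (norm_cpow_nhalf_le h (by rw [re_add]; simp; linarith)).trans ?_
    have : 0 < t ^ (-(1/2):ℝ) := Real.rpow_pos_of_pos ht _
    have h2 : 0 < τ.im ^ (-(1/2):ℝ) := Real.rpow_pos_of_pos h _
    nlinarith

lemma shift_Ioi (f : ℝ → ℂ) (ε : ℝ) : ∫ t in Set.Ioi (0:ℝ), f (ε + t) = ∫ t in Set.Ioi ε, f t := by
  rw [← integral_indicator measurableSet_Ioi, ← integral_indicator measurableSet_Ioi, ← integral_add_left_eq_self ((Set.Ioi ε).indicator f) ε]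
  congr 1; funext t
  simp [Set.indicator]

lemma EE_it {τ : ℂ} (ε : ℝ) : EE τ (I * (ε:ℂ)) = (∫ t in Set.Ioi ε, gg τ (I * (t:ℂ))) * I := by
  rw [EE, integral_mul_const, ← shift_Ioi (fun t => gg τ (I * (t:ℂ)))]
  congr 2; funext t
  congr 1; push_cast; ring

lemma EE_KK {τ : ℂ} (h : 0 < τ.im) : Tendsto (fun n : ℕ => EE τ (I * (((n:ℝ)+1 : ℝ)⁻¹ : ℝ))) atTop (𝓝 (KK τ * I)) := by
  have hU : (⋃ n : ℕ, Set.Ioi (((n:ℝ)+1)⁻¹)) = Set.Ioi (0:ℝ) := by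
    ext x
    simp only [Set.mem_iUnion, Set.mem_Ioi]
    constructor
    · rintro ⟨n, hn⟩
      have : (0:ℝ) < ((n:ℝ)+1)⁻¹ := by positivity
      linarith
    · intro hx
      obtain ⟨n, hn⟩ := exists_nat_one_div_lt hx
      exact ⟨n, by simpa using hn⟩
  have := tendsto_setIntegral_of_monotone (μ := volume) (f := fun t : ℝ => gg τ (I * (t:ℂ))) (s := fun n : ℕ => Set.Ioi (((n:ℝ)+1)⁻¹)) (fun _ => measurableSet_Ioi) ?_ ?_
  · rw [hU] at this
    simp_rw [EE_it]
    exact this.mul_const I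
  · intro m n hmn
    apply Set.Ioi_subset_Ioi
    have : (m:ℝ) ≤ n := by exact_mod_cast hmn
    apply inv_anti₀ (by positivity)
    linarith
  · rw [hU]; exact gg_it_int h

lemma preconn_H : IsPreconnected {w : ℂ | 0 < w.im} := (convex_halfSpace_im_gt 0).isPreconnected

lemma isOpen_H : IsOpen {w : ℂ | 0 < w.im} := isOpen_lt continuous_const continuous_im

lemma EE_S {τ z : ℂ} (h : 0 < τ.im) (hz : 0 < z.im) : EE (-1/τ) (-1/z) + sqI τ * EE τ z = sqI τ * (KK τ * I) := by
  have hS := im_S h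
  have hd : ∀ w : ℂ, 0 < w.im → HasDerivAt (fun w => EE (-1/τ) (-1/w) + sqI τ * EE τ w) 0 w := by
    intro w hw
    have h0 := tau_ne hw
    have h1 : HasDerivAt (fun w : ℂ => -1/w) (1/w^2) w := by
      have := (hasDerivAt_inv h0).const_mul (-1:ℂ)
      have e : (fun w : ℂ => -1/w) = fun y => -1 * y⁻¹ := by funext y; ring
      rw [e]
      exact this.congr_deriv (by ring)
    have h2 := (EE_deriv hS (im_S hw)).comp w h1
    have h3 := h2.add ((EE_deriv h hw).const_mul (sqI τ))
    refine h3.congr_deriv ?_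
    rw [gg_S h hw]
    field_simp
    ring
  have hc : ∀ w : ℂ, 0 < w.im → EE (-1/τ) (-1/w) + sqI τ * EE τ w = EE (-1/τ) (-1/z) + sqI τ * EE τ z := by
    intro w hw
    exact IsOpen.is_const_of_deriv_eq_zero (f := fun w => EE (-1/τ) (-1/w) + sqI τ * EE τ w) isOpen_H preconn_H (fun w hw => (hd w hw).differentiableAt.differentiableWithinAt) (fun w hw => (hd w hw).deriv) hw hz
  have hl : Tendsto (fun n : ℕ => EE (-1/τ) (I * ((n:ℝ)+1 : ℝ)) + sqI τ * EE τ (I * (((n:ℝ)+1 : ℝ)⁻¹ : ℝ))) atTop (𝓝 (0 + sqI τ * (KK τ * I))) :=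
    (EE_zero hS).add ((EE_KK h).const_mul _)
  rw [zero_add] at hl
  refine tendsto_nhds_unique ?_ hl
  refine tendsto_const_nhds.congr ?_
  intro n
  have hn : (0:ℝ) < ((n:ℝ)+1)⁻¹ := by positivity
  rw [← hc (I * (((n:ℝ)+1 : ℝ)⁻¹ : ℝ)) (by rw [mul_comm, im_ofReal_mul, I_im, mul_one]; exact hn)]
  congr 2
  have : ((n:ℂ)+1) ≠ 0 := by exact_mod_cast Nat.succ_ne_zero n
  push_cast
  field_simp
  simp

lemma eichler_S {τ : ℂ} (h : 0 < τ.im) : eichler (-1/τ) + sqI τ * eichler τ = sqI τ * (KK τ * I) := by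
  rw [← EE_S h (z := -(starRingEnd ℂ) τ) (by simpa using h), eichler_eq, eichler_eq]
  congr 2
  simp
  ring

lemma eichler_T {τ : ℂ} (h : 0 < τ.im) : eichler (τ+1) = exp (-(Real.pi:ℂ) * I / 4) * eichler τ := by
  rw [eichler_eq, eichler_eq, EE, EE, ← integral_const_mul]
  apply setIntegral_congr_fun measurableSet_Ioi
  intro t ht
  have ht' := Set.mem_Ioi.1 ht
  simp only [gg]
  have e1 : -(starRingEnd ℂ) (τ + 1) + I * (t:ℂ) + (τ + 1) = -(starRingEnd ℂ) τ + I * (t:ℂ) + τ := by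
    simp; ring
  have e2 : -(starRingEnd ℂ) τ + I * (t:ℂ) = (-(starRingEnd ℂ) (τ+1) + I * (t:ℂ)) + 1 := by simp; ring
  rw [e1, e2, eta_T, mul_pow, ← Complex.exp_nat_mul]
  have e3 : exp (-(Real.pi:ℂ) * I / 4) * exp ((3:ℕ) * (Real.pi * I / 12)) = 1 := by
    rw [← Complex.exp_add, ← Complex.exp_zero]; congr 1; push_cast; ring
  have e4 : -(starRingEnd ℂ) (τ + 1) + I * (t:ℂ) + 1 + τ = -(starRingEnd ℂ) τ + I * (t:ℂ) + τ := by simp; ring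
  rw [e4]
  linear_combination (-etaDedekind (-(starRingEnd ℂ) (τ + 1) + I * (t:ℂ)) ^ 3 * (-I * (-(starRingEnd ℂ) τ + I * (t:ℂ) + τ)) ^ (-(1/2) : ℂ) * I) * e3

lemma KK_diff {τ : ℂ} (h : 0 < τ.im) : DifferentiableAt ℂ KK τ := by
  have hd : ∀ t : ℝ, 0 < t → ∀ z : ℂ, 0 < z.im → HasDerivAt (fun z => gg z (I * (t:ℂ))) (etaDedekind (I * t)^3 * ((-(1/2)) * (-I * (I * t + z)) ^ (-(3/2):ℂ) * (-I))) z := by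
    intro t ht z hz
    have h1 : HasDerivAt (fun z => -I * (I * (t:ℂ) + z)) (-I) z := by
      simpa using ((hasDerivAt_id z).const_add (I * (t:ℂ))).const_mul (-I)
    have h2 := h1.cpow_const (c := -(1/2)) (Or.inl (by rw [re_add]; simp; linarith))
    unfold gg
    refine (h2.const_mul _).congr_deriv ?_
    congr 3
    norm_num
  have hbd : ∀ t : ℝ, 0 < t → ∀ z : ℂ, τ.im / 2 < z.im → ‖((-(1/2)) * (-I * (I * t + z)) ^ (-(3/2):ℂ) * (-I))‖ ≤ 1/2 * (τ.im/2) ^ (-(3/2):ℝ) := by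
    intro t ht z hz
    rw [norm_mul, norm_mul, norm_neg, norm_neg, norm_I, mul_one]
    have h3 := Complex.norm_cpow_real (-I * (I * t + z)) (-(3/2))
    push_cast at h3
    rw [h3]
    have h4 : τ.im/2 ≤ ‖-I * (I * t + z)‖ := by
      refine le_trans ?_ (re_le_norm _)
      rw [re_add]; simp; linarith
    have h5 := Real.rpow_le_rpow_of_nonpos (by positivity) h4 (z := -(3/2)) (by norm_num)
    norm_num at h5 ⊢
    linarith
  have hcont : ∀ z : ℂ, 0 < z.im → ContinuousOn (fun t : ℝ => ((-(1/2)) * (-I * (I * (t:ℂ) + z)) ^ (-(3/2):ℂ) * (-I))) (Set.Ioi 0) := by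
    intro z hz t ht
    have ht' := Set.mem_Ioi.1 ht
    apply ContinuousAt.continuousWithinAt
    apply ContinuousAt.mul _ continuousAt_const
    apply ContinuousAt.mul continuousAt_const
    apply ContinuousAt.cpow (by fun_prop) (by fun_prop)
    exact Or.inl (by rw [re_add]; simp; linarith)
  have hI := (int_eta_mul (fun _ => ((1/2 * (τ.im/2) ^ (-(3/2):ℝ) : ℝ) : ℂ)) continuousOn_const (1/2 * (τ.im/2) ^ (-(3/2):ℝ)) (by
    intro t ht
    have h2 : 0 < 1/2 * (τ.im/2) ^ (-(3/2):ℝ) := by positivity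
    rw [norm_real, Real.norm_of_nonneg h2.le]
    have : 0 < t ^ (-(1/2):ℝ) := Real.rpow_pos_of_pos ht _
    nlinarith)).norm
  have key := hasDerivAt_integral_of_dominated_loc_of_deriv_le (μ := volume.restrict (Set.Ioi (0:ℝ))) (F := fun (z:ℂ) (t:ℝ) => gg z (I * (t:ℂ))) (F' := fun (z:ℂ) (t:ℝ) => etaDedekind (I * t)^3 * ((-(1/2)) * (-I * (I * t + z)) ^ (-(3/2):ℂ) * (-I))) (x₀ := τ) (s := {w | τ.im / 2 < w.im}) ?_ ?_ (gg_it_int h) ?_ ?_ hI ?_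
  · exact key.2.differentiableAt
  · exact (isOpen_lt continuous_const continuous_im).mem_nhds (by simp only [Set.mem_ofPred_eq]; linarith)
  · filter_upwards [isOpen_H.mem_nhds (show τ ∈ {w : ℂ | 0 < w.im} from h)] with w hw
    exact (gg_it_int hw).aestronglyMeasurable
  · apply ContinuousOn.aestronglyMeasurable _ measurableSet_Ioi
    exact cont_eta_it.mul (hcont τ h)
  · rw [ae_restrict_iff' measurableSet_Ioi]
    filter_upwards with t ht w hw
    rw [norm_mul, norm_mul _ (ofReal _)]
    apply mul_le_mul_of_nonneg_left _ (norm_nonneg _)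
    refine (hbd t ht w hw).trans ?_
    rw [norm_real]
    exact le_abs_self _
  · rw [ae_restrict_iff' measurableSet_Ioi]
    filter_upwards with t ht w hw
    replace hw : τ.im / 2 < w.im := hw
    exact hd t ht w (by linarith)

lemma KK_it {y : ℝ} (hy : 0 < y) : KK (I * y) = ∫ x, JJ y 0 x := by
  have h := gauss_sech (y:ℂ) (by simpa using hy.le) 0
  have e1 : ∫ x, JJ y 0 x = ∫ x : ℝ, exp (-(Real.pi * (y:ℂ) * x ^ 2) + 2 * Real.pi * I * ((0:ℝ):ℂ) * x) / cosh (Real.pi * x) := by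
    congr 1; funext x; simp [JJ]
  rw [e1, h, KK]
  apply setIntegral_congr_fun measurableSet_Ioi
  intro t ht
  have ht' := Set.mem_Ioi.1 ht
  simp only [gg]
  congr 1
  have e2 : -I * (I * (t:ℂ) + I * y) = ((t + y : ℝ) : ℂ) := by
    push_cast
    linear_combination -(t + y : ℂ) * I_mul_I
  have hp : 0 < t + y := by linarith
  have e3 : (1 / ((t:ℂ) + y)) = (((t+y)⁻¹ : ℝ) : ℂ) := by push_cast; simp
  rw [e2, e3]
  simp only [ofReal_zero, ne_eq, OfNat.ofNat_ne_zero, not_false_eq_true, zero_pow, mul_zero, zero_div, neg_zero, Complex.exp_zero, mul_one]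
  rw [cpow_neg]
  have := csq_mul (a := ((t+y : ℝ):ℂ)) (b := (((t+y)⁻¹ : ℝ) : ℂ)) (by rw [ofReal_re]; exact hp) (by rw [ofReal_re]; positivity)
  rw [← ofReal_mul, mul_inv_cancel₀ hp.ne', ofReal_one, one_cpow] at this
  rw [inv_eq_of_mul_eq_one_right this.symm]

end

section
open Filter Topology

def tS (n : ℤ) (τ : ℂ) : ℂ := qp τ ((n : ℂ) ^ 2 / 2 - 1 / 8) / (1 + qp τ ((n : ℂ) - 1 / 2))

lemma half_le_abs (n : ℤ) : (1/2 : ℝ) ≤ |(n:ℝ) - 1/2| := by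
  rcases le_or_gt 1 n with h | h
  · have : (1:ℝ) ≤ n := by exact_mod_cast h
    rw [abs_of_nonneg (by linarith)]; linarith
  · have h' : n ≤ 0 := by omega
    have : (n:ℝ) ≤ 0 := by exact_mod_cast h'
    rw [abs_of_nonpos (by linarith)]; linarith

lemma norm_cos_ge {τ : ℂ} (h : 0 < τ.im) (n : ℤ) :
    Real.exp (Real.pi * (τ.im * |(n:ℝ) - 1/2|)) * (1 - Real.exp (-Real.pi * τ.im)) ≤ ‖2 * cos (Real.pi * τ * ((n:ℂ) - 1/2))‖ := by
  rw [Complex.two_cos]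
  set b : ℝ := Real.pi * (τ.im * ((n:ℝ) - 1/2)) with hb
  have h1 : ‖exp (Real.pi * τ * ((n:ℂ) - 1/2) * I)‖ = Real.exp (-b) := by
    rw [Complex.norm_exp]; congr 1
    rw [show Real.pi * τ * ((n:ℂ) - 1/2) = ((Real.pi * ((n:ℝ) - 1/2) : ℝ) : ℂ) * τ by push_cast; ring, mul_assoc, re_ofReal_mul, hb]
    simp; ring
  have h2 : ‖exp (-(Real.pi * τ * ((n:ℂ) - 1/2)) * I)‖ = Real.exp b := by
    rw [Complex.norm_exp]; congr 1
    rw [show -(Real.pi * τ * ((n:ℂ) - 1/2)) = ((-(Real.pi * ((n:ℝ) - 1/2)) : ℝ) : ℂ) * τ by push_cast; ring, mul_assoc, re_ofReal_mul, hb]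
    simp; ring
  have h3 := abs_norm_sub_norm_le (exp (Real.pi * τ * ((n:ℂ) - 1/2) * I)) (-exp (-(Real.pi * τ * ((n:ℂ) - 1/2)) * I))
  rw [sub_neg_eq_add, norm_neg, h1, h2] at h3
  refine le_trans ?_ h3
  have h4 : Real.pi * (τ.im * |(n:ℝ) - 1/2|) = |b| := by
    rw [hb, abs_mul, abs_mul, abs_of_pos Real.pi_pos, abs_of_pos h]
  have h5 : Real.pi * τ.im ≤ 2 * |b| := by
    rw [← h4]
    have := half_le_abs n
    have hp : 0 < Real.pi * τ.im := by have := Real.pi_pos; positivity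
    nlinarith
  rw [h4]
  have h6 : Real.exp |b| - Real.exp (-|b|) ≤ |Real.exp (-b) - Real.exp b| := by
    rcases abs_cases b with ⟨h, _⟩ | ⟨h, _⟩
    · rw [h, abs_sub_comm]; exact le_abs_self _
    · rw [h, neg_neg]; exact le_abs_self _
  refine le_trans ?_ h6
  rw [mul_sub, mul_one, ← Real.exp_add]
  have : Real.exp (-|b|) ≤ Real.exp (|b| + -Real.pi * τ.im) := Real.exp_le_exp.2 (by linarith)
  linarith

lemma exp_lt_one' {y : ℝ} (hy : 0 < y) : 0 < 1 - Real.exp (-Real.pi * y) := by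
  have : Real.exp (-Real.pi * y) < 1 := by
    rw [Real.exp_lt_one_iff]
    have := Real.pi_pos
    nlinarith
  linarith

lemma tS_bd {τ : ℂ} (h : 0 < τ.im) (n : ℤ) : ‖tS n τ‖ ≤ (1 - Real.exp (-Real.pi * τ.im))⁻¹ * Real.exp (-Real.pi * (τ.im * (((n:ℝ) - 1/2)^2 + |(n:ℝ) - 1/2|))) := by
  rw [tS, S3_term, norm_div]
  have h1 := norm_cos_ge h n
  have h2 := exp_lt_one' h
  have h3 : ‖exp (Real.pi * I * τ * ((n:ℂ) - 1/2)^2)‖ = Real.exp (-Real.pi * τ.im * ((n:ℝ) - 1/2)^2) := by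
    have := norm_exp_pi τ (((n:ℝ) - 1/2)^2)
    push_cast at this; exact this
  rw [h3]
  calc _ ≤ Real.exp (-Real.pi * τ.im * ((n:ℝ) - 1/2)^2) / (Real.exp (Real.pi * (τ.im * |(n:ℝ) - 1/2|)) * (1 - Real.exp (-Real.pi * τ.im))) := by
        apply div_le_div_of_nonneg_left (Real.exp_pos _).le (by positivity) h1
    _ = _ := by
      rw [show -Real.pi * (τ.im * (((n:ℝ) - 1/2)^2 + |(n:ℝ) - 1/2|)) = -Real.pi * τ.im * ((n:ℝ) - 1/2)^2 - Real.pi * (τ.im * |(n:ℝ) - 1/2|) by ring, Real.exp_sub]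
      field_simp

lemma tS_bd_summable {y : ℝ} (hy : 0 < y) : Summable fun n : ℤ => (1 - Real.exp (-Real.pi * y))⁻¹ * Real.exp (-Real.pi * (y * (((n:ℝ) - 1/2)^2 + |(n:ℝ) - 1/2|))) := by
  apply Summable.mul_left
  have := summable_poly_gauss (T := y) 0 (S := y/2) hy (c := fun _ => 1) (C := 1) (e := fun n => y * (((n:ℝ) - 1/2)^2 + |(n:ℝ) - 1/2|)) ?_ ?_
  · simpa using this
  · intro n; simp
  · intro n
    have h1 := le_abs_self (n:ℝ)
    have h2 := sq_abs (n:ℝ)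
    have h3 := abs_nonneg ((n:ℝ) - 1/2)
    have : (n:ℝ)^2 - |(n:ℝ)| ≤ ((n:ℝ) - 1/2)^2 + |(n:ℝ) - 1/2| := by nlinarith
    have := mul_le_mul_of_nonneg_left this hy.le
    linarith

lemma tS_den {τ : ℂ} (h : 0 < τ.im) (n : ℤ) : 1 + qp τ ((n : ℂ) - 1 / 2) ≠ 0 := by
  have h1 := norm_cos_ge h n
  have h2 := exp_lt_one' h
  have h3 : 0 < ‖2 * cos (Real.pi * τ * ((n:ℂ) - 1/2))‖ := lt_of_lt_of_le (by positivity) h1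
  have h1 : 1 + qp τ ((n : ℂ) - 1 / 2) = exp (Real.pi * I * τ * ((n:ℂ) - 1/2)) * (2 * cos (Real.pi * τ * ((n:ℂ) - 1/2))) := by
    rw [Complex.two_cos, mul_add, ← Complex.exp_add, ← Complex.exp_add, qp]
    rw [add_comm]
    congr 1
    · congr 1; ring
    · rw [← Complex.exp_zero]; congr 1; ring
  rw [h1]
  exact mul_ne_zero (Complex.exp_ne_zero _) (norm_pos_iff.1 h3)

lemma tS_diff {τ : ℂ} (h : 0 < τ.im) (n : ℤ) : DifferentiableAt ℂ (tS n) τ := by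
  unfold tS
  have h1 := tS_den h n
  unfold qp at h1 ⊢
  exact DifferentiableAt.div (by fun_prop) (by fun_prop) h1

lemma S3_diff {τ : ℂ} (h : 0 < τ.im) : DifferentiableAt ℂ S3 τ := by
  have ho : IsOpen {w : ℂ | τ.im / 2 < w.im} := isOpen_lt continuous_const continuous_im
  have hp := Real.pi_pos
  have := differentiableOn_tsum_of_summable_norm (U := {w : ℂ | τ.im / 2 < w.im}) (F := tS) (tS_bd_summable (y := τ.im/2) (by positivity)) ?_ ho ?_
  · exact (this τ (by simp only [Set.mem_ofPred_eq]; linarith)).differentiableAt (ho.mem_nhds (by simp only [Set.mem_ofPred_eq]; linarith))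
  · intro n w hw
    replace hw : τ.im / 2 < w.im := hw
    exact (tS_diff (by linarith) n).differentiableWithinAt
  · intro n w hw
    replace hw : τ.im / 2 < w.im := hw
    have hw0 : 0 < w.im := by linarith
    refine (tS_bd hw0 n).trans ?_
    have h0 := exp_lt_one' (show 0 < τ.im / 2 by linarith)
    apply mul_le_mul
    · apply inv_anti₀ h0
      have : Real.exp (-Real.pi * w.im) ≤ Real.exp (-Real.pi * (τ.im/2)) := Real.exp_le_exp.2 (by nlinarith)
      linarith
    · apply Real.exp_le_exp.2
      have h3 : 0 ≤ ((n:ℝ) - 1/2)^2 + |(n:ℝ) - 1/2| := by positivity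
      have := mul_le_mul_of_nonneg_right hw.le h3
      nlinarith
    · positivity
    · exact (inv_pos.2 h0).le

lemma diff_S_comp {f : ℂ → ℂ} (hf : ∀ z : ℂ, 0 < z.im → DifferentiableAt ℂ f z) {τ : ℂ} (h : 0 < τ.im) : DifferentiableAt ℂ (fun z => f (-1/z)) τ := by
  have h1 : DifferentiableAt ℂ (fun z : ℂ => -1/z) τ := (differentiableAt_const _).div differentiableAt_id (tau_ne h)
  exact DifferentiableAt.comp τ (hf _ (im_S h)) h1

lemma eq_zero_of_it {f : ℂ → ℂ} (hf : ∀ z : ℂ, 0 < z.im → DifferentiableAt ℂ f z) (h0 : ∀ y : ℝ, 0 < y → f (I * y) = 0) : ∀ z : ℂ, 0 < z.im → f z = 0 := by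
  have ha : AnalyticOnNhd ℂ f {w | 0 < w.im} := by
    apply DifferentiableOn.analyticOnNhd _ isOpen_H
    intro z hz
    exact (hf z hz).differentiableWithinAt
  intro z hz
  refine ha.eqOn_zero_of_preconnected_of_frequently_eq_zero preconn_H (z₀ := I) (by simp) ?_ hz
  have ht : Tendsto (fun n : ℕ => I * ((1 + 1/((n:ℝ)+1) : ℝ):ℂ)) atTop (𝓝[≠] I) := by
    apply tendsto_nhdsWithin_of_tendsto_nhds_of_eventually_within
    · have h1 : Tendsto (fun n : ℕ => (1 + 1/((n:ℝ)+1) : ℝ)) atTop (𝓝 (1 + 0)) := tendsto_const_nhds.add tendsto_one_div_add_atTop_nhds_zero_nat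
      have hc : Continuous (fun x:ℝ => I*(x:ℂ)) := by fun_prop
      have h2 := (hc.tendsto ((1:ℝ)+0)).comp h1
      simpa [Function.comp_def] using h2
    · filter_upwards with n
      intro hn
      have := congrArg Complex.im hn
      rw [mul_comm, im_ofReal_mul] at this
      simp at this
      have h3 : (0:ℝ) < (n:ℝ) + 1 := by positivity
      linarith
  apply ht.frequently
  apply Filter.Frequently.of_forall
  intro n
  exact h0 _ (by positivity)

lemma mordell {τ : ℂ} (h : 0 < τ.im) : 2 * sqI τ * S3 τ - theta3 (-1/τ) * KK τ + 2 * (sqI τ)⁻¹ * S3 (-1/τ) = 0 := by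
  refine eq_zero_of_it (f := fun τ => 2 * sqI τ * S3 τ - theta3 (-1/τ) * KK τ + 2 * (sqI τ)⁻¹ * S3 (-1/τ)) ?_ ?_ τ h
  · intro z hz
    have d1 := diff_sq hz
    have d2 := S3_diff hz
    have d3 := diff_S_comp (f := theta3) (fun z hz => diff_theta3 hz) hz
    have d4 := KK_diff hz
    have d5 := diff_S_comp (f := S3) (fun z hz => S3_diff hz) hz
    have d6 := d1.inv (sqI_ne hz)
    exact ((((differentiableAt_const 2).mul d1).mul d2).sub (d3.mul d4)).add (((differentiableAt_const 2).mul d6).mul d5)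
  · intro y hy
    have h1 := mordell_it hy
    have e : -1 / (I * (y:ℂ)) = I * ((y⁻¹:ℝ):ℂ) := by
      have : (y:ℂ) ≠ 0 := by exact_mod_cast hy.ne'
      push_cast
      field_simp
      simp
    simp only [e]
    rw [h1, KK_it hy]
    ring

lemma A3_S {τ : ℂ} (h : 0 < τ.im) : S3 (-1/τ) / theta3 (-1/τ) = 1/2 * sqI τ * KK τ - sqI τ * (S3 τ / theta3 τ) := by
  have h1 := mordell h
  have h2 := theta3_S h
  have h3 := theta3_ne h
  have h4 := sqI_ne h
  rw [h2] at h1 ⊢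
  generalize S3 (-1/τ) = X at h1 ⊢
  field_simp at h1 ⊢
  linear_combination h1

lemma H0_eq (τ : ℂ) : H0 τ = 2 * (theta2 τ ^ 4 - theta4 τ ^ 4) / etaDedekind τ ^ 3 - 24 * (S3 τ / theta3 τ) := by
  change 2 * (theta2 τ ^ 4 - theta4 τ ^ 4) / etaDedekind τ ^ 3 - (24 / theta3 τ) * S3 τ = _
  ring

lemma Hhat_S {τ : ℂ} (h : 0 < τ.im) : Hhat (-1/τ) = - sqI τ * Hhat τ := by
  have h1 := A3_S h
  have h2 := eichler_S h
  have h3 := eta_ne h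
  have h4 := sqI_ne h
  rw [Hhat, Hhat, H0_eq, H0_eq, theta2_S h, theta4_S h, eta_S h, h1, eq_sub_of_add_eq h2]
  field_simp
  linear_combination (-24 * KK τ * etaDedekind τ ^ 3) * I_sq

end

section
open Filter Topology

def Phi (τ : ℂ) : ℂ := etaDedekind τ ^ 3 * Hhat τ

lemma eta3_T (τ : ℂ) : etaDedekind (τ+1) ^ 3 = exp (Real.pi * I / 4) * etaDedekind τ ^ 3 := by
  rw [eta_T, mul_pow, ← Complex.exp_nat_mul]
  congr 2; push_cast; ring

lemma Phi_S {τ : ℂ} (h : 0 < τ.im) : Phi (-1/τ) = τ^2 * Phi τ := by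
  rw [Phi, Phi, eta_S h, Hhat_S h]
  have h1 := sqI_sq h
  have h2 : sqI τ ^ 4 = - τ^2 := by
    rw [show sqI τ ^ 4 = (sqI τ ^ 2)^2 by ring, h1]
    linear_combination (τ^2) * I_sq
  linear_combination (-etaDedekind τ ^ 3 * Hhat τ) * h2

lemma qp_shift (τ s a : ℂ) : qp (τ + a) s = exp (2 * Real.pi * I * (a * s)) * qp τ s := by
  rw [qp, qp, ← Complex.exp_add]; congr 1; ring

lemma S3_T2 (τ : ℂ) : S3 (τ+2) = exp (-(Real.pi * I / 2)) * S3 τ := by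
  change ∑' n : ℤ, tS n (τ+2) = _ * ∑' n : ℤ, tS n τ
  rw [← tsum_mul_left]
  congr 1; ext n
  rw [tS, tS, qp_shift, qp_shift]
  have e1 : exp (2 * Real.pi * I * (2 * ((n:ℂ)^2/2 - 1/8))) = exp (-(Real.pi * I / 2)) := by
    have := exp_two_pi_int (n^2) (-(Real.pi * I / 2))
    rw [← this]; congr 1; push_cast; ring
  have e2 : exp (2 * Real.pi * I * (2 * ((n:ℂ) - 1/2))) = 1 := by
    have := exp_two_pi_int (2*n-1) 0
    rw [Complex.exp_zero] at this
    refine Eq.trans ?_ this; congr 1; push_cast; ring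
  rw [e1, e2, one_mul, mul_div_assoc]

def AA (τ : ℂ) : ℂ := 4 * theta2 τ ^ 4 + 2 * (theta3 τ ^ 4 - theta4 τ ^ 4)
  - 12 * theta2 τ * (theta4 τ * S3 τ - exp (Real.pi * I / 4) * theta3 τ * S3 (τ+1))

lemma im_T {τ : ℂ} (h : 0 < τ.im) : 0 < (τ+1).im := by simpa using h

lemma exp_pi4_4 : exp (Real.pi * I / 4) ^ 4 = -1 := by
  rw [← Complex.exp_nat_mul, ← Complex.exp_pi_mul_I]; congr 1; push_cast; ring

lemma exp_neg_pi4 : exp (-(Real.pi:ℂ) * I / 4) = (exp (Real.pi * I / 4))⁻¹ := by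
  rw [← Complex.exp_neg]; congr 1; ring

lemma Phi_eq {τ : ℂ} (h : 0 < τ.im) : Phi τ = 2 * (theta2 τ ^ 4 - theta4 τ ^ 4) - 12 * theta2 τ * theta4 τ * S3 τ - 12 * I * (etaDedekind τ ^ 3 * eichler τ) := by
  have h1 := eta_ne h
  have h2 := theta3_ne h
  have h3 := theta_prod h
  rw [Phi, Hhat, H0_eq]
  field_simp
  linear_combination (12 * S3 τ) * h3

lemma Phi_sub {τ : ℂ} (h : 0 < τ.im) : Phi τ - Phi (τ+1) = AA τ := by
  rw [Phi_eq h, Phi_eq (im_T h), theta2_T, theta4_T, eta3_T, eichler_T h, exp_neg_pi4, AA]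
  have h1 := exp_pi4_4
  have h0 : exp (Real.pi * I / 4) ≠ 0 := Complex.exp_ne_zero _
  generalize exp (Real.pi * I / 4) = x at *
  field_simp
  linear_combination (-2 * theta2 τ^4) * h1

lemma AA_T {τ : ℂ} : AA (τ+1) = - AA τ := by
  rw [AA, AA, theta2_T, theta3_T, theta4_T, show τ + 1 + 1 = τ + 2 by ring, S3_T2]
  have h1 := exp_pi4_4
  have h2 : exp (-(Real.pi * I / 2)) = - exp (Real.pi * I / 4) ^ 2 := by
    rw [← Complex.exp_nat_mul, ← neg_one_mul (exp _), ← Complex.exp_pi_mul_I, ← Complex.exp_add]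
    rw [← exp_two_pi_int (-1) (_ + _)]; congr 1; push_cast; ring
  rw [h2]
  generalize exp (Real.pi * I / 4) = x at *
  linear_combination (4 * theta2 τ^4 - 12 * theta2 τ * theta4 τ * S3 τ) * h1

lemma Phi_T2 {τ : ℂ} (h : 0 < τ.im) : Phi (τ+2) = Phi τ := by
  have h1 := Phi_sub h
  have h2 := Phi_sub (im_T h)
  rw [AA_T, show τ + 1 + 1 = τ + 2 by ring] at h2
  linear_combination -h1 - h2

def GG2 (τ : ℂ) : ℂ := (τ^2)⁻¹ * Phi (-1/τ + 1)

lemma GG2_T {τ : ℂ} (h : 0 < τ.im) : GG2 (τ+1) = GG2 τ := by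
  have h0 := tau_ne h
  have h0' := tau_ne (im_T h)
  rw [GG2, GG2]
  have hw : 0 < (-1/(τ+1) + 1).im := im_T (im_S (im_T h))
  have e := Phi_S hw
  have e2 := Phi_T2 (im_S hw)
  have e3 : -1/(-1/(τ+1)+1) + 2 = -1/τ + 1 := by
    have : -1/(τ+1)+1 = τ/(τ+1) := by field_simp; ring
    rw [this]; field_simp; ring
  rw [← e2, e3] at e
  rw [e]
  field_simp
  ring_nf

def BB (τ : ℂ) : ℂ := (τ^2)⁻¹ * AA (-1/τ)

lemma BB_eq {τ : ℂ} (h : 0 < τ.im) : BB τ = Phi τ - GG2 τ := by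
  have h0 := tau_ne h
  rw [BB, ← Phi_sub (im_S h), Phi_S h, GG2]
  field_simp

def CC (τ : ℂ) : ℂ := BB τ - AA τ

lemma CC_eq {τ : ℂ} (h : 0 < τ.im) : CC τ = Phi (τ+1) - GG2 τ := by
  rw [CC, BB_eq h, ← Phi_sub h]; ring

lemma BB_T {τ : ℂ} (h : 0 < τ.im) : BB (τ+1) = CC τ := by
  rw [BB_eq (im_T h), CC_eq h, GG2_T h]

lemma CC_T {τ : ℂ} (h : 0 < τ.im) : CC (τ+1) = BB τ := by
  rw [CC_eq (im_T h), BB_eq h, GG2_T h, show τ + 1 + 1 = τ + 2 by ring, Phi_T2 h]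

lemma AA_S {τ : ℂ} (h : 0 < τ.im) : AA (-1/τ) = τ^2 * BB τ := by
  have h0 := tau_ne h
  rw [BB]; field_simp

lemma BB_S {τ : ℂ} (h : 0 < τ.im) : BB (-1/τ) = τ^2 * AA τ := by
  have h0 := tau_ne h
  rw [BB, S_S h]; field_simp

lemma CC_S {τ : ℂ} (h : 0 < τ.im) : CC (-1/τ) = - τ^2 * CC τ := by
  rw [CC, CC, AA_S h, BB_S h]; ring

def DD (τ : ℂ) : ℂ := (AA τ * BB τ * CC τ)^2 / etaDedekind τ ^ 24

lemma DD_T {τ : ℂ} (h : 0 < τ.im) : DD (τ+1) = DD τ := by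
  rw [DD, DD, AA_T, BB_T h, CC_T h, show etaDedekind (τ+1) ^ 24 = (etaDedekind (τ+1) ^ 3)^8 by ring, eta3_T]
  have h1 := exp_pi4_4
  rw [mul_pow (exp _), show exp (Real.pi * I / 4)^8 = (exp (Real.pi * I / 4)^4)^2 by ring, h1]
  ring

lemma DD_S {τ : ℂ} (h : 0 < τ.im) : DD (-1/τ) = DD τ := by
  have h0 := tau_ne h
  have h1 := eta_ne h
  have h2 : sqI τ ^ 24 = τ^12 := by
    rw [show sqI τ ^ 24 = (sqI τ ^ 2)^12 by ring, sqI_sq h, neg_mul, neg_pow, mul_pow]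
    rw [show I ^ 12 = (I ^ 2)^6 by ring, I_sq]; ring
  rw [DD, DD, AA_S h, BB_S h, CC_S h, eta_S h, mul_pow (sqI τ), h2]
  field_simp

lemma AA_diff {τ : ℂ} (h : 0 < τ.im) : DifferentiableAt ℂ AA τ := by
  have d2 := diff_theta2 h
  have d3 := diff_theta3 h
  have d4 := diff_theta4 h
  have d5 := S3_diff h
  have d6 : DifferentiableAt ℂ (fun z => S3 (z+1)) τ := DifferentiableAt.comp (g := S3) (f := fun z => z + 1) τ (S3_diff (im_T h)) (by fun_prop)
  unfold AA
  fun_prop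

lemma BB_diff {τ : ℂ} (h : 0 < τ.im) : DifferentiableAt ℂ BB τ := by
  have d := diff_S_comp (f := AA) (fun z hz => AA_diff hz) h
  have h0 : τ^2 ≠ 0 := pow_ne_zero _ (tau_ne h)
  unfold BB
  exact DifferentiableAt.mul (DifferentiableAt.inv (by fun_prop) h0) d

lemma CC_diff {τ : ℂ} (h : 0 < τ.im) : DifferentiableAt ℂ CC τ := (BB_diff h).sub (AA_diff h)

lemma DD_diff {τ : ℂ} (h : 0 < τ.im) : DifferentiableAt ℂ DD τ := by
  unfold DD
  exact ((((AA_diff h).mul (BB_diff h)).mul (CC_diff h)).pow 2).div ((diff_eta h).pow 24) (pow_ne_zero _ (eta_ne h))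

end

section
open Filter Topology

lemma exp_pi_lim : Tendsto (fun τ : ℂ => exp (Real.pi * I * τ)) iinf (𝓝 0) := by
  rw [tendsto_zero_iff_norm_tendsto_zero]
  have h1 : ∀ τ : ℂ, ‖exp (Real.pi * I * τ)‖ = Real.exp (-(Real.pi * τ.im)) := by
    intro τ
    have := norm_exp_pi τ 1
    rw [ofReal_one, mul_one, mul_one] at this
    rw [this]; congr 1; ring
  simp only [h1]
  have h2 : Tendsto (fun τ : ℂ => Real.pi * τ.im) iinf atTop := Tendsto.const_mul_atTop Real.pi_pos tendsto_comap
  exact Real.tendsto_exp_neg_atTop_nhds_zero.comp h2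

lemma inv_one_add_lim : Tendsto (fun τ : ℂ => (1 + exp (Real.pi * I * τ))⁻¹) iinf (𝓝 1) := by
  have h := (tendsto_const_nhds (x := (1:ℂ)) (f := iinf)).add exp_pi_lim
  have := h.inv₀ (by simp)
  simpa using this

lemma tS_one (τ : ℂ) : exp (-(3 * Real.pi * I * τ / 4)) * tS 1 τ = (1 + exp (Real.pi * I * τ))⁻¹ := by
  have e1 : exp (-(3 * Real.pi * I * τ / 4)) * qp τ (((1:ℤ):ℂ)^2/2 - 1/8) = 1 := by
    rw [qp, ← Complex.exp_add]; refine Eq.trans ?_ Complex.exp_zero; congr 1; push_cast; ring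
  have e2 : qp τ (((1:ℤ):ℂ) - 1/2) = exp (Real.pi * I * τ) := by
    rw [qp]; congr 1; push_cast; ring
  rw [tS, ← mul_div_assoc, e1, e2, one_div]

lemma tS_zero (τ : ℂ) : exp (-(3 * Real.pi * I * τ / 4)) * tS 0 τ = (1 + exp (Real.pi * I * τ))⁻¹ := by
  have e1 : qp τ (((0:ℤ):ℂ)^2/2 - 1/8) = exp (-(Real.pi * I * τ)) * exp (3 * Real.pi * I * τ / 4) := by
    rw [qp, ← Complex.exp_add]; congr 1; push_cast; ring
  have e2 : qp τ (((0:ℤ):ℂ) - 1/2) = exp (-(Real.pi * I * τ)) := by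
    rw [qp]; congr 1; push_cast; ring
  rw [tS, e1, e2, Complex.exp_neg, Complex.exp_neg]
  have h1 := Complex.exp_ne_zero (Real.pi * I * τ)
  have h2 := Complex.exp_ne_zero (3 * Real.pi * I * τ / 4)
  generalize exp (Real.pi * I * τ) = x at *
  generalize exp (3 * Real.pi * I * τ / 4) = y at *
  by_cases hx : 1 + x = 0
  · have h3 : 1 + x⁻¹ = 0 := by
      rw [show x = -1 by linear_combination hx]; norm_num
    rw [hx, h3]; simp
  · have h3 : 1 + x⁻¹ = (1 + x) / x := by field_simp; ring
    rw [h3]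
    field_simp

lemma quad_ge (n : ℤ) : (3/4:ℝ) ≤ ((n:ℝ) - 1/2)^2 + |(n:ℝ) - 1/2| := by
  have := half_le_abs n
  have h2 := sq_abs ((n:ℝ) - 1/2)
  nlinarith

lemma quad_gt {n : ℤ} (h0 : n ≠ 0) (h1 : n ≠ 1) : (3/4:ℝ) < ((n:ℝ) - 1/2)^2 + |(n:ℝ) - 1/2| := by
  have h3 : (1/2:ℝ) < |(n:ℝ) - 1/2| := by
    rcases lt_or_ge 1 n with h | h
    · have : (2:ℝ) ≤ n := by exact_mod_cast h
      rw [abs_of_nonneg (by linarith)]; linarith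
    · have h' : n ≤ -1 := by omega
      have : (n:ℝ) ≤ -1 := by exact_mod_cast h'
      rw [abs_of_nonpos (by linarith)]; linarith
  have h2 := sq_abs ((n:ℝ) - 1/2)
  nlinarith

lemma tS_bd2 {τ : ℂ} (h : 1 ≤ τ.im) (n : ℤ) : ‖exp (-(3 * Real.pi * I * τ / 4)) * tS n τ‖ ≤
    2 * Real.exp (-(Real.pi * (((n:ℝ) - 1/2)^2 + |(n:ℝ) - 1/2| - 3/4)) * τ.im) := by
  rw [norm_mul]
  have h1 := tS_bd (by linarith : 0 < τ.im) n
  have h2 : ‖exp (-(3 * Real.pi * I * τ / 4))‖ = Real.exp (Real.pi * τ.im * (3/4)) := by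
    have := norm_exp_pi τ (-(3/4))
    rw [show -Real.pi * τ.im * (-(3/4)) = Real.pi * τ.im * (3/4) by ring] at this
    rw [← this]; congr 2; push_cast; ring
  have h3 : (1 - Real.exp (-Real.pi * τ.im))⁻¹ ≤ 2 := by
    apply inv_le_of_inv_le₀ (by norm_num)
    have e : Real.exp (-Real.pi * τ.im) ≤ Real.exp (-1) := Real.exp_le_exp.2 (by nlinarith [Real.pi_gt_three])
    have := Real.exp_neg_one_lt_half
    linarith
  rw [h2]
  calc _ ≤ Real.exp (Real.pi * τ.im * (3/4)) * (2 * Real.exp (-Real.pi * (τ.im * (((n:ℝ) - 1/2)^2 + |(n:ℝ) - 1/2|)))) := by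
        gcongr
        exact h1.trans (by gcongr)
    _ = _ := by
        rw [mul_left_comm, ← Real.exp_add]; congr 2; ring

lemma S3_lim : Tendsto (fun τ => exp (-(3 * Real.pi * I * τ / 4)) * S3 τ) iinf (𝓝 2) := by
  have hsum : ∑' n : ℤ, (if n = 0 ∨ n = 1 then (1:ℂ) else 0) = 2 := by
    rw [tsum_eq_sum (s := {0, 1})]
    · rw [Finset.sum_pair (by norm_num)]; norm_num
    · intro n hn
      simp only [Finset.mem_insert, Finset.mem_singleton] at hn
      simp [hn]
  rw [← hsum]
  have e : (fun τ => exp (-(3 * Real.pi * I * τ / 4)) * S3 τ) = fun τ => ∑' n : ℤ, exp (-(3 * Real.pi * I * τ / 4)) * tS n τ := by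
    ext τ; rw [tsum_mul_left]; rfl
  rw [e]
  apply tendsto_tsum_of_dominated_convergence (bound := fun n : ℤ => 2 * Real.exp (-(Real.pi * (((n:ℝ) - 1/2)^2 + |(n:ℝ) - 1/2| - 3/4))))
  · apply Summable.mul_left
    have h := (tS_bd_summable one_pos).mul_left ((1 - Real.exp (-Real.pi * 1)) * Real.exp (Real.pi * (3/4)))
    refine h.congr ?_
    intro n
    have := (exp_lt_one' one_pos).ne'
    rw [show -(Real.pi * (((n:ℝ) - 1/2)^2 + |(n:ℝ) - 1/2| - 3/4)) = Real.pi * (3/4) + -Real.pi * (1 * (((n:ℝ) - 1/2)^2 + |(n:ℝ) - 1/2|)) by ring, Real.exp_add]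
    generalize 1 - Real.exp (-Real.pi * 1) = x at *
    field_simp
  · intro n
    by_cases h0 : n = 0
    · subst h0
      simp only [tS_zero, true_or, if_true]
      exact inv_one_add_lim
    by_cases h1 : n = 1
    · subst h1
      simp only [tS_one, or_true, if_true]
      exact inv_one_add_lim
    simp only [h0, h1, or_self, if_false]
    apply squeeze_zero_norm' (a := fun τ : ℂ => 2 * Real.exp (-(Real.pi * (((n:ℝ) - 1/2)^2 + |(n:ℝ) - 1/2| - 3/4)) * τ.im))
    · filter_upwards [iinf_ev] with τ hτ
      exact tS_bd2 hτ n
    · have h2 := quad_gt h0 h1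
      have hp := Real.pi_pos
      have h3 : Tendsto (fun τ : ℂ => (Real.pi * (((n:ℝ) - 1/2)^2 + |(n:ℝ) - 1/2| - 3/4)) * τ.im) iinf atTop := Tendsto.const_mul_atTop (by apply mul_pos hp; linarith) tendsto_comap
      have h4 := (Real.tendsto_exp_neg_atTop_nhds_zero.comp h3).const_mul 2
      simpa [Function.comp_def] using h4
  · filter_upwards [iinf_ev] with τ hτ n
    refine (tS_bd2 hτ n).trans ?_
    gcongr
    have h2 := quad_ge n
    have hp := Real.pi_pos
    have : 0 ≤ Real.pi * (((n:ℝ) - 1/2)^2 + |(n:ℝ) - 1/2| - 3/4) := by apply mul_nonneg hp.le; linarith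
    nlinarith

lemma iinf_T : Tendsto (fun τ : ℂ => τ + 1) iinf iinf := by
  rw [iinf, tendsto_comap_iff]
  have : im ∘ (fun τ : ℂ => τ + 1) = im := by ext τ; simp
  rw [this]; exact tendsto_comap

lemma theta_summable {τ : ℂ} (h : 0 < τ.im) : Summable fun n : ℤ => exp (Real.pi * I * τ * ((n^2:ℝ):ℂ)) := by
  rw [← summable_norm_iff]
  simp only [norm_exp_pi]
  have := summable_poly_gauss 0 0 h (fun _ => 1) 1 (fun n => τ.im * (n:ℝ)^2) (by intro n; simp) (by intro n; simp)
  refine this.congr ?_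
  intro n
  rw [one_mul]; congr 1; ring

lemma sq_eq_one_iff_of_ne {n : ℤ} (h : (n:ℝ)^2 = 1) : n = 1 ∨ n = -1 := by
  have : n^2 = 1 := by exact_mod_cast h
  exact sq_eq_one_iff.1 this

lemma th34_lim : Tendsto (fun τ => exp (-(Real.pi * I * τ)) * (theta3 τ - theta4 τ)) iinf (𝓝 4) := by
  have h := qlim (fun n => 1 - (-1)^n) (fun n => |(n:ℝ)^2 - 1|) (fun n => abs_nonneg _) ?_
  · have hsum : ∑' n : ℤ, (if |(n:ℝ)^2 - 1| = 0 then (1 - (-1:ℂ)^n) else 0) = 4 := by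
      rw [tsum_eq_sum (s := {1, -1})]
      · norm_num
      · intro n hn
        simp only [Finset.mem_insert, Finset.mem_singleton] at hn
        rw [if_neg]
        intro h
        rw [abs_eq_zero, sub_eq_zero] at h
        exact hn (sq_eq_one_iff_of_ne h)
    rw [hsum] at h
    refine h.congr' ?_
    filter_upwards [iinf_ev] with τ hτ
    have hτ0 : 0 < τ.im := by linarith
    have s3 := theta_summable hτ0
    have s4 : Summable fun n : ℤ => (-1:ℂ)^n * exp (Real.pi * I * τ * ((n^2:ℝ):ℂ)) := by
      rw [← summable_norm_iff] at s3 ⊢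
      refine s3.congr ?_
      intro n
      simp
    have e3 : theta3 τ = ∑' n : ℤ, exp (Real.pi * I * τ * ((n^2:ℝ):ℂ)) := by
      unfold theta3 qp
      apply tsum_congr; intro n
      congr 1; push_cast; ring
    have e4 : theta4 τ = ∑' n : ℤ, (-1:ℂ)^n * exp (Real.pi * I * τ * ((n^2:ℝ):ℂ)) := by
      unfold theta4 qp
      apply tsum_congr; intro n
      congr 2; push_cast; ring
    rw [e3, e4, ← s3.tsum_sub s4, ← tsum_mul_left]
    apply tsum_congr; intro n
    by_cases hn : n = 0
    · subst hn; simp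
    · have h1 : (1:ℝ) ≤ (n:ℝ)^2 := by
        have : (1:ℤ) ≤ n^2 := by
          have := sq_nonneg n
          have : n^2 ≠ 0 := pow_ne_zero _ hn
          omega
        exact_mod_cast this
      rw [abs_of_nonneg (by linarith)]
      have e5 : exp (Real.pi * I * τ * (((n:ℝ)^2 - 1 : ℝ):ℂ)) = exp (-(Real.pi * I * τ)) * exp (Real.pi * I * τ * ((n^2:ℝ):ℂ)) := by
        rw [← Complex.exp_add]; congr 1; push_cast; ring
      rw [e5]; ring
  · refine summable_poly_gauss 1 (1/2) one_pos _ 2 _ ?_ ?_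
    · intro n
      rw [norm_norm]
      refine (norm_sub_le _ _).trans ?_
      have := abs_nonneg (n:ℝ)
      simp; linarith
    · intro n
      by_cases hn : n = 0
      · subst hn; simp
      · have h1 : (1:ℝ) ≤ |(n:ℝ)| := by exact_mod_cast Int.one_le_abs hn
        refine le_trans ?_ (le_abs_self _)
        linarith

lemma Tt_lim {f : ℂ → ℂ} {c : ℂ} (h : Tendsto f iinf (𝓝 c)) : Tendsto (fun τ => f (τ+1)) iinf (𝓝 c) := h.comp iinf_T

lemma AA_lim : Tendsto (fun τ => exp (-(Real.pi * I * τ)) * AA τ) iinf (𝓝 0) := by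
  have h2 := theta2_lim
  have h3 := theta3_lim
  have h4 := theta4_lim
  have h34 := th34_lim
  have hS := S3_lim
  have hS1 := Tt_lim S3_lim
  have key := (((h2.pow 4).const_mul 4).add ((h34.mul ((((h3.pow 3).add ((h3.pow 2).mul h4)).add (h3.mul (h4.pow 2))).add (h4.pow 3))).const_mul 2)).sub
    ((h2.const_mul 12).mul ((h4.mul hS).add (h3.mul hS1)))
  norm_num at key
  refine key.congr ?_
  intro τ
  rw [AA]
  have e1 : exp (-(3 * Real.pi * I * (τ+1) / 4)) = - exp (Real.pi * I / 4) * exp (-(3 * Real.pi * I * τ / 4)) := by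
    rw [neg_mul, ← neg_one_mul (_ * _), ← Complex.exp_pi_mul_I, ← Complex.exp_add, ← Complex.exp_add,  ← exp_two_pi_int (-1) (_ + _)]
    congr 1; push_cast; ring
  have e2 : exp (-(3 * Real.pi * I * τ / 4)) = exp (-(Real.pi * I * τ / 4))^3 := by
    rw [← Complex.exp_nat_mul]; congr 1; push_cast; ring
  have e3 : exp (-(Real.pi * I * τ)) = exp (-(Real.pi * I * τ / 4))^4 := by
    rw [← Complex.exp_nat_mul]; congr 1; push_cast; ring
  rw [e1, e2, e3]
  generalize exp (-(Real.pi * I * τ / 4)) = x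
  ring

lemma AA_O : AA =O[iinf] fun τ => Real.exp (-3 * Real.pi * τ.im) := by
  have h := Function.Periodic.exp_decay_of_zero_at_inf (h := 1) (f := fun τ => exp (-(Real.pi * I * τ)) * AA τ) one_pos ?_ ?_ AA_lim
  · have h2 : (fun τ : ℂ => exp (Real.pi * I * τ)) =O[iinf] fun τ => Real.exp (-Real.pi * τ.im) := by
      apply Asymptotics.IsBigO.of_norm_le
      intro τ
      have := norm_exp_pi τ 1
      rw [ofReal_one, mul_one, mul_one] at this
      rw [this]
    have h3 := h2.mul h
    refine (h3.congr_left ?_).congr_right ?_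
    · intro τ
      rw [← mul_assoc, ← Complex.exp_add]; simp
    · intro τ
      rw [← Real.exp_add]; congr 1; ring
  · intro τ
    dsimp only
    rw [ofReal_one, AA_T]
    have : exp (-(Real.pi * I * (τ+1))) = - exp (-(Real.pi * I * τ)) := by
      rw [← neg_one_mul (exp _), ← Complex.exp_pi_mul_I, ← Complex.exp_add, ← exp_two_pi_int (-1) (_ + _)]
      congr 1; push_cast; ring
    rw [this]; ring
  · have := iinf_ev
    filter_upwards [iinf_ev] with τ hτ
    have := AA_diff (show 0 < τ.im by linarith)
    fun_prop

end

section
open Filter Topology Asymptotics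

lemma summable_half : Summable fun n : ℤ => 1 / ((n:ℝ) - 1/2)^2 := by
  have := (Real.summable_one_div_int_add_rpow (-(1/2)) 2).2 (by norm_num)
  refine this.congr ?_
  intro n
  rw [show (2:ℝ) = ((2:ℕ):ℝ) by norm_num, Real.rpow_natCast, sq_abs]
  push_cast
  ring

lemma S3_crude : ∃ M : ℝ, 0 ≤ M ∧ ∀ w : ℂ, 0 < w.im → ‖S3 w‖ ≤ (1 + 1 / w.im) * (1 / w.im) * M := by
  refine ⟨∑' n : ℤ, 1 / ((n:ℝ) - 1/2)^2, tsum_nonneg (fun n => by positivity), ?_⟩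
  intro w hw
  rw [← tsum_mul_left]
  refine tsum_of_norm_bounded (summable_half.mul_left _).hasSum ?_
  intro n
  have hν := half_le_abs n
  have hν2 : 0 < ((n:ℝ) - 1/2)^2 := by
    rw [← sq_abs]; positivity
  have hp := Real.pi_gt_three
  refine (tS_bd hw n).trans ?_
  rw [mul_assoc]
  have h0 := exp_lt_one' hw
  apply mul_le_mul
  · have h1 : 1 + w.im ≤ Real.exp (Real.pi * w.im) := by
      have := Real.add_one_le_exp (Real.pi * w.im)
      nlinarith
    have h2 : Real.exp (-Real.pi * w.im) ≤ (1 + w.im)⁻¹ := by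
      rw [neg_mul, Real.exp_neg]
      exact inv_anti₀ (by positivity) h1
    have h3 : w.im / (1 + w.im) ≤ 1 - Real.exp (-Real.pi * w.im) := by
      have : w.im / (1 + w.im) = 1 - (1 + w.im)⁻¹ := by field_simp; ring
      rw [this]; linarith
    refine (inv_anti₀ (by positivity) h3).trans (le_of_eq ?_)
    field_simp; ring
  · have h1 : Real.exp (-Real.pi * (w.im * (((n:ℝ) - 1/2)^2 + |(n:ℝ) - 1/2|))) ≤ Real.exp (-(w.im * ((n:ℝ) - 1/2)^2)) := by
      apply Real.exp_le_exp.2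
      have a : 0 ≤ w.im * ((n:ℝ) - 1/2)^2 := by positivity
      have b : 0 ≤ w.im * |(n:ℝ) - 1/2| := by positivity
      nlinarith
    refine h1.trans ?_
    rw [one_div_mul_one_div, Real.exp_neg, one_div (w.im * _)]
    apply inv_anti₀ (by positivity)
    have := Real.add_one_le_exp (w.im * ((n:ℝ) - 1/2)^2)
    linarith
  · positivity
  · positivity

def FF : Filter ℂ := iinf ⊓ 𝓟 {z | |z.re| ≤ 1}

lemma FF_ev : ∀ᶠ τ : ℂ in FF, 1 ≤ τ.im ∧ |τ.re| ≤ 1 := by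
  apply Filter.Eventually.and
  · exact iinf_ev.filter_mono inf_le_left
  · exact (eventually_principal.2 (fun z hz => hz)).filter_mono inf_le_right

lemma norm_tau {τ : ℂ} (h : 1 ≤ τ.im ∧ |τ.re| ≤ 1) : ‖τ‖^2 ≤ 2 * τ.im^2 := by
  rw [Complex.sq_norm, normSq_apply]
  have := sq_abs τ.re
  nlinarith [h.1, h.2, abs_nonneg τ.re]

lemma im_neg_inv (τ : ℂ) : (-1/τ).im = τ.im / ‖τ‖^2 := by
  rw [Complex.sq_norm, neg_div, neg_im, div_im]; simp

lemma sqI_O : sqI =O[FF] fun τ => τ.im := by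
  apply IsBigO.of_bound 2
  filter_upwards [FF_ev] with τ h
  have h0 : 0 < τ.im := by linarith [h.1]
  have h1 : ‖sqI τ‖^2 = ‖τ‖ := by rw [← norm_pow, sqI_sq h0]; simp
  have h2 := norm_tau h
  rw [Real.norm_of_nonneg h0.le]
  have h3 : ‖τ‖ ≤ 2 * τ.im := by
    apply le_of_sq_le_sq _ (by positivity)
    nlinarith
  apply le_of_sq_le_sq _ (by positivity)
  rw [h1]
  nlinarith [h.1]

lemma inv_im_bd {τ : ℂ} (h : 1 ≤ τ.im ∧ |τ.re| ≤ 1) {M : ℝ} (hM : 0 ≤ M) {w : ℂ} (hw : w.im = τ.im / ‖τ‖^2) : (1 + 1 / w.im) * (1 / w.im) * M ≤ 6 * M * τ.im^2 := by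
  have h0 : 0 < τ.im := by linarith [h.1]
  have h1 : 1 / w.im ≤ 2 * τ.im := by
    rw [hw, one_div_div, div_le_iff₀ h0]
    have := norm_tau h
    linarith
  have h2 : 0 ≤ 1 / w.im := by rw [hw]; positivity
  have h3 : (1 + 1 / w.im) * (1 / w.im) ≤ 6 * τ.im^2 := by nlinarith [h.1]
  nlinarith

lemma S3S_O : (fun τ => S3 (-1/τ)) =O[FF] fun τ => τ.im^2 := by
  obtain ⟨M, hM, hb⟩ := S3_crude
  apply IsBigO.of_bound (6 * M)
  filter_upwards [FF_ev] with τ h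
  have h0 : 0 < τ.im := by linarith [h.1]
  rw [Real.norm_of_nonneg (by positivity)]
  exact (hb _ (im_S h0)).trans (inv_im_bd h hM (im_neg_inv τ))

lemma S3ST_O : (fun τ => S3 (-1/τ+1)) =O[FF] fun τ => τ.im^2 := by
  obtain ⟨M, hM, hb⟩ := S3_crude
  apply IsBigO.of_bound (6 * M)
  filter_upwards [FF_ev] with τ h
  have h0 : 0 < τ.im := by linarith [h.1]
  rw [Real.norm_of_nonneg (by positivity)]
  exact (hb _ (im_T (im_S h0))).trans (inv_im_bd h hM (by rw [add_im, one_im, add_zero, im_neg_inv]))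

lemma thS_O {f : ℂ → ℂ} {c : ℂ} {g : ℂ → ℂ} (hf : Tendsto f iinf (𝓝 c)) (hg : ∀ τ : ℂ, 0 < τ.im → g (-1/τ) = sqI τ * f τ) :
    (fun τ => g (-1/τ)) =O[FF] fun τ => τ.im := by
  have h1 : f =O[FF] fun _ => (1:ℝ) := (hf.mono_left inf_le_left).isBigO_one ℝ
  have h2 := sqI_O.mul h1
  simp only [mul_one] at h2
  refine h2.congr' ?_ (EventuallyEq.refl _ _)
  filter_upwards [FF_ev] with τ h
  rw [hg τ (by linarith [h.1])]

lemma theta2_lim0 : Tendsto theta2 iinf (𝓝 0) := by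
  have h1 := theta2_lim
  have h2 : Tendsto (fun τ : ℂ => exp (Real.pi * I * τ / 4)) iinf (𝓝 0) := by
    have := exp_pi_lim.norm
    rw [tendsto_zero_iff_norm_tendsto_zero]
    have h3 : Tendsto (fun τ : ℂ => Real.pi / 4 * τ.im) iinf atTop := Tendsto.const_mul_atTop (by positivity) tendsto_comap
    refine (Real.tendsto_exp_neg_atTop_nhds_zero.comp h3).congr ?_
    intro τ
    have := norm_exp_pi τ (1/4)
    rw [show Real.pi * I * τ / 4 = Real.pi * I * τ * ((1/4:ℝ):ℂ) by push_cast; ring, this]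
    simp only [Function.comp]; congr 1; ring
  have h3 := h2.mul h1
  rw [zero_mul] at h3
  refine h3.congr ?_
  intro τ
  rw [← mul_assoc, ← Complex.exp_add]; simp

lemma im_pow_le {m n : ℕ} (h : m ≤ n) : (fun τ : ℂ => τ.im^m) =O[FF] fun τ => τ.im^n := by
  apply IsBigO.of_bound 1
  filter_upwards [FF_ev] with τ hτ
  have : 0 < τ.im := by linarith [hτ.1]
  rw [one_mul, Real.norm_of_nonneg (by positivity), Real.norm_of_nonneg (by positivity)]
  exact pow_le_pow_right₀ hτ.1 h

lemma AAS_O : (fun τ => AA (-1/τ)) =O[FF] fun τ => τ.im^4 := by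
  have h2 := thS_O theta4_lim (fun τ h => theta2_S h)
  have h3 := thS_O theta3_lim (fun τ h => theta3_S h)
  have h4 := thS_O theta2_lim0 (fun τ h => theta4_S h)
  have hm : (fun τ : ℂ => 12 * theta2 (-1/τ) * (theta4 (-1/τ) * S3 (-1/τ) - exp (Real.pi * I / 4) * theta3 (-1/τ) * S3 (-1/τ+1))) =O[FF] fun τ => τ.im^4 := by
    have a := (h2.const_mul_left 12).mul ((h4.mul S3S_O).sub ((h3.const_mul_left (exp (Real.pi * I / 4))).mul S3ST_O))
    refine a.congr_right ?_
    intro τ; ring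
  exact (((h2.pow 4).const_mul_left 4).add (((h3.pow 4).sub (h4.pow 4)).const_mul_left 2)).sub hm

lemma BB_O : BB =O[FF] fun τ => τ.im^4 := by
  have h1 : (fun τ : ℂ => (τ^2)⁻¹) =O[FF] fun _ => (1:ℝ) := by
    apply IsBigO.of_bound 1
    filter_upwards [FF_ev] with τ hτ
    have h2 : 1 ≤ ‖τ‖ := by
      have := Complex.abs_im_le_norm τ
      have := le_abs_self τ.im
      linarith [hτ.1]
    rw [norm_inv, norm_pow]
    simp only [norm_one, mul_one]
    apply inv_le_one_of_one_le₀
    nlinarith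
  have := h1.mul AAS_O
  simp only [one_mul] at this
  exact this

lemma AA_O' : AA =O[FF] fun τ => Real.exp (-3 * Real.pi * τ.im) := AA_O.mono inf_le_left

lemma CC_O : CC =O[FF] fun τ => τ.im^4 := by
  refine BB_O.sub (AA_O'.trans ?_)
  refine IsBigO.trans ?_ (im_pow_le (m := 0) (n := 4) (by norm_num))
  apply IsBigO.of_bound 1
  filter_upwards [FF_ev] with τ hτ
  simp only [pow_zero, norm_one, mul_one, Real.norm_eq_abs, Real.abs_exp]
  apply Real.exp_le_one_iff.2
  nlinarith [Real.pi_pos, hτ.1]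

lemma eta24_O : (fun τ => (etaDedekind τ ^ 24)⁻¹) =O[FF] fun τ => Real.exp (2 * Real.pi * τ.im) := by
  have h1 := ((eta3_lim.pow 8).inv₀ (by norm_num)).mono_left (inf_le_left (b := 𝓟 {z : ℂ | |z.re| ≤ 1}))
  have h2 := h1.isBigO_one ℝ
  have h3 : (fun τ : ℂ => exp (-(2 * Real.pi * I * τ))) =O[FF] fun τ => Real.exp (2 * Real.pi * τ.im) := by
    apply IsBigO.of_norm_le
    intro τ
    have := norm_exp_pi τ (-2)
    rw [show -(2 * Real.pi * I * τ) = Real.pi * I * τ * ((-2:ℝ):ℂ) by push_cast; ring, this]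
    apply le_of_eq; congr 1; ring
  have h4 := h3.mul h2
  refine (h4.congr_right (fun τ => mul_one _)).congr_left ?_
  intro τ
  rw [mul_pow, ← Complex.exp_nat_mul, mul_inv, ← mul_assoc, ← Complex.exp_neg, ← Complex.exp_add, ← pow_mul]
  rw [show -(2 * Real.pi * I * τ) + -(((8:ℕ):ℂ) * -(Real.pi * I * τ / 4)) = 0 by push_cast; ring, Complex.exp_zero, one_mul]

lemma DD_lim : Tendsto DD FF (𝓝 0) := by
  have h1 := (((AA_O'.mul BB_O).mul CC_O).pow 2).mul eta24_O
  refine IsBigO.trans_tendsto (h1.congr_left (fun τ => (div_eq_mul_inv _ _).symm)) ?_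
  have h2 : Tendsto (fun τ : ℂ => τ.im) FF atTop := tendsto_comap.mono_left inf_le_left
  have h3 := (Real.tendsto_pow_mul_exp_neg_atTop_nhds_zero 16).comp h2
  refine squeeze_zero' (g := fun τ : ℂ => τ.im ^ 16 * Real.exp (-τ.im)) ?_ ?_ h3
  · filter_upwards [FF_ev] with τ h
    positivity
  · filter_upwards [FF_ev] with τ h
    have e : (Real.exp (-3 * Real.pi * τ.im) * τ.im^4 * τ.im^4)^2 * Real.exp (2 * Real.pi * τ.im) = τ.im^16 * Real.exp (-4 * Real.pi * τ.im) := by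
      rw [mul_pow, mul_pow, ← Real.exp_nat_mul, show -4 * Real.pi * τ.im = ((2:ℕ):ℝ) * (-3 * Real.pi * τ.im) + 2 * Real.pi * τ.im by push_cast; ring, Real.exp_add]
      ring
    rw [e]
    gcongr
    nlinarith [Real.pi_gt_three, h.1]

lemma DD_zero {τ : ℂ} (h : 0 < τ.im) : DD τ = 0 :=
  levelOne_const DD (fun _ hz => DD_diff hz) (fun _ hz => DD_T hz) (fun _ hz => DD_S hz) 0 DD_lim τ h

lemma mul_zero_dich {f g : ℂ → ℂ} (hf : ∀ z : ℂ, 0 < z.im → DifferentiableAt ℂ f z) (hg : ∀ z : ℂ, 0 < z.im → DifferentiableAt ℂ g z)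
    (h : ∀ z : ℂ, 0 < z.im → f z * g z = 0) : (∀ z : ℂ, 0 < z.im → f z = 0) ∨ (∀ z : ℂ, 0 < z.im → g z = 0) := by
  have ha : ∀ f : ℂ → ℂ, (∀ z : ℂ, 0 < z.im → DifferentiableAt ℂ f z) → AnalyticOnNhd ℂ f {w | 0 < w.im} := by
    intro f hf
    apply DifferentiableOn.analyticOnNhd _ isOpen_H
    intro z hz
    exact (hf z hz).differentiableWithinAt
  by_cases h0 : ∃ᶠ z in 𝓝[≠] I, f z = 0
  · left
    intro z hz
    exact (ha f hf).eqOn_zero_of_preconnected_of_frequently_eq_zero preconn_H (z₀ := I) (by simp) h0 hz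
  · right
    intro z hz
    refine (ha g hg).eqOn_zero_of_preconnected_of_frequently_eq_zero preconn_H (z₀ := I) (by simp) ?_ hz
    rw [not_frequently] at h0
    apply Eventually.frequently
    have h1 : ∀ᶠ z : ℂ in 𝓝[≠] I, 0 < z.im := nhdsWithin_le_nhds (isOpen_H.mem_nhds (by simp))
    filter_upwards [h0, h1] with z hz hz1
    exact (mul_eq_zero.1 (h z hz1)).resolve_left hz

lemma AA_zero {τ : ℂ} (h : 0 < τ.im) : AA τ = 0 := by
  have hB : (∀ z : ℂ, 0 < z.im → BB z = 0) → AA τ = 0 := by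
    intro hB
    have := BB_S h
    rw [hB _ (im_S h)] at this
    have h0 : τ^2 ≠ 0 := pow_ne_zero _ (tau_ne h)
    exact (mul_eq_zero.1 this.symm).resolve_left h0
  have h1 : ∀ z : ℂ, 0 < z.im → (AA z * BB z) * CC z = 0 := by
    intro z hz
    have := DD_zero hz
    rw [DD, div_eq_zero_iff] at this
    exact pow_eq_zero_iff (two_ne_zero) |>.1 (this.resolve_right (pow_ne_zero _ (eta_ne hz)))
  rcases mul_zero_dich (fun z hz => (AA_diff hz).mul (BB_diff hz)) (fun z hz => CC_diff hz) h1 with h2 | h2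
  · rcases mul_zero_dich (fun z hz => AA_diff hz) (fun z hz => BB_diff hz) h2 with h3 | h3
    · exact h3 τ h
    · exact hB h3
  · apply hB
    intro z hz
    rw [← CC_T hz]
    exact h2 _ (im_T hz)

lemma Hhat_T {τ : ℂ} (h : 0 < τ.im) : Hhat (τ+1) = exp (-(Real.pi:ℂ) * I / 4) * Hhat τ := by
  have h1 := Phi_sub h
  rw [AA_zero h, Phi, Phi, eta3_T] at h1
  have h2 := eta_ne h
  rw [exp_neg_pi4]
  have h3 : exp (Real.pi * I / 4) ≠ 0 := Complex.exp_ne_zero _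
  generalize exp (Real.pi * I / 4) = x at *
  have h4 : etaDedekind τ ^ 3 * (Hhat τ - x * Hhat (τ+1)) = 0 := by linear_combination h1
  have h5 := (mul_eq_zero.1 h4).resolve_left (pow_ne_zero _ h2)
  field_simp
  linear_combination -h5

end

/-- `Ĥ` transforms as a non-holomorphic modular form of weight `(1/2, 0)` for `SL(2,ℤ)`:
`Ĥ(τ+1) = e^{−πi/4} Ĥ(τ)` and `Ĥ(−1/τ) = −√(−iτ) Ĥ(τ)` (principal square root). -/
theorem Hhat_modular (τ : ℂ) (hτ : 0 < τ.im) :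
    Hhat (τ + 1) = Complex.exp (-(Real.pi : ℂ) * Complex.I / 4) * Hhat τ ∧
    Hhat (-1 / τ) = -((-Complex.I * τ) ^ ((1 : ℂ) / 2)) * Hhat τ := by
  exact ⟨Hhat_T hτ, Hhat_S hτ⟩
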